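/- If a finite-dimensional simple Lie algebra S over k possesses a faithful irreducible representation of dimension at most p − 1, then S is either a classical simple Lie algebra or the Witt algebra W(1). -/

import Mathlib

/-!
The truncated polynomial ring `A(n) = k[X₁,…,Xₙ]/(X₁^p,…,Xₙ^p)`, its partial derivatives,
the Jacobson–Witt algebra `W(n) = Der(A(n))`, and related Lie algebras of Cartan type.
-/

set_option synthInstance.maxHeartbeats 1000000
set_option maxHeartbeats 1600000

section Trunc

variable (p : ℕ) (k : Type*) [Field k] (n : ℕ)

/-- The defining ideal `(X₁^p, …, Xₙ^p)`. -/
noncomputable abbrev truncIdeal : Ideal (MvPolynomial (Fin n) k) :=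
  Ideal.span {f | ∃ i : Fin n, f = MvPolynomial.X i ^ p}

/-- The truncated polynomial ring `A(n) := k[X₁,…,Xₙ]/(X₁^p,…,Xₙ^p)`. -/
noncomputable abbrev TruncPoly := MvPolynomial (Fin n) k ⧸ truncIdeal p k n

variable [CharP k p]

theorem pderiv_mem_truncIdeal (i : Fin n) {f : MvPolynomial (Fin n) k}
    (hf : f ∈ truncIdeal p k n) : MvPolynomial.pderiv i f ∈ truncIdeal p k n := by
  induction hf using Submodule.span_induction with
  | mem x hx =>
    obtain ⟨j, rfl⟩ := hx
    have h0 : (p : MvPolynomial (Fin n) k) = 0 := CharP.cast_eq_zero _ p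
    rw [Derivation.leibniz_pow]
    rw [nsmul_eq_mul, h0, zero_mul]
    exact Ideal.zero_mem _
  | zero => simp only [map_zero]; exact Ideal.zero_mem _
  | add x y _ _ hx hy => rw [map_add]; exact Ideal.add_mem _ hx hy
  | smul a x hxmem hx =>
    rw [smul_eq_mul, Derivation.leibniz, smul_eq_mul, smul_eq_mul]
    exact Ideal.add_mem _ (Ideal.mul_mem_left _ _ hx) (Ideal.mul_mem_right _ _ hxmem)

/-- The partial derivative `∂/∂Xᵢ` on the truncated polynomial ring, as a derivation. -/
noncomputable def truncPD (i : Fin n) :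
    Derivation k (TruncPoly p k n) (TruncPoly p k n) where
  toFun := fun a => Quotient.liftOn' a
    (fun f => Ideal.Quotient.mk (truncIdeal p k n) (MvPolynomial.pderiv i f))
    (by
      intro f g hfg
      rw [Submodule.quotientRel_def] at hfg
      rw [Ideal.Quotient.eq]
      rw [← map_sub]
      exact pderiv_mem_truncIdeal p k n i hfg)
  map_add' := by
    rintro ⟨f⟩ ⟨g⟩
    show Ideal.Quotient.mk _ (MvPolynomial.pderiv i (f + g)) =
      Ideal.Quotient.mk _ (MvPolynomial.pderiv i f) +
        Ideal.Quotient.mk _ (MvPolynomial.pderiv i g)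
    rw [map_add, map_add]
  map_smul' := by
    rintro c ⟨f⟩
    show Ideal.Quotient.mkₐ k (truncIdeal p k n) (MvPolynomial.pderiv i (c • f)) =
      c • Ideal.Quotient.mkₐ k (truncIdeal p k n) (MvPolynomial.pderiv i f)
    rw [Derivation.map_smul, map_smul]
  map_one_eq_zero' := by
    show Ideal.Quotient.mk (truncIdeal p k n) (MvPolynomial.pderiv i 1) = 0
    simp only [Derivation.map_one_eq_zero, map_zero]
  leibniz' := by
    rintro ⟨f⟩ ⟨g⟩
    show Ideal.Quotient.mk (truncIdeal p k n) (MvPolynomial.pderiv i (f * g)) =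
      (Ideal.Quotient.mk (truncIdeal p k n) f) *
          (Ideal.Quotient.mk (truncIdeal p k n) (MvPolynomial.pderiv i g)) +
        (Ideal.Quotient.mk (truncIdeal p k n) g) *
          (Ideal.Quotient.mk (truncIdeal p k n) (MvPolynomial.pderiv i f))
    rw [Derivation.leibniz, smul_eq_mul, smul_eq_mul, map_add, map_mul, map_mul]

/-- The image of the variable `Xᵢ` in the truncated polynomial ring. -/
noncomputable def truncX (i : Fin n) : TruncPoly p k n :=
  Ideal.Quotient.mk (truncIdeal p k n) (MvPolynomial.X i)

end Trunc
/-- The weight space of a linear character `χ` of a subalgebra `t` on the adjoint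
module. -/
def charWeightSpace (k : Type*) [Field k] {L : Type*} [LieRing L] [LieAlgebra k L]
    (t : LieSubalgebra k L) (χ : t →ₗ[k] k) (V : Type*) [AddCommGroup V]
    [Module k V] [LieRingModule L V] [LieModule k L V] : Submodule k V where
  carrier := {v | ∀ x : t, ⁅(x : L), v⁆ = χ x • v}
  add_mem' := by
    intro a b ha hb x
    rw [lie_add, ha x, hb x, smul_add]
  zero_mem' := by
    intro x
    rw [lie_zero, smul_zero]
  smul_mem' := by
    intro c a ha x
    rw [lie_smul, ha x, smul_comm]

/-- A *classical* simple Lie algebra in the sense of Seligman: `[L,L] = L`, the center is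
trivial, and `L` has an abelian Cartan subalgebra `H` such that (a) `L` is the sum of its
weight spaces relative to `H`; (b) for every nonzero root `α`, `[L_α, L_{−α}]` is
one-dimensional; (c) for all roots `α, β` with `β ≠ 0`, not every `α + mβ` is a root.
For `p > 3` these are exactly the Lie algebras obtained by reduction mod `p` from the
simple Lie algebras in characteristic `0` (possibly modulo their centers). -/
def IsClassicalSimpleLieAlgebra (k : Type*) [Field k] (L : Type*) [LieRing L]
    [LieAlgebra k L] : Prop :=
  LieAlgebra.derivedSeries k L 1 = ⊤ ∧
  LieAlgebra.center k L = ⊥ ∧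
  ∃ H : LieSubalgebra k L, H.IsCartanSubalgebra ∧ IsLieAbelian H ∧
    (⨆ χ : (H : LieSubalgebra k L) →ₗ[k] k, charWeightSpace k H χ L) = ⊤ ∧
    (∀ χ : (H : LieSubalgebra k L) →ₗ[k] k, χ ≠ 0 → charWeightSpace k H χ L ≠ ⊥ →
      Module.finrank k (Submodule.span k {z : L | ∃ x ∈ charWeightSpace k H χ L,
        ∃ y ∈ charWeightSpace k H (-χ) L, z = ⁅x, y⁆}) = 1) ∧
    (∀ χ β : (H : LieSubalgebra k L) →ₗ[k] k, charWeightSpace k H χ L ≠ ⊥ →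
      charWeightSpace k H β L ≠ ⊥ → β ≠ 0 →
      ∃ m : ℕ, charWeightSpace k H (χ + m • β) L = ⊥)

section Witt

variable (p : ℕ) (k : Type*) [Field k] [CharP k p]

/-- The Witt algebra `W(1) := Der(k[X]/(X^p))`. -/
noncomputable abbrev WittAlg (n : ℕ) :=
  Derivation k (TruncPoly p k n) (TruncPoly p k n)

end Witt

set_option linter.all false
section Main
open LieModule (toEnd toEnd_apply_apply)
open AddSubgroup (zmultiples mem_zmultiples zmultiples_neg add_mem_cancel_right)
open Submodule (smul_mem mem_bot span subset_span span_induction span_le mem_sup_right mem_sup_left exists_mem_ne_zero_of_ne_bot mem_sup mem_span_singleton mem_span_singleton_self span_mono smul_mem_iff)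
open Module (finrank Dual Basis)
open Nat (cast_smul_eq_nsmul not_dvd_of_pos_of_lt mod_modEq le_induction factorial choose_one_right ModEq)
open CharP (cast_eq_zero cast_eq_zero_iff cast_eq_iff_mod_eq)
open Finset (sum_congr)
open LinearMap (congr_fun)
attribute [local instance] LieRing.ofAssociativeRing
section EJ
universe u v
variable {k : Type u} [Field k]
theorem ej_P {V : Type v} [AddCommGroup V] [Module k V] [FiniteDimensional k V] (E : Set (Module.End k V)) (hZ : ∀ Z : Submodule k V, (∀ a ∈ E, ∀ z ∈ Z, a z ∈ Z) → Z ≠ ⊤ → ∃ w, w ∉ Z ∧ ∀ a ∈ E, a w ∈ Z) (P : V → Prop) (h0 : ¬ P 0) (v : V) (hv : P v) : ∃ w, P w ∧ ∀ a ∈ E, ¬ P (a w) := by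
  classical
  by_contra hcon
  push Not at hcon
  let A : Set (Submodule k V) := {Z | (∀ a ∈ E, ∀ z ∈ Z, a z ∈ Z) ∧ ∀ z ∈ Z, ¬ P z}
  have hne : A.Nonempty := ⟨⊥, by
    refine ⟨?_, ?_⟩
    · intro a _ z hz
      rw [mem_bot] at hz ⊢
      rw [hz, map_zero]
    · intro z hz
      rw [mem_bot] at hz
      rw [hz]; exact h0⟩
  obtain ⟨Z, ⟨hZE, hZP⟩, hmax⟩ := (wellFounded_gt (α := Submodule k V)).has_min A hne
  have hZt : Z ≠ ⊤ := by
    rintro rfl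
    exact hZP v trivial hv
  obtain ⟨w, hw, hwE⟩ := hZ Z hZE hZt
  let Z' : Submodule k V :=
    { carrier := {x | x ∈ Z ∨ True ∧ ∀ a ∈ E, a x ∈ Z}
      add_mem' := by
        intro x y hx hy
        right
        refine ⟨trivial, fun a ha => ?_⟩
        rw [map_add]
        exact Z.add_mem (hx.elim (fun h => hZE a ha _ h) (fun h => h.2 a ha))
          (hy.elim (fun h => hZE a ha _ h) (fun h => h.2 a ha))
      zero_mem' := Or.inl Z.zero_mem
      smul_mem' := by
        intro c x hx
        right
        refine ⟨trivial, fun a ha => ?_⟩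
        rw [map_smul]
        exact Z.smul_mem c (hx.elim (fun h => hZE a ha _ h) (fun h => h.2 a ha)) }
  have hin : ∀ x ∈ Z', ∀ a ∈ E, a x ∈ Z := by
    intro x hx a ha
    exact hx.elim (fun h => hZE a ha _ h) (fun h => h.2 a ha)
  have hZ'A : Z' ∈ A := by
    refine ⟨fun a ha z hz => Or.inl (hin z hz a ha), fun z hz hPz => ?_⟩
    obtain ⟨a, ha, hPa⟩ := hcon z hPz
    exact hZP _ (hin z hz a ha) hPa
  refine hmax Z' hZ'A (lt_of_le_of_ne (fun x hx => Or.inl hx) ?_)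
  intro h
  apply hw
  rw [h]
  exact Or.inr ⟨trivial, hwE⟩
theorem ej_Z (d : ℕ) : ∀ (V : Type v) [AddCommGroup V] [Module k V] [FiniteDimensional k V] (E : Set (Module.End k V)) (_ : ∀ a ∈ E, ∀ b ∈ E, a * b - b * a ∈ E) (_ : ∀ a ∈ E, IsNilpotent a) (_ : finrank k (span k E) ≤ d) (Z : Submodule k V), (∀ a ∈ E, ∀ z ∈ Z, a z ∈ Z) → Z ≠ ⊤ → ∃ w, w ∉ Z ∧ ∀ a ∈ E, a w ∈ Z := by
  classical
  induction d with
  | zero =>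
    intro V _ _ _ E _ _ hd Z _ hZt
    obtain ⟨w, hw⟩ : ∃ w, w ∉ Z := by
      by_contra hc; push Not at hc
      exact hZt (eq_top_iff.2 fun x _ => hc x)
    refine ⟨w, hw, fun a ha => ?_⟩
    have hb : span k E = ⊥ := Submodule.finrank_eq_zero.1 (Nat.le_zero.1 hd)
    have : a ∈ span k E := subset_span ha
    rw [hb, mem_bot] at this
    rw [this]; exact Z.zero_mem
  | succ d ih =>
    intro V _ _ _ E hE hnil hd Z hZE hZt
    by_cases hE0 : span k E = ⊥
    · refine ih V E hE hnil ?_ Z hZE hZt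
      rw [hE0]; simp
    let A : Set (Submodule k (Module.End k V)) := {U | ∃ F ⊆ E, (∀ a ∈ F, ∀ b ∈ F, a * b - b * a ∈ F) ∧ U = span k F ∧ U < span k E}
    have hAne : A.Nonempty := ⟨⊥, ∅, by simp, by simp, by simp, bot_lt_iff_ne_bot.2 hE0⟩
    obtain ⟨U, ⟨F, hFE, hFc, rfl, hlt⟩, hmax⟩ :=
      (wellFounded_gt (α := Submodule k (Module.End k V))).has_min A hAne
    set U := span k F with hU
    have hdU : finrank k U ≤ d := by
      have := Submodule.finrank_lt_finrank_of_lt hlt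
      omega
    have hUU : ∀ a ∈ U, ∀ b ∈ U, a * b - b * a ∈ U := by
      intro a ha b hb
      induction ha using span_induction with
      | mem a ha =>
        induction hb using span_induction with
        | mem b hb => exact subset_span (hFc a ha b hb)
        | zero => simp
        | add x y _ _ hx hy =>
          have : a * (x + y) - (x + y) * a = (a * x - x * a) + (a * y - y * a) := by noncomm_ring
          rw [this]; exact U.add_mem hx hy
        | smul c x _ hx =>
          have : a * (c • x) - (c • x) * a = c • (a * x - x * a) := by rw [mul_smul_comm, smul_mul_assoc, smul_sub]
          rw [this]; exact U.smul_mem c hx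
      | zero => simp
      | add x y _ _ hx hy =>
        have : (x + y) * b - b * (x + y) = (x * b - b * x) + (y * b - b * y) := by noncomm_ring
        rw [this]; exact U.add_mem hx hy
      | smul c x _ hx =>
        have : (c • x) * b - b * (c • x) = c • (x * b - b * x) := by rw [mul_smul_comm, smul_mul_assoc, smul_sub]
        rw [this]; exact U.smul_mem c hx
    let adl : Module.End k V →ₗ[k] Module.End k (Module.End k V) :=
      LinearMap.mul k (Module.End k V) - (LinearMap.mul k (Module.End k V)).flip
    have adl_apply : ∀ a b, adl a b = a * b - b * a := fun a b => by simp [adl]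
    have hadnil : ∀ a, IsNilpotent a → IsNilpotent (adl a) := by
      intro a ha
      have h1 := LieAlgebra.ad_nilpotent_of_nilpotent (R := k) ha
      have h2 : adl a = LieAlgebra.ad k (Module.End k V) a := by ext b; rw [adl_apply]; rfl
      rw [h2]; exact h1
    have key := ih (Module.End k V) (adl '' F)
      (by
        rintro _ ⟨a, ha, rfl⟩ _ ⟨b, hb, rfl⟩
        refine ⟨_, hFc a ha b hb, ?_⟩
        refine LinearMap.ext fun x => ?_
        simp only [adl_apply, LinearMap.sub_apply, Module.End.mul_apply]
        noncomm_ring)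
      (by
        rintro _ ⟨a, ha, rfl⟩
        exact hadnil a (hnil a (hFE ha)))
      (by
        rw [Submodule.span_image]
        exact (Submodule.finrank_map_le _ _).trans hdU)
    obtain ⟨e0, he0E, he0U⟩ : ∃ e ∈ E, e ∉ U := by
      by_contra hc; push Not at hc
      exact absurd (span_le.2 (fun x hx => hc x hx)) (not_le_of_gt hlt)
    obtain ⟨e, ⟨heE, heU⟩, heF⟩ := ej_P (adl '' F) key (fun x => x ∈ E ∧ x ∉ U)
      (by simp) e0 ⟨he0E, he0U⟩
    have heF' : ∀ a ∈ F, a * e - e * a ∈ U := by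
      intro a ha
      have := heF _ ⟨a, ha, rfl⟩
      rw [adl_apply] at this
      by_contra hc
      exact this ⟨hE a (hFE ha) e heE, hc⟩
    have heU' : ∀ a ∈ U, a * e - e * a ∈ U := by
      intro a ha
      induction ha using span_induction with
      | mem a ha => exact heF' a ha
      | zero => simp
      | add x y _ _ hx hy =>
        have : (x + y) * e - e * (x + y) = (x * e - e * x) + (y * e - e * y) := by noncomm_ring
        rw [this]; exact U.add_mem hx hy
      | smul c x _ hx =>
        have : (c • x) * e - e * (c • x) = c • (x * e - e * x) := by rw [mul_smul_comm, smul_mul_assoc, smul_sub]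
        rw [this]; exact U.smul_mem c hx
    let F' : Set (Module.End k V) := {a | a ∈ E ∧ a ∈ U} ∪ {e}
    have hF'E : F' ⊆ E := by
      rintro x (hx | hx)
      · exact hx.1
      · rw [Set.mem_singleton_iff] at hx; rw [hx]; exact heE
    have hF'c : ∀ a ∈ F', ∀ b ∈ F', a * b - b * a ∈ F' := by
      rintro a ha b hb
      left
      refine ⟨hE a (hF'E ha) b (hF'E hb), ?_⟩
      rcases ha with ha | ha <;> rcases hb with hb | hb
      · exact hUU a ha.2 b hb.2
      · rw [Set.mem_singleton_iff] at hb; rw [hb]; exact heU' a ha.2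
      · rw [Set.mem_singleton_iff] at ha; rw [ha]
        have := U.neg_mem (heU' b hb.2)
        rwa [neg_sub] at this
      · rw [Set.mem_singleton_iff] at ha hb; rw [ha, hb]; simp
    have hUF' : U < span k F' := by
      refine lt_of_le_of_ne (span_mono ?_) ?_
      · intro x hx; exact Or.inl ⟨hFE hx, subset_span hx⟩
      · intro h
        apply heU
        rw [h]; exact subset_span (Or.inr rfl)
    have hspan : span k F' = span k E := by
      by_contra hne
      exact hmax _ ⟨F', hF'E, hF'c, rfl, lt_of_le_of_ne (span_mono hF'E) hne⟩ hUF'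
    obtain ⟨w0, hw0, hw0F⟩ := ih V F hFc (fun a ha => hnil a (hFE ha)) hdU Z
      (fun a ha => hZE a (hFE ha)) hZt
    have hw0U : ∀ a ∈ U, a w0 ∈ Z := by
      intro a ha
      induction ha using span_induction with
      | mem a ha => exact hw0F a ha
      | zero => simp
      | add x y _ _ hx hy => exact Z.add_mem hx hy
      | smul c x _ hx => exact Z.smul_mem c hx
    have hpow : ∀ n, ∀ a ∈ U, a ((e ^ n) w0) ∈ Z := by
      intro n
      induction n with
      | zero => simpa using hw0U
      | succ n ihn =>
        intro a ha
        have h1 : a ((e ^ (n + 1)) w0) = (a * e - e * a) ((e ^ n) w0) + e (a ((e ^ n) w0)) := by rw [pow_succ']; simp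
        rw [h1]
        exact Z.add_mem (ihn _ (heU' a ha)) (hZE e heE _ (ihn a ha))
    obtain ⟨N, hN⟩ := hnil e heE
    have hex : ∃ n, (e ^ n) w0 ∈ Z := ⟨N, by rw [hN]; simp⟩
    have hfind := Nat.find_spec hex
    have hmin := fun m => @Nat.find_min _ _ hex m
    obtain ⟨n, hn⟩ : ∃ n, Nat.find hex = n + 1 := by
      refine Nat.exists_eq_succ_of_ne_zero ?_
      intro h
      rw [h] at hfind
      exact hw0 (by simpa using hfind)
    rw [hn] at hfind
    refine ⟨(e ^ n) w0, hmin n (by omega), ?_⟩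
    have hfin : ∀ a ∈ span k F', a ((e ^ n) w0) ∈ Z := by
      intro a ha'
      induction ha' using span_induction with
      | mem a ha =>
        rcases ha with ha | ha
        · exact hpow n a ha.2
        · rw [Set.mem_singleton_iff] at ha; rw [ha]
          rw [pow_succ'] at hfind
          exact hfind
      | zero => simp
      | add x y _ _ hx hy => exact Z.add_mem hx hy
      | smul c x _ hx => exact Z.smul_mem c hx
    intro a ha
    exact hfin a (by rw [hspan]; exact subset_span ha)
theorem ej {V : Type v} [AddCommGroup V] [Module k V] [FiniteDimensional k V] (E : Set (Module.End k V)) (hE : ∀ a ∈ E, ∀ b ∈ E, a * b - b * a ∈ E) (hnil : ∀ a ∈ E, IsNilpotent a) (P : V → Prop) (h0 : ¬ P 0) (v : V) (hv : P v) : ∃ w, P w ∧ ∀ a ∈ E, ¬ P (a w) :=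
  ej_P E (ej_Z _ V E hE hnil le_rfl) P h0 v hv
end EJ
section GMsec
structure GM {k S D M : Type*} [Field k] [LieRing S] [LieAlgebra k S] [AddCommGroup D] [Module k D]
    [AddCommGroup M] [Module k M] [LieRingModule S M] [LieModule k S M]
    (Sg : D → Submodule k S) (ev : D →ₗ[k] Dual k S) (Mg : D → Submodule k M) : Prop where
  top : ⨆ a, Mg a = ⊤
  ind : iSupIndep Mg
  lie : ∀ {a b x m}, x ∈ Sg a → m ∈ Mg b → ⁅x, m⁆ ∈ Mg (a + b)
  nil : ∀ {a h m}, h ∈ Sg 0 → m ∈ Mg a → ∃ n, ((toEnd k S M h - ev a h • (1 : Module.End k M)) ^ n) m = 0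
variable {k S D M : Type*} [Field k] [LieRing S] [LieAlgebra k S] [AddCommGroup D] [Module k D]
    [AddCommGroup M] [Module k M] [LieRingModule S M] [LieModule k S M]
    {Sg : D → Submodule k S} {ev : D →ₗ[k] Dual k S} {Mg : D → Submodule k M}
theorem indep_part {Mg n : D → Submodule k M} (hi : iSupIndep Mg) (hn : ∀ a, n a ≤ Mg a) {a : D} {x : M} (hx : x ∈ Mg a) (hx' : x ∈ ⨆ b, n b) : x ∈ n a := by
  have h1 : (⨆ b, n b) ≤ n a ⊔ ⨆ b, ⨆ (_ : b ≠ a), Mg b := by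
    refine iSup_le fun b => ?_
    by_cases hb : b = a
    · rw [hb]; exact le_sup_left
    · have h2 : Mg b ≤ ⨆ b, ⨆ (_ : b ≠ a), Mg b := le_iSup₂_of_le b hb le_rfl
      exact (hn b).trans (h2.trans le_sup_right)
  obtain ⟨y, hy, z, hz, rfl⟩ := mem_sup.1 (h1 hx')
  have hz' : z ∈ Mg a := by
    have := (Mg a).sub_mem hx (hn a hy)
    simpa using this
  have : z = 0 := by
    have := (Submodule.disjoint_def.1 (hi a)) z hz' hz
    exact this
  rw [this, add_zero]; exact hy
namespace GM
theorem ext (hM : GM Sg ev Mg) {N : Type*} [AddCommGroup N] [Module k N] {T T' : M →ₗ[k] N} (h : ∀ a, ∀ m ∈ Mg a, T m = T' m) : T = T' := by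
  refine LinearMap.ext fun m => ?_
  have hm : m ∈ ⨆ a, Mg a := by rw [hM.top]; trivial
  induction hm using Submodule.iSup_induction' with
  | mem i x hx => exact h i x hx
  | zero => simp
  | add x y _ _ hx hy => rw [map_add, map_add, hx, hy]
theorem exists_sc (hM : GM Sg ev Mg) (c : D → k) :
    ∃ T : Module.End k M, ∀ a, ∀ m ∈ Mg a, T m = c a • m := by
  classical
  have hint := DirectSum.isInternal_submodule_of_iSupIndep_of_iSup_eq_top hM.ind hM.top
  let φ := LinearEquiv.ofBijective (DirectSum.coeLinearMap Mg) hint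
  refine ⟨DirectSum.coeLinearMap Mg ∘ₗ
    (DirectSum.lmap (fun a => c a • (LinearMap.id : Mg a →ₗ[k] Mg a))) ∘ₗ φ.symm.toLinearMap, ?_⟩
  intro a m hm
  have h1 : φ.symm m = DirectSum.lof k D (fun a => Mg a) a ⟨m, hm⟩ := by
    rw [LinearEquiv.symm_apply_eq]
    exact (DirectSum.coeLinearMap_lof Mg a ⟨m, hm⟩).symm
  simp only [LinearMap.comp_apply, LinearEquiv.coe_coe, h1, DirectSum.lmap_lof]
  rw [DirectSum.coeLinearMap_lof]
  simp
noncomputable def sc (hM : GM Sg ev Mg) (c : D → k) : Module.End k M :=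
  (hM.exists_sc c).choose
theorem sc_apply (hM : GM Sg ev Mg) (c : D → k) {a : D} {m : M} (hm : m ∈ Mg a) :
    hM.sc c m = c a • m := (hM.exists_sc c).choose_spec a m hm
variable [FiniteDimensional k M]
theorem isNilpotent_of (hM : GM Sg ev Mg) {T : Module.End k M} (h : ∀ a, ∀ m ∈ Mg a, ∃ n, (T ^ n) m = 0) : IsNilpotent T := by
  rw [Module.End.isNilpotent_iff_of_finite]
  intro m
  have hm : m ∈ ⨆ a, Mg a := by rw [hM.top]; trivial
  induction hm using Submodule.iSup_induction' with
  | mem i x hx => exact h i x hx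
  | zero => exact ⟨0, by simp⟩
  | add x y _ _ hx hy =>
    obtain ⟨n, hn⟩ := hx
    obtain ⟨l, hl⟩ := hy
    refine ⟨n + l, ?_⟩
    have h1 : (T ^ (n + l)) x = 0 := by rw [add_comm, pow_add, Module.End.mul_apply, hn, map_zero]
    have h2 : (T ^ (n + l)) y = 0 := by rw [pow_add, Module.End.mul_apply, hl, map_zero]
    rw [map_add, h1, h2, add_zero]
theorem lie0 (hM : GM Sg ev Mg) {a : D} {h : S} {m : M} (hh : h ∈ Sg 0) (hm : m ∈ Mg a) :
    ⁅h, m⁆ ∈ Mg a := by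
  have := hM.lie hh hm
  rwa [zero_add] at this
theorem nilpart (hM : GM Sg ev Mg) {h : S} (hh : h ∈ Sg 0) :
    IsNilpotent (toEnd k S M h - hM.sc (fun a => ev a h)) := by
  refine hM.isNilpotent_of fun a m hm => ?_
  obtain ⟨n, hn⟩ := hM.nil hh hm
  refine ⟨n, ?_⟩
  rw [← hn]
  have key : ∀ n, (((toEnd k S M h - hM.sc (fun a => ev a h)) ^ n) m = ((toEnd k S M h - ev a h • (1 : Module.End k M)) ^ n) m) ∧ ((toEnd k S M h - ev a h • (1 : Module.End k M)) ^ n) m ∈ Mg a := by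
    intro n
    induction n with
    | zero => simpa using hm
    | succ n ih =>
      rw [pow_succ', pow_succ', Module.End.mul_apply, Module.End.mul_apply, ih.1]
      set w := ((toEnd k S M h - ev a h • (1 : Module.End k M)) ^ n) m
      constructor
      · simp [hM.sc_apply _ ih.2]
      · simp only [LinearMap.sub_apply, toEnd_apply_apply, LinearMap.smul_apply, Module.End.one_apply]
        exact (Mg a).sub_mem (hM.lie0 hh ih.2) ((Mg a).smul_mem _ ih.2)
  exact (key n).1
theorem finite_ne_bot (hM : GM Sg ev Mg) : {a | Mg a ≠ ⊥}.Finite :=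
  WellFoundedGT.finite_ne_bot_of_iSupIndep hM.ind
theorem trace_sc (hM : GM Sg ev Mg) {h : S} (hh : h ∈ Sg 0) (c : D → k) :
    LinearMap.trace k M (toEnd k S M h * hM.sc c) = ∑ a ∈ hM.finite_ne_bot.toFinset, c a * (finrank k (Mg a) * ev a h) := by
  classical
  have hint := DirectSum.isInternal_submodule_of_iSupIndep_of_iSup_eq_top hM.ind hM.top
  have hf : ∀ a, Set.MapsTo (toEnd k S M h * hM.sc c) (Mg a) (Mg a) := by
    intro a m hm
    rw [Module.End.mul_apply, hM.sc_apply c hm]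
    simp only [toEnd_apply_apply, lie_smul, SetLike.mem_coe]
    exact (Mg a).smul_mem _ (hM.lie0 hh hm)
  rw [LinearMap.trace_eq_sum_trace_restrict' hint hM.finite_ne_bot hf]
  refine sum_congr rfl fun a _ => ?_
  have hh' : ∀ m ∈ Mg a, toEnd k S M h m ∈ Mg a := fun m hm => hM.lie0 hh hm
  have h1 : (toEnd k S M h * hM.sc c).restrict (hf a) = c a • ((toEnd k S M h).restrict hh') := by
    refine LinearMap.ext fun m => Subtype.ext ?_
    change (toEnd k S M h) (hM.sc c m) = c a • (toEnd k S M h) m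
    rw [hM.sc_apply c m.2, map_smul]
  have h2 : IsNilpotent ((toEnd k S M h).restrict hh' - ev a h • (1 : Module.End k (Mg a))) := by
    rw [Module.End.isNilpotent_iff_of_finite]
    intro m
    obtain ⟨n, hn⟩ := hM.nil hh m.2
    refine ⟨n, ?_⟩
    have key : ∀ n, (((((toEnd k S M h).restrict hh' - ev a h • (1 : Module.End k (Mg a))) ^ n) m : Mg a) : M) = ((toEnd k S M h - ev a h • (1 : Module.End k M)) ^ n) m := by
      intro n
      induction n with
      | zero => simp
      | succ n ih =>
        rw [pow_succ', pow_succ', Module.End.mul_apply, Module.End.mul_apply, ← ih]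
        simp
    apply Subtype.ext
    rw [key, hn]; rfl
  have h3 := (LinearMap.isNilpotent_trace_of_isNilpotent h2).eq_zero
  rw [map_sub, map_smul, LinearMap.trace_one, sub_eq_zero] at h3
  rw [h1, map_smul, h3, smul_eq_mul, smul_eq_mul, mul_comm (ev a h)]
theorem trace_lie (hM : GM Sg ev Mg) {a : D} {x y : S} (hx : x ∈ Sg a) (hy : y ∈ Sg (-a)) (h0 : ⁅x, y⁆ ∈ Sg 0) (c : D → k) (hc : ∀ b, c (b + a) = c b) :
    ∑ b ∈ hM.finite_ne_bot.toFinset, c b * (finrank k (Mg b) * ev b ⁅x, y⁆) = 0 := by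
  rw [← hM.trace_sc h0 c]
  have hcomm : toEnd k S M y * hM.sc c = hM.sc c * toEnd k S M y := by
    refine hM.ext fun b m hm => ?_
    rw [Module.End.mul_apply, Module.End.mul_apply, hM.sc_apply c hm, map_smul, toEnd_apply_apply, hM.sc_apply c (hM.lie hy hm)]
    have := hc (-a + b)
    rw [show -a + b + a = b by abel] at this
    rw [this]
  have h1 : toEnd k S M ⁅x, y⁆ * hM.sc c = toEnd k S M x * (toEnd k S M y * hM.sc c) -
      toEnd k S M y * (toEnd k S M x * hM.sc c) := by
    rw [LieHom.map_lie, LieRing.of_associative_ring_bracket]; noncomm_ring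
  rw [h1, map_sub, LinearMap.trace_mul_comm k (toEnd k S M y), hcomm, mul_assoc, sub_self]
theorem last (hM : GM Sg ev Mg) (n : D → Submodule k S) (hn : ∀ a, n a ≤ Sg a) (hbr : ∀ a b x y, x ∈ n a → y ∈ n b → ⁅x, y⁆ ∈ n (a + b)) (hH : ∀ a h x, h ∈ Sg 0 → x ∈ n a → ⁅h, x⁆ ∈ n a) (h00 : ∀ h h', h ∈ Sg 0 → h' ∈ Sg 0 → ⁅h, h'⁆ ∈ n 0) (hnil : ∀ a x, x ∈ n a → IsNilpotent (toEnd k S M x)) (P : M → Prop) (h0 : ¬ P 0) (v : M) (hv : P v) :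
    ∃ w, P w ∧ (∀ a, ∀ x ∈ n a, ¬ P ⁅x, w⁆) ∧ (∀ h ∈ Sg 0, ∀ χ, w ∈ Mg χ → ¬ P (⁅h, w⁆ - ev χ h • w)) := by
  classical
  let E : Set (Module.End k M) := {T | ∃ a, ∃ x ∈ n a, T = toEnd k S M x} ∪
    {T | ∃ h ∈ Sg 0, T = toEnd k S M h - hM.sc (fun a => ev a h)}
  have hmix : ∀ a, ∀ x ∈ n a, ∀ h ∈ Sg 0, (toEnd k S M h - hM.sc (fun a => ev a h)) * toEnd k S M x -
      toEnd k S M x * (toEnd k S M h - hM.sc (fun a => ev a h)) = toEnd k S M (⁅h, x⁆ - ev a h • x) := by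
    intro a x hx h hh
    refine hM.ext fun b m hm => ?_
    have h1 := hM.sc_apply (fun a => ev a h) (hM.lie (hn a hx) hm)
    have h2 := hM.sc_apply (fun a => ev a h) hm
    simp only [LinearMap.sub_apply, Module.End.mul_apply, toEnd_apply_apply, h1, h2, sub_lie, lie_sub, smul_lie, lie_smul, leibniz_lie h x m, map_add, add_smul, LinearMap.add_apply]
    abel
  obtain ⟨w, hw, hwE⟩ := ej E
    (by
      rintro A (⟨a, x, hx, rfl⟩ | ⟨h, hh, rfl⟩) B (⟨b, y, hy, rfl⟩ | ⟨h', hh', rfl⟩)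
      · left
        refine ⟨a + b, ⁅x, y⁆, hbr a b x y hx hy, ?_⟩
        rw [LieHom.map_lie, LieRing.of_associative_ring_bracket]
      · left
        refine ⟨a, -(⁅h', x⁆ - ev a h' • x), (n a).neg_mem
          ((n a).sub_mem (hH a h' x hh' hx) ((n a).smul_mem _ hx)), ?_⟩
        rw [map_neg, ← hmix a x hx h' hh', neg_sub]
      · left
        exact ⟨b, ⁅h, y⁆ - ev b h • y, (n b).sub_mem (hH b h y hh hy) ((n b).smul_mem _ hy), hmix b y hy h hh⟩
      · left
        refine ⟨0, ⁅h, h'⁆, h00 h h' hh hh', ?_⟩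
        refine hM.ext fun b m hm => ?_
        have h1 := hM.sc_apply (fun a => ev a h) hm
        have h2 := hM.sc_apply (fun a => ev a h') hm
        have h3 := hM.sc_apply (fun a => ev a h) (hM.lie0 hh' hm)
        have h4 := hM.sc_apply (fun a => ev a h') (hM.lie0 hh hm)
        simp only [LinearMap.sub_apply, Module.End.mul_apply, toEnd_apply_apply, h1, h2, h3, h4, map_sub, lie_sub, lie_smul, map_smul, lie_lie]
        module)
    (by
      rintro A (⟨a, x, hx, rfl⟩ | ⟨h, hh, rfl⟩)
      · exact hnil a x hx
      · exact hM.nilpart hh)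
    P h0 v hv
  refine ⟨w, hw, fun a x hx => ?_, fun h hh χ hχ => ?_⟩
  · exact hwE _ (Or.inl ⟨a, x, hx, rfl⟩)
  · have := hwE _ (Or.inr ⟨h, hh, rfl⟩)
    rwa [LinearMap.sub_apply, toEnd_apply_apply, hM.sc_apply _ hχ] at this
end GM
end GMsec
section WDsec
structure WD {k S D V : Type*} [Field k] [LieRing S] [LieAlgebra k S] [AddCommGroup D] [Module k D]
    [AddCommGroup V] [Module k V] [LieRingModule S V] [LieModule k S V] (p : ℕ)
    (Sg : D → Submodule k S) (Vg : D → Submodule k V) (ev : D →ₗ[k] Dual k S) : Prop where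
  sS : GM Sg ev Sg
  sV : GM Sg ev Vg
  dim : finrank k V < p
  faithful : ∀ x : S, (∀ v : V, ⁅x, v⁆ = 0) → x = 0
  inj : ∀ a, (∀ h ∈ Sg 0, ev a h = 0) → a = 0
variable {k S D V : Type*} [Field k] [LieRing S] [LieAlgebra k S] [AddCommGroup D] [Module k D]
    [AddCommGroup V] [Module k V] [LieRingModule S V] [LieModule k S V]
    {Sg : D → Submodule k S} {Vg : D → Submodule k V} {ev : D →ₗ[k] Dual k S} {p : ℕ}
theorem nsmul_eq_zero_of_char [Fact p.Prime] [CharP k p] {a : D} (ha : a ≠ 0) {n : ℕ} :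
    n • a = 0 ↔ p ∣ n := by
  rw [← cast_smul_eq_nsmul k, smul_eq_zero, or_iff_left ha, cast_eq_zero_iff k p]
include k in
theorem p_nsmul [CharP k p] (a : D) : p • a = 0 := by rw [← cast_smul_eq_nsmul k, cast_eq_zero, zero_smul]
theorem nsmul_inj [Fact p.Prime] [CharP k p] {a : D} (ha : a ≠ 0) {i j : ℕ} (hi : i < p) (hj : j < p) (h : i • a = j • a) : i = j := by
  rw [← cast_smul_eq_nsmul k i, ← cast_smul_eq_nsmul k j] at h
  have := smul_left_injective k ha h
  rw [cast_eq_iff_mod_eq k p] at this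
  rwa [Nat.mod_eq_of_lt hi, Nat.mod_eq_of_lt hj] at this
namespace WD
variable [Fact p.Prime] [CharP k p] [FiniteDimensional k S] [FiniteDimensional k V]
theorem nop' (W : WD p Sg Vg ev) (f : Fin p → D) (hf : Function.Injective f) :
    ∃ i, Vg (f i) = ⊥ := by
  classical
  by_contra hc
  push Not at hc
  have hfin := W.sV.finite_ne_bot
  haveI : Fintype {a // Vg a ≠ ⊥} := hfin.fintype
  have h1 := W.sV.ind.subtype_ne_bot_le_finrank
  have h2 : Fintype.card (Fin p) ≤ Fintype.card {a // Vg a ≠ ⊥} :=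
    Fintype.card_le_of_injective (fun i => ⟨f i, hc i⟩) (fun i j h => hf (by simpa using h))
  rw [Fintype.card_fin] at h2
  have := W.dim
  omega
theorem nop (W : WD p Sg Vg ev) {a : D} (ha : a ≠ 0) (χ : D) : ∃ j < p, Vg (χ + j • a) = ⊥ := by
  obtain ⟨i, hi⟩ := W.nop' (fun i : Fin p => χ + (i : ℕ) • a) (by
    intro i j h
    exact Fin.ext (nsmul_inj (k := k) ha i.2 j.2 (by simpa using h)))
  exact ⟨i, i.2, hi⟩
theorem pow_mem (W : WD p Sg Vg ev) {a χ : D} {x : S} (hx : x ∈ Sg a) {v : V} (hv : v ∈ Vg χ) (n : ℕ) : ((toEnd k S V x) ^ n) v ∈ Vg (χ + n • a) := by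
  induction n with
  | zero => simpa using hv
  | succ n ih =>
    rw [pow_succ', Module.End.mul_apply, succ_nsmul, ← add_assoc, add_comm _ a]
    exact W.sV.lie hx ih
theorem nilV (W : WD p Sg Vg ev) {a : D} (ha : a ≠ 0) {x : S} (hx : x ∈ Sg a) :
    IsNilpotent (toEnd k S V x) := by
  refine W.sV.isNilpotent_of fun χ m hm => ?_
  obtain ⟨j, _, hj⟩ := W.nop ha χ
  refine ⟨j, ?_⟩
  have := W.pow_mem hx hm j
  rwa [hj, mem_bot] at this
theorem nilS (W : WD p Sg Vg ev) {x : S} (h : IsNilpotent (toEnd k S V x)) :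
    IsNilpotent (toEnd k S S x) := by
  obtain ⟨n, hn⟩ := LieAlgebra.ad_nilpotent_of_nilpotent (R := k) h
  refine ⟨n, LinearMap.ext fun y => ?_⟩
  have key : ∀ n, toEnd k S V (((toEnd k S S x) ^ n) y) = ((LieAlgebra.ad k _ (toEnd k S V x)) ^ n) (toEnd k S V y) := by
    intro n
    induction n with
    | zero => simp
    | succ n ih =>
      rw [pow_succ', pow_succ', Module.End.mul_apply, Module.End.mul_apply, ← ih]
      simp
  rw [LinearMap.zero_apply]
  refine W.faithful _ fun v => ?_
  have := key n
  rw [hn, LinearMap.zero_apply] at this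
  rw [← toEnd_apply_apply k, this, LinearMap.zero_apply]
theorem F2 (W : WD p Sg Vg ev) (β : D) {μ : D} (hμ : Vg μ ≠ ⊥) :
    ∃ r : ℕ, ∀ a ∈ zmultiples β, ∀ x ∈ Sg a, ∀ y ∈ Sg (-a), ev μ ⁅x, y⁆ = r * ev β ⁅x, y⁆ := by
  classical
  have hp : p.Prime := Fact.out
  set F := W.sV.finite_ne_bot.toFinset with hF
  set Γ := zmultiples β
  set F' := F.filter (fun b => b - μ ∈ Γ) with hF'
  have hcoord : ∀ b, b - μ ∈ Γ → ∃ j : ℤ, b = μ + j • β := by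
    intro b hb
    obtain ⟨j, hj⟩ := AddSubgroup.mem_zmultiples_iff.1 hb
    exact ⟨j, by rw [hj]; abel⟩
  choose! j hj using hcoord
  set d : ℕ := ∑ b ∈ F', finrank k (Vg b) with hd
  have hμF : μ ∈ F' := by
    rw [hF', Finset.mem_filter, sub_self]
    exact ⟨by rw [hF]; simpa using hμ, Γ.zero_mem⟩
  have hdpos : 0 < d := by
    refine lt_of_lt_of_le (Nat.pos_of_ne_zero ?_)
      (Finset.single_le_sum (f := fun b => finrank k (Vg b)) (fun _ _ => Nat.zero_le _) hμF)
    rwa [Ne, Submodule.finrank_eq_zero]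
  have hdlt : d < p := by
    refine lt_of_le_of_lt ?_ W.dim
    have hsum : ∑ b ∈ F, finrank k (Vg b) = finrank k V := by
      let e := LinearEquiv.ofBijective (DirectSum.coeLinearMap fun i : F => Vg i)
        (by
          have hi : iSupIndep (fun i : F => Vg i) := W.sV.ind.comp Subtype.val_injective
          refine DirectSum.isInternal_submodule_of_iSupIndep_of_iSup_eq_top hi ?_
          rw [← top_le_iff, ← W.sV.top]
          refine iSup_le fun b => ?_
          by_cases hb : Vg b = ⊥
          · rw [hb]; exact bot_le
          · exact le_iSup (fun i : F => Vg i) ⟨b, by rw [hF]; simpa using hb⟩)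
      rw [← e.finrank_eq, Module.finrank_directSum, ← Finset.sum_coe_sort]
    rw [← hsum]
    exact Finset.sum_le_sum_of_subset (Finset.filter_subset _ _)
  have hdk : (d : k) ≠ 0 := by
    rw [Ne, cast_eq_zero_iff k p]
    exact not_dvd_of_pos_of_lt hdpos hdlt
  have hdZ : ((d : ℕ) : ZMod p) ≠ 0 := by
    rw [Ne, cast_eq_zero_iff (ZMod p) p]
    exact not_dvd_of_pos_of_lt hdpos hdlt
  set s : ℤ := ∑ b ∈ F', finrank k (Vg b) * j b with hs
  set r : ZMod p := -(s : ZMod p) / (d : ZMod p) with hr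
  have hrk : (d : k) * (r.val : k) = -(s : k) := by
    have h1 : (d : ZMod p) * (r.val : ZMod p) = -(s : ZMod p) := by rw [ZMod.natCast_zmod_val, hr]; field_simp
    have h2 := congrArg (ZMod.castHom (dvd_refl p) k) h1
    simpa using h2
  refine ⟨r.val, fun a ha x hx y hy => ?_⟩
  have h0 : ⁅x, y⁆ ∈ Sg 0 := by
    have := W.sS.lie hx hy
    rwa [add_neg_cancel] at this
  have ht := W.sV.trace_lie hx hy h0 (fun b => if b - μ ∈ Γ then 1 else 0) (by
    intro b
    have : b + a - μ ∈ Γ ↔ b - μ ∈ Γ := by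
      rw [show b + a - μ = (b - μ) + a by abel]
      exact add_mem_cancel_right Γ ha
    simp only [this])
  simp only [ite_mul, one_mul, zero_mul] at ht
  rw [← Finset.sum_filter] at ht
  have hval : ∀ b ∈ F', (finrank k (Vg b) : k) * ev b ⁅x, y⁆ = (finrank k (Vg b) : k) * ev μ ⁅x, y⁆ + ((finrank k (Vg b) * j b : ℤ) : k) * ev β ⁅x, y⁆ := by
    intro b hb
    have h1 := hj b (Finset.mem_filter.1 hb).2
    have h2 : ev b = ev μ + j b • ev β := by rw [← map_zsmul, ← map_add, ← h1]
    rw [h2]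
    simp only [LinearMap.add_apply, LinearMap.smul_apply, zsmul_eq_mul]
    push_cast; ring
  rw [sum_congr rfl hval, Finset.sum_add_distrib, ← Finset.sum_mul, ← Finset.sum_mul, ← Nat.cast_sum, ← Int.cast_sum, ← hs, ← hd] at ht
  have : (d : k) * (ev μ ⁅x, y⁆ - r.val * ev β ⁅x, y⁆) = 0 := by linear_combination ht - ev β ⁅x, y⁆ * hrk
  rcases mul_eq_zero.1 this with h | h
  · exact absurd h hdk
  · exact sub_eq_zero.1 h
def N (_ : WD p Sg Vg ev) : Submodule k S where
  carrier := {h | h ∈ Sg 0 ∧ ∀ χ, Vg χ ≠ ⊥ → ev χ h = 0}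
  add_mem' := fun ha hb => ⟨(Sg 0).add_mem ha.1 hb.1, fun χ hχ => by rw [map_add, ha.2 χ hχ, hb.2 χ hχ, add_zero]⟩
  zero_mem' := ⟨(Sg 0).zero_mem, fun χ _ => map_zero _⟩
  smul_mem' := fun c x hx => ⟨(Sg 0).smul_mem c hx.1, fun χ hχ => by rw [map_smul, hx.2 χ hχ, smul_zero]⟩
theorem lie_mem0 (W : WD p Sg Vg ev) {a : D} {x y : S} (hx : x ∈ Sg a) (hy : y ∈ Sg (-a)) :
    ⁅x, y⁆ ∈ Sg 0 := by
  have := W.sS.lie hx hy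
  rwa [add_neg_cancel] at this
theorem HH (W : WD p Sg Vg ev) {h h' : S} (hh : h ∈ Sg 0) (hh' : h' ∈ Sg 0) : ⁅h, h'⁆ ∈ W.N := by
  refine ⟨W.sS.lie0 hh hh', fun χ hχ => ?_⟩
  obtain ⟨r, hr⟩ := W.F2 0 hχ
  rw [hr 0 (AddSubgroup.zero_mem _) h hh h' (by rwa [neg_zero])]
  simp
theorem root_diff (W : WD p Sg Vg ev) {a : D} (ha : Sg a ≠ ⊥) :
    ∃ χ, Vg χ ≠ ⊥ ∧ Vg (a + χ) ≠ ⊥ := by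
  by_contra hc
  push Not at hc
  apply ha
  rw [eq_bot_iff]
  intro x hx
  rw [mem_bot]
  refine W.faithful x fun v => ?_
  have : toEnd k S V x = 0 := by
    refine W.sV.ext fun χ m hm => ?_
    by_cases h : Vg χ = ⊥
    · rw [h, mem_bot] at hm
      rw [hm, map_zero, map_zero]
    · have h1 := W.sV.lie hx hm
      rw [hc χ h, mem_bot] at h1
      simpa using h1
  rw [← toEnd_apply_apply k, this, LinearMap.zero_apply]
theorem root_N (W : WD p Sg Vg ev) {a : D} (ha : Sg a ≠ ⊥) {h : S} (hh : h ∈ W.N) : ev a h = 0 := by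
  obtain ⟨χ, h1, h2⟩ := W.root_diff ha
  have h3 := hh.2 _ h2
  rw [map_add, LinearMap.add_apply, hh.2 _ h1, add_zero] at h3
  exact h3
theorem nilN (W : WD p Sg Vg ev) {h : S} (hh : h ∈ W.N) : IsNilpotent (toEnd k S V h) := by
  refine W.sV.isNilpotent_of fun χ m hm => ?_
  by_cases hχ : Vg χ = ⊥
  · rw [hχ, mem_bot] at hm
    exact ⟨0, by simpa using hm⟩
  · obtain ⟨n, hn⟩ := W.sV.nil hh.1 hm
    refine ⟨n, ?_⟩
    rwa [hh.2 χ hχ, zero_smul, sub_zero] at hn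
open Classical in
noncomputable def J (W : WD p Sg Vg ev) (a : D) : Submodule k S :=
  if a = 0 then W.N else
  { carrier := {x | x ∈ Sg a ∧ ∀ y ∈ Sg (-a), ⁅x, y⁆ ∈ W.N}
    add_mem' := fun hx hy => ⟨(Sg a).add_mem hx.1 hy.1, fun z hz => by rw [add_lie]; exact W.N.add_mem (hx.2 z hz) (hy.2 z hz)⟩
    zero_mem' := ⟨(Sg a).zero_mem, fun z _ => by rw [zero_lie]; exact W.N.zero_mem⟩
    smul_mem' := fun c x hx => ⟨(Sg a).smul_mem c hx.1, fun z hz => by rw [smul_lie]; exact W.N.smul_mem c (hx.2 z hz)⟩ }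
theorem J_zero (W : WD p Sg Vg ev) : W.J 0 = W.N := by simp [J]
theorem mem_J {W : WD p Sg Vg ev} {a : D} (ha : a ≠ 0) {x : S} :
    x ∈ W.J a ↔ x ∈ Sg a ∧ ∀ y ∈ Sg (-a), ⁅x, y⁆ ∈ W.N := by
  rw [J, if_neg ha]; rfl
theorem J_le (W : WD p Sg Vg ev) (a : D) : W.J a ≤ Sg a := by
  intro x hx
  by_cases ha : a = 0
  · subst ha
    rw [J_zero] at hx
    exact hx.1
  · exact ((mem_J ha).1 hx).1
theorem JN (W : WD p Sg Vg ev) {a : D} {x y : S} (hx : x ∈ W.J a) (hy : y ∈ Sg (-a)) :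
    ⁅x, y⁆ ∈ W.N := by
  by_cases ha : a = 0
  · subst ha
    rw [neg_zero] at hy
    exact W.HH (W.J_le _ hx) hy
  · exact ((mem_J ha).1 hx).2 y hy
theorem JN' (W : WD p Sg Vg ev) {a : D} {x y : S} (hx : x ∈ W.J a) (hy : y ∈ Sg (-a)) :
    ⁅y, x⁆ ∈ W.N := by
  rw [← lie_skew]; exact W.N.neg_mem (W.JN hx hy)
theorem HJ (W : WD p Sg Vg ev) {a : D} {h x : S} (hh : h ∈ Sg 0) (hx : x ∈ W.J a) :
    ⁅h, x⁆ ∈ W.J a := by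
  by_cases ha : a = 0
  · subst ha
    rw [J_zero]
    exact W.HH hh (W.J_le _ hx)
  · refine (mem_J ha).2 ⟨W.sS.lie0 hh (W.J_le _ hx), fun y hy => ?_⟩
    rw [lie_lie]
    exact W.N.sub_mem (W.HH hh (W.lie_mem0 (W.J_le _ hx) hy)) (W.JN hx (W.sS.lie0 hh hy))
theorem JJ (W : WD p Sg Vg ev) {a b : D} {x y : S} (hx : x ∈ W.J a) (hy : y ∈ W.J b) :
    ⁅x, y⁆ ∈ W.J (a + b) := by
  by_cases hab : a + b = 0
  · rw [hab, J_zero]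
    exact W.JN hx (by rw [← eq_neg_of_add_eq_zero_right hab]; exact W.J_le _ hy)
  · refine (mem_J hab).2 ⟨W.sS.lie (W.J_le _ hx) (W.J_le _ hy), fun z hz => ?_⟩
    rw [lie_lie]
    refine W.N.sub_mem (W.JN hx ?_) (W.JN hy ?_)
    · have := W.sS.lie (W.J_le _ hy) hz
      rwa [show b + -(a + b) = -a by abel] at this
    · have := W.sS.lie (W.J_le _ hx) hz
      rwa [show a + -(a + b) = -b by abel] at this
theorem mem_N_of_line (W : WD p Sg Vg ev) {β a : D} (ha : a ∈ zmultiples β) {x y : S} (hx : x ∈ Sg a) (hy : y ∈ Sg (-a)) (h : ev β ⁅x, y⁆ = 0) : ⁅x, y⁆ ∈ W.N := by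
  refine ⟨W.lie_mem0 hx hy, fun χ hχ => ?_⟩
  obtain ⟨r, hr⟩ := W.F2 β hχ
  rw [hr a ha x hx y hy, h, mul_zero]
end WD
end WDsec
section
variable {k S D V : Type*} [Field k] [LieRing S] [LieAlgebra k S] [AddCommGroup D] [Module k D]
    [AddCommGroup V] [Module k V] [LieRingModule S V] [LieModule k S V]
    {Sg : D → Submodule k S} {Vg : D → Submodule k V} {ev : D →ₗ[k] Dual k S} {p : ℕ}
namespace WD
variable [Fact p.Prime] [CharP k p] [FiniteDimensional k S] [FiniteDimensional k V]
def GSt (_ : WD p Sg Vg ev) (β : D) (Y : Submodule k V) : Prop :=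
  ∀ a ∈ zmultiples β, ∀ x ∈ Sg a, ∀ v ∈ Y, ⁅x, v⁆ ∈ Y
def act (X : Submodule k S) (M : Submodule k V) : Submodule k V :=
  Submodule.map₂ ((toEnd k S V : S →ₗ[k] Module.End k V)) X M
theorem act_mem {X : Submodule k S} {M : Submodule k V} {x : S} {m : V} (hx : x ∈ X) (hm : m ∈ M) :
    ⁅x, m⁆ ∈ act X M := Submodule.apply_mem_map₂ _ hx hm
theorem act_ind {X : Submodule k S} {M Z : Submodule k V} {T : V →ₗ[k] V} (h : ∀ x ∈ X, ∀ m ∈ M, T ⁅x, m⁆ ∈ Z) : ∀ v ∈ act X M, T v ∈ Z := by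
  have : act X M ≤ Z.comap T := Submodule.map₂_le.2 h
  exact this
theorem natne [Fact p.Prime] [CharP k p] {n : ℕ} (h : 0 < n) (h' : n < p) : (n : k) ≠ 0 := by
  rw [Ne, cast_eq_zero_iff k p]
  exact not_dvd_of_pos_of_lt h h'
theorem S1 (W : WD p Sg Vg ev) {l : D} {y : S} (hy : y ∈ Sg l) (hye : ∀ h ∈ Sg 0, ⁅h, y⁆ - ev l h • y ∈ W.J l) (hl : ∀ h ∈ W.N, ev l h = 0) {Y : Submodule k V} (hY : W.GSt l Y) {ν : D} {v : V} (hv : v ∈ Vg ν) (hvY : v ∉ Y) (hve : ∀ h ∈ Sg 0, ⁅h, v⁆ - ev ν h • v ∈ Y) (hyv : ⁅y, v⁆ ∈ Y) {g : S} (hg : g ∈ Sg (-l)) (hL : ev l ⁅y, g⁆ ≠ 0) {n : ℕ} (hn : n < p) (h2 : 2 * ev ν ⁅y, g⁆ = n * ev l ⁅y, g⁆) : ∀ s ≤ n, Vg (ν - s • l) ≠ ⊥ := by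
  set h' := ⁅y, g⁆ with hh'
  have hh0 : h' ∈ Sg 0 := W.lie_mem0 hy hg
  have hYl : ∀ v ∈ Y, ⁅y, v⁆ ∈ Y := hY l (mem_zmultiples l) y hy
  have hYm : ∀ x ∈ Sg (-l), ∀ v ∈ Y, ⁅x, v⁆ ∈ Y :=
    hY (-l) (neg_mem (mem_zmultiples l))
  have hY0 : ∀ x ∈ Sg 0, ∀ v ∈ Y, ⁅x, v⁆ ∈ Y := hY 0 (zero_mem _)
  have hνN : ∀ h ∈ W.N, ev ν h = 0 := fun h hh => hh.2 ν (by
    intro hb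
    rw [hb, mem_bot] at hv
    exact hvY (hv ▸ Y.zero_mem))
  let X0 : Submodule k S := Sg (-l) ⊓ W.N.comap (toEnd k S S y)
  have hX0 : ∀ x, x ∈ X0 ↔ x ∈ Sg (-l) ∧ ⁅y, x⁆ ∈ W.N := fun x => Iff.rfl
  have hyh : ∀ h ∈ Sg 0, ∀ x ∈ Sg (-l), ⁅⁅y, h⁆, x⁆ + ev l h • ⁅y, x⁆ ∈ W.N := by
    intro h hh x hx
    have h1 := W.JN (hye h hh) hx
    rw [sub_lie, smul_lie] at h1
    have h2 : ⁅⁅y, h⁆, x⁆ = - ⁅⁅h, y⁆, x⁆ := by rw [← lie_skew h y, neg_lie, neg_neg]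
    rw [h2]
    have := W.N.neg_mem h1
    rwa [neg_sub, sub_eq_neg_add] at this
  have hHX : ∀ h ∈ Sg 0, ∀ x ∈ X0, ⁅h, x⁆ ∈ X0 := by
    intro h hh x hx
    refine ⟨W.sS.lie0 hh hx.1, ?_⟩
    change ⁅y, ⁅h, x⁆⁆ ∈ W.N
    rw [leibniz_lie]
    have h1 := hyh h hh x hx.1
    have h2 := W.N.smul_mem (ev l h) hx.2
    exact W.N.add_mem ((Submodule.add_mem_iff_left _ h2).1 h1) (W.HH hh hx.2.1)
  have hNX : ∀ h ∈ W.N, ∀ x ∈ Sg (-l), ⁅h, x⁆ ∈ X0 := by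
    intro h hh x hx
    refine ⟨W.sS.lie0 hh.1 hx, ?_⟩
    change ⁅y, ⁅h, x⁆⁆ ∈ W.N
    rw [leibniz_lie]
    have h1 := hyh h hh.1 x hx
    rw [hl h hh, zero_smul, add_zero] at h1
    exact W.N.add_mem h1 (W.HH hh.1 (W.lie_mem0 hy hx))
  have hgX : ⁅h', g⁆ + ev l h' • g ∈ X0 := by
    refine ⟨(Sg (-l)).add_mem (W.sS.lie0 hh0 hg) ((Sg (-l)).smul_mem _ hg), ?_⟩
    change ⁅y, ⁅h', g⁆ + ev l h' • g⁆ ∈ W.N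
    rw [lie_add, lie_smul, leibniz_lie y h' g, ← hh', lie_self, add_zero]
    exact hyh h' hh0 g hg
  have hw : ∀ s, ((toEnd k S V g) ^ s) v ∈ Vg (ν - s • l) := by
    intro s
    have := W.pow_mem hg hv s
    rwa [smul_neg, ← sub_eq_add_neg] at this
  have key : ∀ s ≤ n, ∃ M Q : Submodule k V, (∀ h ∈ Sg 0, ∀ m ∈ M, ⁅h, m⁆ ∈ M) ∧ (∀ h ∈ Sg 0, ∀ m ∈ Q, ⁅h, m⁆ ∈ Q) ∧ (∀ h ∈ W.N, ∀ m ∈ M, ⁅h, m⁆ ∈ Q) ∧ (∀ x ∈ Sg (-l), ∀ m ∈ M, ⁅x, ⁅y, m⁆⁆ ∈ M) ∧ (∀ x ∈ Sg (-l), ∀ m ∈ Q, ⁅x, ⁅y, m⁆⁆ ∈ Q) ∧ (∀ x ∈ X0, ∀ m ∈ M, ⁅x, ⁅y, m⁆⁆ ∈ Q) ∧ ((toEnd k S V g) ^ s) v ∈ M ∧ ((toEnd k S V g) ^ s) v ∉ Q ∧ (⁅h', ((toEnd k S V g) ^ s) v⁆ - (ev ν h' - s * ev l h') •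
        ((toEnd k S V g) ^ s) v ∈ Q) ∧ ∃ c : k, 2 * c = (s + 1) * (n - s) * ev l h' ∧ ⁅y, ⁅g, ((toEnd k S V g) ^ s) v⁆⁆ - c • ((toEnd k S V g) ^ s) v ∈ Q := by
    intro s
    induction s with
    | zero =>
      intro _
      have hH : ∀ h ∈ Sg 0, ∀ m ∈ (k ∙ v) ⊔ Y, ⁅h, m⁆ ∈ (k ∙ v) ⊔ Y := by
        intro h hh m hm
        obtain ⟨a, ha, b, hb, rfl⟩ := mem_sup.1 hm
        obtain ⟨c, rfl⟩ := mem_span_singleton.1 ha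
        rw [lie_add, lie_smul]
        refine add_mem (smul_mem _ _ ?_) (mem_sup_right (hY0 h hh b hb))
        rw [← sub_add_cancel ⁅h, v⁆ (ev ν h • v)]
        exact add_mem (mem_sup_right (hve h hh))
          (mem_sup_left (smul_mem _ _ (mem_span_singleton_self v)))
      have hyM : ∀ m ∈ (k ∙ v) ⊔ Y, ⁅y, m⁆ ∈ Y := by
        intro m hm
        obtain ⟨a, ha, b, hb, rfl⟩ := mem_sup.1 hm
        obtain ⟨c, rfl⟩ := mem_span_singleton.1 ha
        rw [lie_add, lie_smul]
        exact add_mem (smul_mem _ _ hyv) (hYl b hb)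
      refine ⟨(k ∙ v) ⊔ Y, Y, hH, hY0, ?_, fun x hx m hm => mem_sup_right
        (hYm x hx _ (hyM m hm)), fun x hx m hm => hYm x hx _ (hYl m hm), fun x hx m hm => hYm x hx.1 _ (hyM m hm), ?_, ?_, ?_, ev ν h', ?_, ?_⟩
      · intro h hh m hm
        obtain ⟨a, ha, b, hb, rfl⟩ := mem_sup.1 hm
        obtain ⟨c, rfl⟩ := mem_span_singleton.1 ha
        rw [lie_add, lie_smul]
        refine add_mem (smul_mem _ _ ?_) (hY0 h hh.1 b hb)
        have := hve h hh.1
        rwa [hνN h hh, zero_smul, sub_zero] at this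
      · exact mem_sup_left (mem_span_singleton_self v)
      · exact hvY
      · simpa using hve h' hh0
      · rw [h2]; push_cast; ring
      · simp only [pow_zero, Module.End.one_apply]
        rw [leibniz_lie, ← hh', add_sub_right_comm]
        exact add_mem (hve h' hh0) (hYm g hg _ hyv)
    | succ s ih =>
      intro hs
      obtain ⟨M, Q, hM, hQ, hNM, hA1, hA2, hA3, hwM, hwQ, he, c, hc, hyg⟩ := ih (by omega)
      set w := ((toEnd k S V g) ^ s) v with hwdef
      have hw' : ((toEnd k S V g) ^ (s + 1)) v = ⁅g, w⁆ := by rw [pow_succ', Module.End.mul_apply]; rfl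
      rw [hw']
      have hyM : ∀ m ∈ act (Sg (-l)) M, toEnd k S V y m ∈ M := act_ind (by
        intro x hx m hm
        rw [toEnd_apply_apply, leibniz_lie]
        exact add_mem (hM _ (W.lie_mem0 hy hx) m hm) (hA1 x hx m hm))
      have hyQ : ∀ m ∈ act (Sg (-l)) Q ⊔ act X0 M, toEnd k S V y m ∈ Q := by
        intro m hm
        obtain ⟨a, ha, b, hb, rfl⟩ := mem_sup.1 hm
        rw [map_add]
        refine add_mem ?_ ?_
        · refine act_ind ?_ a ha
          intro x hx m hm
          rw [toEnd_apply_apply, leibniz_lie]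
          exact add_mem (hQ _ (W.lie_mem0 hy hx) m hm) (hA2 x hx m hm)
        · refine act_ind ?_ b hb
          intro x hx m hm
          rw [toEnd_apply_apply, leibniz_lie]
          exact add_mem (hNM _ hx.2 m hm) (hA3 x hx m hm)
      refine ⟨act (Sg (-l)) M, act (Sg (-l)) Q ⊔ act X0 M, ?_, ?_, ?_, fun x hx m hm => act_mem hx (hyM m hm), fun x hx m hm => mem_sup_left (act_mem hx (hyQ m hm)), fun x hx m hm => mem_sup_right (act_mem hx (hyM m hm)), act_mem hg hwM, ?_, ?_, c + (ev ν h' - (s + 1) * ev l h'), ?_, ?_⟩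
      · intro h hh m hm
        refine act_ind (T := toEnd k S V h) ?_ m hm
        intro x hx m hm
        rw [toEnd_apply_apply, leibniz_lie]
        exact add_mem (act_mem (W.sS.lie0 hh hx) hm) (act_mem hx (hM h hh m hm))
      · intro h hh m hm
        obtain ⟨a, ha, b, hb, rfl⟩ := mem_sup.1 hm
        rw [lie_add]
        refine add_mem (mem_sup_left ?_) (mem_sup_right ?_)
        · refine act_ind (T := toEnd k S V h) ?_ a ha
          intro x hx m hm
          rw [toEnd_apply_apply, leibniz_lie]
          exact add_mem (act_mem (W.sS.lie0 hh hx) hm) (act_mem hx (hQ h hh m hm))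
        · refine act_ind (T := toEnd k S V h) ?_ b hb
          intro x hx m hm
          rw [toEnd_apply_apply, leibniz_lie]
          exact add_mem (act_mem (hHX h hh x hx) hm) (act_mem hx (hM h hh m hm))
      · intro h hh m hm
        refine act_ind (T := toEnd k S V h) ?_ m hm
        intro x hx m hm
        rw [toEnd_apply_apply, leibniz_lie]
        exact add_mem (mem_sup_right (act_mem (hNX h hh x hx) hm))
          (mem_sup_left (act_mem hx (hNM h hh m hm)))
      · intro hmem
        have h1 := hyQ _ hmem
        rw [toEnd_apply_apply] at h1
        have h3 : c • w ∈ Q := by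
          have := sub_mem h1 hyg
          rwa [sub_sub_cancel] at this
        have hc0 : c ≠ 0 := by
          rintro rfl
          rw [mul_zero] at hc
          have e1 : ((s : k) + 1) ≠ 0 := by
            have := natne (k := k) (p := p) (n := s + 1) (by omega) (by omega)
            simpa using this
          have e2 : ((n : k) - s) ≠ 0 := by
            have := natne (k := k) (p := p) (n := n - s) (by omega) (by omega)
            rwa [Nat.cast_sub (by omega)] at this
          exact mul_ne_zero (mul_ne_zero e1 e2) hL hc.symm
        exact hwQ ((smul_mem_iff _ hc0).1 h3)
      · have h1 := act_mem (V := V) hgX hwM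
        have h3 := act_mem (V := V) hg he
        rw [leibniz_lie]
        have : ⁅⁅h', g⁆, w⁆ + ⁅g, ⁅h', w⁆⁆ - (ev ν h' - ((s + 1 : ℕ) : k) * ev l h') • ⁅g, w⁆ = ⁅⁅h', g⁆ + ev l h' • g, w⁆ + ⁅g, ⁅h', w⁆ - (ev ν h' - s * ev l h') • w⁆ := by
          simp only [add_lie, smul_lie, lie_sub, lie_smul]
          push_cast
          module
        rw [this]
        exact add_mem (mem_sup_right h1) (mem_sup_left h3)
      · push_cast; linear_combination hc + h2
      · have h1 := act_mem (V := V) hgX hwM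
        have h3 := act_mem (V := V) hg he
        have h4 := act_mem (V := V) hg hyg
        have : ⁅y, ⁅g, ⁅g, w⁆⁆⁆ - (c + (ev ν h' - (s + 1) * ev l h')) • ⁅g, w⁆ = ⁅⁅h', g⁆ + ev l h' • g, w⁆ + (⁅g, ⁅h', w⁆ - (ev ν h' - s * ev l h') • w⁆ + ⁅g, ⁅y, ⁅g, w⁆⁆ - c • w⁆) := by
          rw [leibniz_lie y g ⁅g, w⁆, ← hh', leibniz_lie h' g w]
          simp only [add_lie, smul_lie, lie_sub, lie_smul]
          module
        rw [this]
        exact add_mem (mem_sup_right h1) (mem_sup_left (add_mem h3 h4))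
  intro s hs hb
  obtain ⟨M, Q, -, -, -, -, -, -, -, hwQ, -⟩ := key s hs
  have := hw s
  rw [hb, mem_bot] at this
  exact hwQ (this ▸ Q.zero_mem)
theorem S1c (W : WD p Sg Vg ev) {l : D} (hl0 : l ≠ 0) {y : S} (hy : y ∈ Sg l) (hyJ : y ∉ W.J l) (hye : ∀ h ∈ Sg 0, ⁅h, y⁆ - ev l h • y ∈ W.J l) {Y : Submodule k V} (hY : W.GSt l Y) {ν ν' : D} {v v' : V} (hv : v ∈ Vg ν) (hvY : v ∉ Y) (hve : ∀ h ∈ Sg 0, ⁅h, v⁆ - ev ν h • v ∈ Y) (hyv : ⁅y, v⁆ ∈ Y) (hv' : v' ∈ Vg ν') (hvY' : v' ∉ Y) (hve' : ∀ h ∈ Sg 0, ⁅h, v'⁆ - ev ν' h • v' ∈ Y) (hyv' : ⁅y, v'⁆ ∈ Y) {n : ℕ} (hn0 : 0 < n) (hn : n < p) (hnn : ν' = ν + n • l) (h2 : ∀ g ∈ Sg (-l), 2 * ev ν ⁅y, g⁆ = - (n * ev l ⁅y, g⁆)) : False := by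
  have hl : ∀ h ∈ W.N, ev l h = 0 := fun h hh => W.root_N (by
    intro hb; rw [hb, mem_bot] at hy; exact hyJ (hy ▸ Submodule.zero_mem _)) hh
  obtain ⟨g, hg, hgN⟩ : ∃ g ∈ Sg (-l), ⁅y, g⁆ ∉ W.N := by
    by_contra hc
    push Not at hc
    exact hyJ ((mem_J hl0).2 ⟨hy, hc⟩)
  have hL : ev l ⁅y, g⁆ ≠ 0 := fun h0 => hgN
    (W.mem_N_of_line (mem_zmultiples l) hy hg h0)
  have hpk : (p : k) = 0 := cast_eq_zero k p
  have A := W.S1 hy hye hl hY hv hvY hve hyv hg hL (n := p - n) (by omega) (by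
    rw [h2 g hg, Nat.cast_sub hn.le, hpk]; ring)
  have B := W.S1 hy hye hl hY hv' hvY' hve' hyv' hg hL (n := n) (by omega) (by
    have h3 : ev ν' ⁅y, g⁆ = ev ν ⁅y, g⁆ + n * ev l ⁅y, g⁆ := by rw [hnn, map_add, map_nsmul]; simp
    rw [h3]; linear_combination h2 g hg)
  obtain ⟨j, hj, hb⟩ := W.nop hl0 ν
  by_cases h : j ≤ n
  · refine B (n - j) (by omega) ?_
    rw [← hb, hnn]
    congr 1
    have : n • l = j • l + (n - j) • l := by rw [← add_nsmul]; congr 1; omega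
    rw [this]; abel
  · refine A (p - j) (by omega) ?_
    rw [← hb]
    congr 1
    have h1 : p • l = j • l + (p - j) • l := by rw [← add_nsmul]; congr 1; omega
    rw [p_nsmul (k := k)] at h1
    rw [sub_eq_add_neg]
    congr 1
    exact (eq_neg_of_add_eq_zero_left h1.symm).symm
theorem str (W : WD p Sg Vg ev) {a : D} {Y : Submodule k V} (hY : W.GSt a Y) {x : S} (hx : x ∈ Sg a) {ν : D} {v : V} (hve : ∀ h ∈ Sg 0, ⁅h, v⁆ - ev ν h • v ∈ Y) {t : ℕ} (hk : ∀ s < t, ∀ h ∈ Sg 0, ⁅⁅h, x⁆ - ev a h • x, ((toEnd k S V x) ^ s) v⁆ ∈ Y) :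
    ∀ s ≤ t, ∀ h ∈ Sg 0, ⁅h, ((toEnd k S V x) ^ s) v⁆ -
      ev (ν + s • a) h • ((toEnd k S V x) ^ s) v ∈ Y := by
  intro s
  induction s with
  | zero => intro _ h hh; simpa using hve h hh
  | succ s ih =>
    intro hs h hh
    have h1 := ih (by omega) h hh
    have h2 := hk s (by omega) h hh
    rw [pow_succ', Module.End.mul_apply, toEnd_apply_apply]
    set w := ((toEnd k S V x) ^ s) v
    have h3 := hY a (mem_zmultiples a) x hx _ h1
    have : ⁅h, ⁅x, w⁆⁆ - ev (ν + (s + 1) • a) h • ⁅x, w⁆ = ⁅⁅h, x⁆ - ev a h • x, w⁆ + ⁅x, ⁅h, w⁆ - ev (ν + s • a) h • w⁆ := by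
      rw [leibniz_lie h x w, succ_nsmul, ← add_assoc, map_add ev (ν + s • a), LinearMap.add_apply]
      simp only [sub_lie, smul_lie, lie_sub, lie_smul]
      module
    rw [this]
    exact add_mem h2 h3
theorem str2 (W : WD p Sg Vg ev) {a : D} {Y : Submodule k V} (hY : W.GSt a Y) {x : S} (hx : x ∈ Sg a) {ν : D} {v : V} (hve : ∀ h ∈ Sg 0, ⁅h, v⁆ - ev ν h • v ∈ Y) {t : ℕ} (hk : ∀ s < t, ∀ h ∈ Sg 0, ⁅⁅h, x⁆ - ev a h • x, ((toEnd k S V x) ^ s) v⁆ ∈ Y) {y : S} (hy : y ∈ Sg (-a)) (hyv : ⁅y, v⁆ ∈ Y) :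
    ∀ s ≤ t, ⁅y, ((toEnd k S V x) ^ (s + 1)) v⁆ + ev ((s + 1) • ν + (s + 1).choose 2 • a) ⁅x, y⁆ • ((toEnd k S V x) ^ s) v ∈ Y := by
  intro s
  have hxY := hY a (mem_zmultiples a) x hx
  induction s with
  | zero =>
    intro _
    have h1 := hve _ (W.lie_mem0 hx hy)
    have h2 := hxY _ hyv
    rw [leibniz_lie] at h2
    simp only [zero_add, pow_one, pow_zero, Module.End.one_apply, toEnd_apply_apply, one_nsmul, show Nat.choose 1 2 = 0 from rfl, zero_nsmul, add_zero]
    have := sub_mem h2 h1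
    convert this using 1
    abel
  | succ s ih =>
    intro hs
    have h1 := W.str hY hx hve hk (s + 1) hs _ (W.lie_mem0 hx hy)
    have h2 := hxY _ (ih (by omega))
    rw [pow_succ' _ (s + 1), Module.End.mul_apply, toEnd_apply_apply]
    have e1 : ⁅x, ((toEnd k S V x) ^ s) v⁆ = ((toEnd k S V x) ^ (s + 1)) v := by rw [pow_succ', Module.End.mul_apply, toEnd_apply_apply]
    rw [lie_add, lie_smul, e1, leibniz_lie] at h2
    set w := ((toEnd k S V x) ^ (s + 1)) v
    have e2 : (s + 1 + 1) • ν + (s + 1 + 1).choose 2 • a = ((s + 1) • ν + (s + 1).choose 2 • a) + (ν + (s + 1) • a) := by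
      rw [Nat.choose_succ_succ' (s + 1) 1, choose_one_right, succ_nsmul _ (s + 1), add_nsmul, show 1 + 1 = 2 from rfl]; module
    rw [e2, map_add ev ((s + 1) • ν + (s + 1).choose 2 • a), LinearMap.add_apply, add_smul]
    have := sub_mem h2 h1
    convert this using 1
    abel
theorem exm (W : WD p Sg Vg ev) {a : D} (ha : a ≠ 0) {Y : Submodule k V} {x : S} (hx : x ∈ Sg a) {ν : D} {v : V} (hv : v ∈ Vg ν) (hvY : v ∉ Y) : ∃ m, m + 2 ≤ p ∧ ((toEnd k S V x) ^ m) v ∉ Y ∧ ((toEnd k S V x) ^ (m + 1)) v ∈ Y := by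
  classical
  obtain ⟨j, hj, hb⟩ := W.nop ha ν
  have hex : ∃ n, ((toEnd k S V x) ^ n) v ∈ Y := ⟨j, by
    have := W.pow_mem hx hv j
    rw [hb, mem_bot] at this
    rw [this]; exact Y.zero_mem⟩
  have h0 : Nat.find hex ≠ 0 := by
    intro h
    have := Nat.find_spec hex
    rw [h] at this
    exact hvY (by simpa using this)
  have hle : Nat.find hex ≤ j := Nat.find_min' hex (by
    have := W.pow_mem hx hv j
    rw [hb, mem_bot] at this
    rw [this]; exact Y.zero_mem)
  refine ⟨Nat.find hex - 1, by omega, Nat.find_min hex (by omega), ?_⟩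
  rw [Nat.sub_add_cancel (Nat.one_le_iff_ne_zero.2 h0)]
  exact Nat.find_spec hex
theorem str3 (W : WD p Sg Vg ev) {a : D} {Y : Submodule k V} (hY : W.GSt a Y) {x : S} (hx : x ∈ Sg a) {ν : D} {v : V} (hve : ∀ h ∈ Sg 0, ⁅h, v⁆ - ev ν h • v ∈ Y) {t : ℕ} (hk : ∀ s < t, ∀ h ∈ Sg 0, ⁅⁅h, x⁆ - ev a h • x, ((toEnd k S V x) ^ s) v⁆ ∈ Y) {y : S} (hy : y ∈ Sg (-a)) (hyv : ⁅y, v⁆ ∈ Y) {m : ℕ} (hmt : m ≤ t) (hmp : m + 1 < p) (hm : ((toEnd k S V x) ^ m) v ∉ Y) (hm' : ((toEnd k S V x) ^ (m + 1)) v ∈ Y) :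
    2 * ev ν ⁅x, y⁆ = - (m * ev a ⁅x, y⁆) := by
  have h1 := W.str2 hY hx hve hk hy hyv m hmt
  have h2 := hY (-a) (neg_mem (mem_zmultiples a)) y hy _ hm'
  have h3 := (Submodule.add_mem_iff_right _ h2).1 h1
  have h4 : ev ((m + 1) • ν + (m + 1).choose 2 • a) ⁅x, y⁆ = 0 := by
    by_contra hne
    exact hm ((smul_mem_iff _ hne).1 h3)
  rw [map_add, map_nsmul, map_nsmul] at h4
  simp only [LinearMap.add_apply, LinearMap.smul_apply, nsmul_eq_mul] at h4
  have h5 : ((m + 1).choose 2 : k) * 2 = (m + 1) * m := by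
    have := Nat.choose_two_right (m + 1)
    have h6 : (m + 1).choose 2 * 2 = (m + 1) * m := by
      rw [this, Nat.add_sub_cancel]
      exact Nat.div_mul_cancel (by rw [mul_comm]; exact (Nat.even_mul_succ_self m).two_dvd)
    exact_mod_cast congrArg (Nat.cast : ℕ → k) h6
  have h6 : ((m + 1 : ℕ) : k) ≠ 0 := natne (p := p) (by omega) hmp
  have h7 : ((m + 1 : ℕ) : k) * (2 * ev ν ⁅x, y⁆ + m * ev a ⁅x, y⁆) = 0 := by
    push_cast at h4 ⊢
    linear_combination 2 * h4 - ev a ⁅x, y⁆ * h5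
  rcases mul_eq_zero.1 h7 with h | h
  · exact absurd h h6
  · linear_combination h
theorem brk (W : WD p Sg Vg ev) {a ν : D} (hν : Vg ν ≠ ⊥) {x y : S} (hx : x ∈ Sg a) (hy : y ∈ Sg (-a)) {m : k} (h : 2 * ev ν ⁅x, y⁆ = - (m * ev a ⁅x, y⁆)) (h0 : ev a ⁅x, y⁆ ≠ 0) {b : D} (hb : b ∈ zmultiples a) {x' y' : S} (hx' : x' ∈ Sg b) (hy' : y' ∈ Sg (-b)) :
    2 * ev ν ⁅x', y'⁆ = - (m * ev a ⁅x', y'⁆) := by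
  obtain ⟨r, hr⟩ := W.F2 a hν
  have h1 := hr a (mem_zmultiples a) x hx y hy
  have h2 := hr b hb x' hx' y' hy'
  have h3 : (2 * (r : k) + m) * ev a ⁅x, y⁆ = 0 := by rw [h1] at h; linear_combination h
  rcases mul_eq_zero.1 h3 with h3 | h3
  · rw [h2]; linear_combination ev a ⁅x', y'⁆ * h3
  · exact absurd h3 h0
theorem str4 (W : WD p Sg Vg ev) {a : D} {Y : Submodule k V} (hY : W.GSt a Y) {x : S} (hx : x ∈ Sg a) {ν : D} {v : V} (hve : ∀ h ∈ Sg 0, ⁅h, v⁆ - ev ν h • v ∈ Y) {t : ℕ} (hk : ∀ s < t, ∀ h ∈ Sg 0, ⁅⁅h, x⁆ - ev a h • x, ((toEnd k S V x) ^ s) v⁆ ∈ Y) {y : S} (hy : y ∈ Sg (-(2 • a))) (hyv : ⁅⁅x, y⁆, v⁆ ∈ Y) (hyv' : ⁅y, ⁅x, v⁆⁆ ∈ Y) :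
    ∀ s ≤ t, ⁅y, ((toEnd k S V x) ^ (s + 2)) v⁆ -
      ev ((s + 2).choose 2 • ν + (s + 2).choose 3 • a) ⁅x, ⁅x, y⁆⁆ •
        ((toEnd k S V x) ^ s) v ∈ Y := by
  have hxY := hY a (mem_zmultiples a) x hx
  have hy1 : ⁅x, y⁆ ∈ Sg (-a) := by
    have := W.sS.lie hx hy
    rwa [show a + -(2 • a) = -a by rw [two_nsmul]; abel] at this
  have hS := W.str2 hY hx hve hk hy1 hyv
  have e1 : ∀ s, ⁅x, ((toEnd k S V x) ^ s) v⁆ = ((toEnd k S V x) ^ (s + 1)) v := by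
    intro s
    rw [pow_succ', Module.End.mul_apply, toEnd_apply_apply]
  have e2 : ∀ s, ⁅y, ((toEnd k S V x) ^ (s + 1)) v⁆ = ⁅x, ⁅y, ((toEnd k S V x) ^ s) v⁆⁆ - ⁅⁅x, y⁆, ((toEnd k S V x) ^ s) v⁆ := by
    intro s
    rw [leibniz_lie x y, e1, add_sub_cancel_left]
  intro s
  induction s with
  | zero =>
    intro h0
    have h1 := hS 0 h0
    have h2 := hxY _ hyv'
    rw [e2 1]
    simp only [zero_add, pow_one, pow_zero, Module.End.one_apply, toEnd_apply_apply, one_nsmul, show Nat.choose 1 2 = 0 from rfl, zero_nsmul, add_zero] at h1 ⊢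
    have := sub_mem h2 h1
    convert this using 1
    simp [Nat.choose]
    abel
  | succ s ih =>
    intro hs
    have h1 := hS (s + 1) hs
    have h2 := hxY _ (ih (by omega))
    rw [e2 (s + 2)]
    rw [lie_sub, lie_smul, e1] at h2
    have e3 : (s + 1 + 2).choose 2 • ν + (s + 1 + 2).choose 3 • a = ((s + 2).choose 2 • ν + (s + 2).choose 3 • a) + ((s + 2) • ν + (s + 2).choose 2 • a) := by
      rw [show s + 1 + 2 = s + 2 + 1 by ring, Nat.choose_succ_succ' (s + 2) 1, Nat.choose_succ_succ' (s + 2) 2, choose_one_right, add_nsmul, add_nsmul, show 1 + 1 = 2 from rfl, show 2 + 1 = 3 from rfl]; module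
    rw [e3, map_add ev ((s + 2).choose 2 • ν + (s + 2).choose 3 • a), LinearMap.add_apply, add_smul]
    have := sub_mem h2 h1
    convert this using 1
    abel
theorem str5 (W : WD p Sg Vg ev) {a : D} {Y : Submodule k V} (hY : W.GSt a Y) {x : S} (hx : x ∈ Sg a) {ν : D} {v : V} (hve : ∀ h ∈ Sg 0, ⁅h, v⁆ - ev ν h • v ∈ Y) {t : ℕ} (hk : ∀ s < t, ∀ h ∈ Sg 0, ⁅⁅h, x⁆ - ev a h • x, ((toEnd k S V x) ^ s) v⁆ ∈ Y) {y : S} (hy : y ∈ Sg (-(2 • a))) (hyv : ⁅⁅x, y⁆, v⁆ ∈ Y) (hyv' : ⁅y, ⁅x, v⁆⁆ ∈ Y) {m : ℕ} (hm0 : 0 < m) (hmt : m ≤ t) (hmp : m + 2 < p) (hm : ((toEnd k S V x) ^ m) v ∉ Y) (hm' : ((toEnd k S V x) ^ (m + 1)) v ∈ Y) (h2 : 2 * ev ν ⁅x, ⁅x, y⁆⁆ = - (m * ev a ⁅x, ⁅x, y⁆⁆)) : ev a ⁅x, ⁅x, y⁆⁆ = 0 := by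
  obtain ⟨s, rfl⟩ : ∃ s, m = s + 1 := ⟨m - 1, by omega⟩
  have h1 := W.str4 hY hx hve hk hy hyv hyv' s (by omega)
  have h3 := hY (-(2 • a)) (neg_mem (nsmul_mem (mem_zmultiples a) 2)) y hy _ hm'
  have h4 := (Submodule.sub_mem_iff_right _ h3).1 h1
  have h5 : ev ((s + 2).choose 2 • ν + (s + 2).choose 3 • a) ⁅x, ⁅x, y⁆⁆ = 0 := by
    by_contra hne
    refine hm ?_
    rw [pow_succ', Module.End.mul_apply, toEnd_apply_apply]
    exact hY a (mem_zmultiples a) x hx _ ((smul_mem_iff _ hne).1 h4)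
  rw [map_add, map_nsmul, map_nsmul] at h5
  simp only [LinearMap.add_apply, LinearMap.smul_apply, nsmul_eq_mul] at h5
  have c2 : ((s + 2).choose 2 : k) * 2 = (s + 2) * (s + 1) := by
    have h := Nat.add_one_mul_choose_eq (s + 1) 1
    rw [choose_one_right] at h
    have := congrArg (Nat.cast : ℕ → k) h
    push_cast at this
    linear_combination -this
  have c3 : ((s + 2).choose 3 : k) * 6 = (s + 2) * (s + 1) * s := by
    have h := Nat.add_one_mul_choose_eq (s + 1) 2
    have h' := congrArg (Nat.cast : ℕ → k) h
    push_cast at h'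
    have g : ((s + 1).choose 2 : k) * 2 = (s + 1) * s := by
      have h := Nat.add_one_mul_choose_eq s 1
      rw [choose_one_right] at h
      have := congrArg (Nat.cast : ℕ → k) h
      push_cast at this
      linear_combination -this
    linear_combination -2 * h' + (s + 2) * g
  have n1 := natne (k := k) (p := p) (n := s + 1) (by omega) (by omega)
  have n2 := natne (k := k) (p := p) (n := s + 2) (by omega) (by omega)
  have n3 := natne (k := k) (p := p) (n := s + 3) (by omega) (by omega)
  have : ((s + 1 : ℕ) : k) * ((s + 2 : ℕ) : k) * ((s + 3 : ℕ) : k) * ev a ⁅x, ⁅x, y⁆⁆ = 0 := by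
    push_cast at h2 ⊢
    linear_combination -12 * h5 + 6 * ev ν ⁅x, ⁅x, y⁆⁆ * c2 + 2 * ev a ⁅x, ⁅x, y⁆⁆ * c3 + 3 * (s + 2) * (s + 1) * h2
  rcases mul_eq_zero.1 this with h | h
  · exact absurd h (mul_ne_zero (mul_ne_zero n1 n2) n3)
  · exact h
structure Adm (W : WD p Sg Vg ev) (Γ : AddSubgroup D) (n : D → Submodule k S) : Prop where
  le : ∀ a, n a ≤ Sg a
  off : ∀ a, a ∉ Γ → n a = ⊥
  zero : n 0 = W.N
  J : ∀ a ∈ Γ, W.J a ≤ n a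
  br : ∀ a b x y, x ∈ n a → y ∈ n b → ⁅x, y⁆ ∈ n (a + b)
  H : ∀ a h x, h ∈ Sg 0 → x ∈ n a → ⁅h, x⁆ ∈ n a
theorem Adm.nil {W : WD p Sg Vg ev} {Γ : AddSubgroup D} {n : D → Submodule k S} (A : W.Adm Γ n) (a : D) (x : S) (hx : x ∈ n a) : IsNilpotent (toEnd k S V x) := by
  by_cases ha : a = 0
  · subst ha
    rw [A.zero] at hx
    exact W.nilN hx
  · exact W.nilV ha (A.le a hx)
theorem Adm.lastV {W : WD p Sg Vg ev} {Γ : AddSubgroup D} {n : D → Submodule k S} (A : W.Adm Γ n) (P : V → Prop) (h0 : ¬ P 0) (v : V) (hv : P v) :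
    ∃ w, P w ∧ (∀ a, ∀ x ∈ n a, ¬ P ⁅x, w⁆) ∧ (∀ h ∈ Sg 0, ∀ χ, w ∈ Vg χ → ¬ P (⁅h, w⁆ - ev χ h • w)) :=
  W.sV.last n A.le A.br A.H (fun h h' hh hh' => by rw [A.zero]; exact W.HH hh hh') A.nil P h0 v hv
theorem Adm.lastS {W : WD p Sg Vg ev} {Γ : AddSubgroup D} {n : D → Submodule k S} (A : W.Adm Γ n) (P : S → Prop) (h0 : ¬ P 0) (v : S) (hv : P v) :
    ∃ w, P w ∧ (∀ a, ∀ x ∈ n a, ¬ P ⁅x, w⁆) ∧ (∀ h ∈ Sg 0, ∀ χ, w ∈ Sg χ → ¬ P (⁅h, w⁆ - ev χ h • w)) :=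
  W.sS.last n A.le A.br A.H (fun h h' hh hh' => by rw [A.zero]; exact W.HH hh hh')
    (fun a x hx => W.nilS (A.nil a x hx)) P h0 v hv
open Classical in
noncomputable def JF (W : WD p Sg Vg ev) (Γ : AddSubgroup D) (a : D) : Submodule k S :=
  if a ∈ Γ then W.J a else ⊥
theorem JF_mem (W : WD p Sg Vg ev) {Γ : AddSubgroup D} {a : D} (ha : a ∈ Γ) : W.JF Γ a = W.J a :=
  if_pos ha
theorem JF_sub {W : WD p Sg Vg ev} {Γ : AddSubgroup D} {a : D} {x : S} (hx : x ∈ W.JF Γ a) :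
    x = 0 ∨ (a ∈ Γ ∧ x ∈ W.J a) := by
  by_cases ha : a ∈ Γ
  · rw [JF, if_pos ha] at hx; exact Or.inr ⟨ha, hx⟩
  · rw [JF, if_neg ha] at hx; exact Or.inl hx
theorem JF_adm (W : WD p Sg Vg ev) (Γ : AddSubgroup D) : W.Adm Γ (W.JF Γ) where
  le := fun a x hx => by
    rcases JF_sub hx with rfl | ⟨_, h⟩
    · exact Submodule.zero_mem _
    · exact W.J_le _ h
  off := fun a ha => if_neg ha
  zero := by rw [W.JF_mem Γ.zero_mem, J_zero]
  J := fun a ha => by rw [W.JF_mem ha]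
  br := fun a b x y hx hy => by
    rcases JF_sub hx with rfl | ⟨ha, hx⟩
    · rw [zero_lie]; exact Submodule.zero_mem _
    rcases JF_sub hy with rfl | ⟨hb, hy⟩
    · rw [lie_zero]; exact Submodule.zero_mem _
    rw [W.JF_mem (Γ.add_mem ha hb)]
    exact W.JJ hx hy
  H := fun a h x hh hx => by
    rcases JF_sub hx with rfl | ⟨ha, hx⟩
    · rw [lie_zero]; exact Submodule.zero_mem _
    rw [W.JF_mem ha]
    exact W.HJ hh hx
open Classical in
noncomputable def adj (n : D → Submodule k S) (κ : D) (e : S) (a : D) : Submodule k S :=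
  n a ⊔ (if a = κ then k ∙ e else ⊥)
theorem le_adj (n : D → Submodule k S) (κ : D) (e : S) (a : D) : n a ≤ adj n κ e a := le_sup_left
theorem mem_adj (n : D → Submodule k S) (κ : D) (e : S) : e ∈ adj n κ e κ := by
  rw [adj, if_pos rfl]
  exact mem_sup_right (mem_span_singleton_self e)
theorem adj_cases {n : D → Submodule k S} {κ : D} {e : S} {a : D} {x : S} (hx : x ∈ adj n κ e a) :
    x ∈ n a ∨ (a = κ ∧ ∃ y ∈ n a, ∃ c : k, x = y + c • e) := by
  by_cases h : a = κ
  · rw [adj, if_pos h] at hx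
    obtain ⟨y, hy, z, hz, rfl⟩ := mem_sup.1 hx
    obtain ⟨c, rfl⟩ := mem_span_singleton.1 hz
    exact Or.inr ⟨h, y, hy, c, rfl⟩
  · rw [adj, if_neg h, sup_bot_eq] at hx
    exact Or.inl hx
theorem Adm.adjoin {W : WD p Sg Vg ev} {Γ : AddSubgroup D} {n : D → Submodule k S} (A : W.Adm Γ n) {κ : D} (hκ : κ ∈ Γ) (hκ0 : κ ≠ 0) {e : S} (he : e ∈ Sg κ) (h1 : ∀ a ∈ Γ, ∀ x ∈ n a, ⁅x, e⁆ ∈ n (a + κ)) (h2 : ∀ h ∈ Sg 0, ⁅h, e⁆ - ev κ h • e ∈ n κ) : W.Adm Γ (adj n κ e) where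
  le := fun a x hx => by
    rcases adj_cases hx with h | ⟨rfl, y, hy, c, rfl⟩
    · exact A.le a h
    · exact Submodule.add_mem _ (A.le _ hy) (smul_mem _ _ he)
  off := fun a ha => by
    have h : a ≠ κ := fun h => ha (h ▸ hκ)
    rw [adj, A.off a ha, if_neg h, sup_bot_eq]
  zero := by rw [adj, if_neg (Ne.symm hκ0), sup_bot_eq, A.zero]
  J := fun a ha => (A.J a ha).trans le_sup_left
  br := fun a b x y hx hy => by
    have h1' : ∀ a, ∀ x ∈ n a, ⁅x, e⁆ ∈ n (a + κ) := by
      intro a x hx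
      by_cases ha : a ∈ Γ
      · exact h1 a ha x hx
      · rw [A.off a ha, mem_bot] at hx
        rw [hx, zero_lie]; exact Submodule.zero_mem _
    have h1'' : ∀ a, ∀ x ∈ n a, ⁅e, x⁆ ∈ n (κ + a) := by
      intro a x hx
      rw [← lie_skew, add_comm]; exact Submodule.neg_mem _ (h1' a x hx)
    refine le_adj n κ e _ ?_
    rcases adj_cases hx with hx1 | ⟨rfl, x', hx', c, rfl⟩ <;>
      rcases adj_cases hy with hy1 | ⟨rfl, y', hy', c', rfl⟩
    · exact A.br _ _ _ _ hx1 hy1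
    · rw [lie_add, lie_smul]
      exact add_mem (A.br _ _ _ _ hx1 hy') (smul_mem _ _ (h1' _ _ hx1))
    · rw [add_lie, smul_lie]
      exact add_mem (A.br _ _ _ _ hx' hy1) (smul_mem _ _ (h1'' _ _ hy1))
    · rw [add_lie, smul_lie, lie_add, lie_add, lie_smul, lie_smul, lie_self, smul_zero, add_zero]
      exact add_mem (add_mem (A.br _ _ _ _ hx' hy') (smul_mem _ _ (h1' _ _ hx')))
        (smul_mem _ _ (h1'' _ _ hy'))
  H := fun a h x hh hx => by
    rcases adj_cases hx with hx | ⟨rfl, x', hx', c, rfl⟩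
    · exact le_adj n κ e _ (A.H _ _ _ hh hx)
    · rw [lie_add, lie_smul, ← sub_add_cancel ⁅h, e⁆ (ev a h • e)]
      refine add_mem (le_adj n a e _ (A.H _ _ _ hh hx')) (smul_mem _ _ (add_mem ?_ ?_))
      · exact le_adj n a e _ (h2 h hh)
      · exact smul_mem _ _ (mem_adj n a e)
def AMax (W : WD p Sg Vg ev) (Γ : AddSubgroup D) (n : D → Submodule k S) : Prop :=
  ∀ n', W.Adm Γ n' → (∀ a, n a ≤ n' a) → ∀ a, n' a ≤ n a
theorem Adm.exists_max {W : WD p Sg Vg ev} {Γ : AddSubgroup D} {n : D → Submodule k S} (A : W.Adm Γ n) : ∃ n', W.Adm Γ n' ∧ (∀ a, n a ≤ n' a) ∧ W.AMax Γ n' := by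
  let T : Set (Submodule k S) := {U | ∃ n', W.Adm Γ n' ∧ (∀ a, n a ≤ n' a) ∧ U = ⨆ a, n' a}
  obtain ⟨U, ⟨n', A', hle, hU⟩, hmax⟩ := (wellFounded_gt (α := Submodule k S)).has_min T
    ⟨_, n, A, fun a => le_rfl, rfl⟩
  refine ⟨n', A', hle, fun n'' A'' hle' a x hx => ?_⟩
  have h1 : U ≤ ⨆ a, n'' a := by rw [hU]; exact iSup_mono hle'
  have h2 : ¬ (U < ⨆ a, n'' a) := hmax _ ⟨n'', A'', fun a => (hle a).trans (hle' a), rfl⟩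
  have h3 : U = ⨆ a, n'' a := eq_of_le_of_not_lt h1 h2
  refine indep_part W.sS.ind A'.le (A''.le a hx) ?_
  rw [← hU, h3]
  exact Submodule.mem_iSup_of_mem a hx
theorem AMax.ext {W : WD p Sg Vg ev} {Γ : AddSubgroup D} {n : D → Submodule k S} (A : W.Adm Γ n) (M : W.AMax Γ n) {κ : D} (hκ : κ ∈ Γ) (hκ0 : κ ≠ 0) {e : S} (he : e ∈ Sg κ) (h1 : ∀ a ∈ Γ, ∀ x ∈ n a, ⁅x, e⁆ ∈ n (a + κ)) (h2 : ∀ h ∈ Sg 0, ⁅h, e⁆ - ev κ h • e ∈ n κ) : e ∈ n κ :=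
  M _ (A.adjoin hκ hκ0 he h1 h2) (le_adj n κ e) κ (mem_adj n κ e)
include k in
theorem zmul_eq [Fact p.Prime] [CharP k p] {β κ : D} (h : κ ∈ zmultiples β) (h0 : κ ≠ 0) : ∃ t : ℕ, 0 < t ∧ t < p ∧ β = t • κ := by
  have hp : p.Prime := Fact.out
  obtain ⟨i, rfl⟩ := AddSubgroup.mem_zmultiples_iff.1 h
  have hi : (i : ZMod p) ≠ 0 := by
    intro hi
    apply h0
    rw [ZMod.intCast_zmod_eq_zero_iff_dvd] at hi
    obtain ⟨j, rfl⟩ := hi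
    rw [mul_comm, mul_smul, natCast_zsmul, p_nsmul (k := k), smul_zero]
  refine ⟨((i : ZMod p)⁻¹).val, ?_, ZMod.val_lt _, ?_⟩
  · rw [ZMod.val_pos]; exact inv_ne_zero hi
  · have h1 : (((((i : ZMod p)⁻¹).val : ℤ) * i : ℤ) : ZMod p) = ((1 : ℤ) : ZMod p) := by
      push_cast
      rw [ZMod.natCast_zmod_val, inv_mul_cancel₀ hi]
    rw [ZMod.intCast_eq_intCast_iff_dvd_sub] at h1
    obtain ⟨j, hj⟩ := h1
    have h2 : (1 : ℤ) • β = ((((i : ZMod p)⁻¹).val : ℤ) * i) • β + ((p : ℤ) * j) • β := by rw [← hj, ← add_smul]; congr 1; ring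
    rw [one_smul, mul_comm (p : ℤ), mul_smul j, natCast_zsmul, p_nsmul (k := k), smul_zero, add_zero, mul_smul, natCast_zsmul] at h2
    exact h2
include k in
theorem zmul_eq' [Fact p.Prime] [CharP k p] {β κ : D} (h : κ ∈ zmultiples β) (h0 : κ ≠ 0) : zmultiples κ = zmultiples β := by
  obtain ⟨t, _, _, ht⟩ := zmul_eq (k := k) (p := p) h h0
  refine le_antisymm ?_ ?_
  · rwa [AddSubgroup.zmultiples_le]
  · rw [AddSubgroup.zmultiples_le, ht]
    exact nsmul_mem (mem_zmultiples κ) t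
def CaseA (W : WD p Sg Vg ev) : Prop :=
  ∃ (κ : D) (e f : S) (ν : D) (v : V), κ ≠ 0 ∧ e ∈ Sg κ ∧ f ∈ Sg (-κ) ∧ ev κ ⁅e, f⁆ ≠ 0 ∧ v ∈ Vg ν ∧ ((toEnd k S V e) ^ (p - 2)) v ≠ 0
theorem coreb (W : WD p Sg Vg ev) {Γ : AddSubgroup D} {n : D → Submodule k S} (A : W.Adm Γ n) (M : W.AMax Γ n) {b : D} (hb : b ∈ Γ) (hb0 : b ≠ 0) {x : S} (hx : x ∈ Sg b) (hxJ : x ∉ W.J b) :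
    ∃ (κ : D) (e f : S), κ ∈ Γ ∧ κ ≠ 0 ∧ e ∈ Sg κ ∧ f ∈ n (-κ) ∧ ⁅e, f⁆ ∉ W.N ∧ (∀ a, a + κ ≠ 0 → ∀ x ∈ n a, ⁅x, e⁆ ∈ n (a + κ)) ∧ (∀ h ∈ Sg 0, ⁅h, e⁆ - ev κ h • e ∈ n κ) := by
  have hex : ∃ w : S, ∃ a ∈ Γ, a ≠ 0 ∧ w ∈ Sg a ∧ w ∉ n a := by
    by_contra hc
    push Not at hc
    refine hxJ ((mem_J hb0).2 ⟨hx, fun y hy => ?_⟩)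
    have := A.br _ _ _ _ (hc x b hb hb0 hx) (hc y (-b) (Γ.neg_mem hb) (neg_ne_zero.2 hb0) hy)
    rwa [add_neg_cancel, A.zero] at this
  obtain ⟨w, hw⟩ := hex
  obtain ⟨e, ⟨κ, hκ, hκ0, he, hen⟩, hl1, hl2⟩ := A.lastS
    (fun w => ∃ a ∈ Γ, a ≠ 0 ∧ w ∈ Sg a ∧ w ∉ n a)
    (by rintro ⟨a, _, _, _, h⟩; exact h (Submodule.zero_mem _)) w hw
  have g1 : ∀ a, a + κ ≠ 0 → ∀ x ∈ n a, ⁅x, e⁆ ∈ n (a + κ) := by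
    intro a ha x hx
    by_cases haΓ : a ∈ Γ
    · by_contra hcon
      exact hl1 a x hx ⟨a + κ, Γ.add_mem haΓ hκ, ha, W.sS.lie (A.le a hx) he, hcon⟩
    · rw [A.off a haΓ, mem_bot] at hx
      rw [hx, zero_lie]; exact Submodule.zero_mem _
  have g2 : ∀ h ∈ Sg 0, ⁅h, e⁆ - ev κ h • e ∈ n κ := by
    intro h hh
    by_contra hcon
    exact hl2 h hh κ he ⟨κ, hκ, hκ0, sub_mem (W.sS.lie0 hh he) (smul_mem _ _ he), hcon⟩
  have g3 : ∃ f ∈ n (-κ), ⁅e, f⁆ ∉ W.N := by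
    by_contra hc
    push Not at hc
    refine hen (AMax.ext A M hκ hκ0 he ?_ g2)
    intro a ha x hx
    by_cases h0 : a + κ = 0
    · rw [h0, A.zero, ← lie_skew]
      have : a = -κ := eq_neg_of_add_eq_zero_left h0
      subst this
      exact Submodule.neg_mem _ (hc x hx)
    · exact g1 a h0 x hx
  obtain ⟨f, hf, hef⟩ := g3
  exact ⟨κ, e, f, hκ, hκ0, he, hf, hef, g1, g2⟩
def Sing (_ : WD p Sg Vg ev) (β χ : D) : Prop :=
  ∀ a ∈ zmultiples β, ∀ x ∈ Sg a, ∀ y ∈ Sg (-a), ev χ ⁅x, y⁆ = 0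
theorem corec (W : WD p Sg Vg ev) {κ : D} {n : D → Submodule k S} (A : W.Adm (zmultiples κ) n) {e f : S} (he : e ∈ Sg κ) (hf : f ∈ Sg (-κ)) (hef : ⁅e, f⁆ ∉ W.N) :
    ∃ (Y : Submodule k V) (ν : D) (v : V), W.GSt κ Y ∧ v ∈ Vg ν ∧ v ∉ Y ∧ (∀ h ∈ Sg 0, ⁅h, v⁆ - ev ν h • v ∈ Y) ∧ (∀ a, ∀ x ∈ n a, ⁅x, v⁆ ∈ Y) ∧ ev ν ⁅e, f⁆ ≠ 0 := by
  classical
  set Γ := zmultiples κ with hΓ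
  have hκΓ : κ ∈ Γ := mem_zmultiples κ
  have hκef : ev κ ⁅e, f⁆ ≠ 0 := fun h => hef (W.mem_N_of_line hκΓ he hf h)
  have hns : ∀ χ, Vg χ ≠ ⊥ → ev χ ⁅e, f⁆ = 0 → W.Sing κ χ := by
    intro χ hχ h0 a ha x hx y hy
    obtain ⟨r, hr⟩ := W.F2 κ hχ
    have h1 := hr κ hκΓ e he f hf
    rw [h0] at h1
    rcases mul_eq_zero.1 h1.symm with h | h
    · rw [hr a ha x hx y hy, h, zero_mul]
    · exact absurd h hκef
  let V0 : Submodule k V := ⨆ χ, if ev χ ⁅e, f⁆ = 0 then Vg χ else ⊥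
  have hV0 : ∀ χ, ev χ ⁅e, f⁆ = 0 → Vg χ ≤ V0 := by
    intro χ hχ
    refine le_trans ?_ (le_iSup _ χ)
    rw [if_pos hχ]
  let Y : Submodule k V := sSup {Z | W.GSt κ Z ∧ Z ≤ V0}
  have hYS : W.GSt κ Y := by
    intro a ha x hx v hv
    have : Y ≤ Y.comap (toEnd k S V x) := by
      refine sSup_le fun Z hZ z hz => ?_
      exact (le_sSup hZ : Z ≤ Y) (hZ.1 a ha x hx z hz)
    exact this hv
  have hYV : Y ≤ V0 := sSup_le fun Z hZ => hZ.2
  have hYm : ∀ Z, W.GSt κ Z → Z ≤ V0 → Z ≤ Y := fun Z h1 h2 => le_sSup ⟨h1, h2⟩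
  have hY0 := hYS 0 Γ.zero_mem
  obtain ⟨χ, hχ, hχ0⟩ : ∃ χ, Vg χ ≠ ⊥ ∧ ev χ ⁅e, f⁆ ≠ 0 := by
    by_contra hc
    push Not at hc
    exact hef ⟨W.lie_mem0 he hf, hc⟩
  obtain ⟨u, hu, hu0⟩ := (Submodule.ne_bot_iff _).1 hχ
  have huY : u ∉ Y := by
    intro h
    have h1 := indep_part W.sV.ind (n := fun χ => if ev χ ⁅e, f⁆ = 0 then Vg χ else ⊥) (by
      intro a
      split_ifs
      · exact le_rfl
      · exact bot_le) hu (hYV h)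
    rw [if_neg hχ0] at h1
    exact hu0 h1
  obtain ⟨v, ⟨hvY, ν, hv⟩, hl1, hl2⟩ := A.lastV (fun v => v ∉ Y ∧ ∃ ν, v ∈ Vg ν)
    (fun h => h.1 Y.zero_mem) u ⟨huY, χ, hu⟩
  have hnv : ∀ a, ∀ x ∈ n a, ⁅x, v⁆ ∈ Y := by
    intro a x hx
    by_contra hc
    exact hl1 a x hx ⟨hc, a + ν, W.sV.lie (A.le a hx) hv⟩
  have hve : ∀ h ∈ Sg 0, ⁅h, v⁆ - ev ν h • v ∈ Y := by
    intro h hh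
    by_contra hc
    exact hl2 h hh ν hv ⟨hc, ν, sub_mem (W.sV.lie0 hh hv) (smul_mem _ _ hv)⟩
  by_cases hν : ev ν ⁅e, f⁆ = 0
  swap
  · exact ⟨Y, ν, v, hYS, hv, hvY, hve, hnv, hν⟩
  have hνb : Vg ν ≠ ⊥ := by
    intro hb
    rw [hb, mem_bot] at hv
    exact hvY (hv ▸ Y.zero_mem)
  have hsing := hns ν hνb hν
  obtain ⟨l, hlΓ, hl0, g, hg, hgv⟩ : ∃ l ∈ Γ, l ≠ 0 ∧ ∃ g ∈ Sg l, ⁅g, v⁆ ∉ Y := by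
    by_contra hc
    push Not at hc
    refine hvY (hYm (Y ⊔ k ∙ v) ?_ ?_ (mem_sup_right (mem_span_singleton_self v)))
    · intro a ha x hx w hw
      obtain ⟨y, hy, z, hz, rfl⟩ := mem_sup.1 hw
      obtain ⟨c, rfl⟩ := mem_span_singleton.1 hz
      rw [lie_add, lie_smul]
      refine add_mem (mem_sup_left (hYS a ha x hx y hy)) (smul_mem _ _ ?_)
      by_cases h0 : a = 0
      · subst h0
        rw [← sub_add_cancel ⁅x, v⁆ (ev ν x • v)]
        exact add_mem (mem_sup_left (hve x hx)) (mem_sup_right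
          (smul_mem _ _ (mem_span_singleton_self v)))
      · exact mem_sup_left (hc a ha h0 x hx)
    · refine sup_le hYV ?_
      rw [Submodule.span_singleton_le_iff_mem]
      exact hV0 ν hν hv
  obtain ⟨u', ⟨hu'Y, l', hl'Γ, hl'0, g', hg', hu'V, hu'g⟩, hm1, hm2⟩ := A.lastV
    (fun u => u ∉ Y ∧ ∃ l ∈ Γ, l ≠ 0 ∧ ∃ g ∈ Sg l, u ∈ Vg (l + ν) ∧ u - ⁅g, v⁆ ∈ Y)
    (fun h => h.1 Y.zero_mem) ⁅g, v⁆ ⟨hgv, l, hlΓ, hl0, g, hg, W.sV.lie hg hv, by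
      rw [sub_self]; exact Y.zero_mem⟩
  refine ⟨Y, l' + ν, u', hYS, hu'V, hu'Y, ?_, ?_, ?_⟩
  · intro h hh
    by_contra hc
    refine hm2 h hh _ hu'V ⟨hc, l', hl'Γ, hl'0, ⁅h, g'⁆ - ev l' h • g', sub_mem (W.sS.lie0 hh hg') (smul_mem _ _ hg'), sub_mem (W.sV.lie0 hh hu'V) (smul_mem _ _ hu'V), ?_⟩
    have h1 := hY0 h hh _ hu'g
    have h2 := hYS l' hl'Γ g' hg' _ (hve h hh)
    have h3 := smul_mem _ (ev (l' + ν) h) hu'g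
    have := sub_mem (add_mem h1 h2) h3
    convert this using 1
    rw [map_add, LinearMap.add_apply]
    simp only [lie_sub, sub_lie, smul_lie, lie_smul]
    rw [leibniz_lie h g' v]
    module
  · intro a x hx
    by_contra hc
    have haΓ : a ∈ Γ := by
      by_contra ha
      rw [A.off a ha, mem_bot] at hx
      rw [hx, zero_lie] at hc
      exact hc Y.zero_mem
    have h1 : ⁅x, u'⁆ - ⁅⁅x, g'⁆, v⁆ ∈ Y := by
      have := add_mem (hYS a haΓ x (A.le a hx) _ hu'g) (hYS l' hl'Γ g' hg' _ (hnv a x hx))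
      convert this using 1
      rw [lie_sub, leibniz_lie x g' v]; abel
    by_cases h0 : a + l' = 0
    · have hx0 : ⁅x, g'⁆ ∈ Sg 0 := by
        have := W.sS.lie (A.le a hx) hg'
        rwa [h0] at this
      have h2 := hve _ hx0
      rw [hsing a haΓ x (A.le a hx) g' (by rwa [← eq_neg_of_add_eq_zero_right h0]), zero_smul, sub_zero] at h2
      have := add_mem h1 h2
      rw [sub_add_cancel] at this
      exact hc this
    · refine hm1 a x hx ⟨hc, a + l', Γ.add_mem haΓ hl'Γ, h0, ⁅x, g'⁆, W.sS.lie (A.le a hx) hg', ?_, h1⟩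
      rw [add_assoc]
      exact W.sV.lie (A.le a hx) hu'V
  · rw [map_add, LinearMap.add_apply, hν, add_zero]
    intro h0
    obtain ⟨t, _, _, ht⟩ := zmul_eq (k := k) (p := p) hl'Γ hl'0
    apply hκef
    rw [ht, map_nsmul, LinearMap.smul_apply, h0, smul_zero]
local notation "ρ" => toEnd k S V
include k in
theorem zmul_nat {κ a : D} (h : a ∈ zmultiples κ) : ∃ r : ℕ, r < p ∧ a = r • κ := by
  have hp : p.Prime := Fact.out
  obtain ⟨i, rfl⟩ := AddSubgroup.mem_zmultiples_iff.1 h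
  have h0 : (0 : ℤ) < p := by exact_mod_cast hp.pos
  refine ⟨(i % p).toNat, ?_, ?_⟩
  · have := Int.emod_lt_of_pos i h0
    have := Int.emod_nonneg i h0.ne'
    omega
  · rw [← natCast_zsmul, Int.toNat_of_nonneg (Int.emod_nonneg i h0.ne')]
    conv_lhs => rw [← Int.emod_add_mul_ediv i p]
    rw [add_smul, mul_comm, mul_smul, natCast_zsmul, p_nsmul (k := k), smul_zero, add_zero]
include k in
theorem pm1 (κ : D) : κ = -((p - 1) • κ) := by
  have hp : p.Prime := Fact.out
  rw [eq_neg_iff_add_eq_zero, ← succ_nsmul', show p - 1 + 1 = p by have := hp.pos; omega, p_nsmul (k := k)]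
theorem core1 (W : WD p Sg Vg ev) {κ : D} (hκ0 : κ ≠ 0) {n : D → Submodule k S} (A : W.Adm (zmultiples κ) n) {e f : S} (he : e ∈ Sg κ) (hf : f ∈ n (-κ)) (hef : ⁅e, f⁆ ∉ W.N) (g1 : ∀ a, a + κ ≠ 0 → ∀ x ∈ n a, ⁅x, e⁆ ∈ n (a + κ)) (g2 : ∀ h ∈ Sg 0, ⁅h, e⁆ - ev κ h • e ∈ n κ) (hA : ¬ W.CaseA) :
    ∃ (Y : Submodule k V) (ν : D) (v : V) (m : ℕ), W.GSt κ Y ∧ v ∈ Vg ν ∧ v ∉ Y ∧ 1 ≤ m ∧ m + 2 < p ∧ 2 * ev ν ⁅e, f⁆ = -(m * ev κ ⁅e, f⁆) ∧ (∀ s ≤ p - 1, ∀ h ∈ Sg 0, ⁅h, ((ρ e) ^ s) v⁆ - ev (ν + s • κ) h • ((ρ e) ^ s) v ∈ Y) ∧ ((ρ e) ^ m) v ∉ Y ∧ ((ρ e) ^ (m + 1)) v ∈ Y ∧ (∀ a, ∀ x ∈ n a, (a ≠ -κ ∨ ⁅e, x⁆ ∈ W.N) → ∀ s ≤ p - 1,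 ⁅x, ((ρ e) ^ s) v⁆ ∈ Y) ∧ (∀ y ∈ n (-(2 • κ)), ⁅e, ⁅e, y⁆⁆ ∈ W.N) := by
  have hp : p.Prime := Fact.out
  have hκΓ := mem_zmultiples κ
  have hfS := A.le _ hf
  have hκef : ev κ ⁅e, f⁆ ≠ 0 := fun h => hef (W.mem_N_of_line hκΓ he hfS h)
  obtain ⟨Y, ν, v, hY, hv, hvY, hve, hnv, hν⟩ := W.corec A he hfS hef
  have hVν : Vg ν ≠ ⊥ := fun h => hvY (by
    rw [h, mem_bot] at hv; rw [hv]; exact Y.zero_mem)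
  have hSκ : Sg κ ≠ ⊥ := fun h => hef (by
    rw [h, mem_bot] at he; rw [he, zero_lie]; exact Submodule.zero_mem _)
  have heY := hY κ hκΓ e he
  have hsucc : ∀ s, ((ρ e) ^ (s + 1)) v = ⁅e, ((ρ e) ^ s) v⁆ := by intro s; rw [pow_succ', Module.End.mul_apply, toEnd_apply_apply]
  have hcomm : ∀ (y : S) (s : ℕ), ⁅y, ((ρ e) ^ (s + 1)) v⁆ = ⁅e, ⁅y, ((ρ e) ^ s) v⁆⁆ + ⁅⁅y, e⁆, ((ρ e) ^ s) v⁆ := by intro y s; rw [hsucc, leibniz_lie, add_comm]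
  have hsub : ∀ r : ℕ, 1 ≤ r → r + 1 < p → ∀ y ∈ n (-((r + 1) • κ)), ⁅y, e⁆ ∈ n (-(r • κ)) := by
    intro r hr hr' y hy
    have h1 : -((r + 1) • κ) + κ = -(r • κ) := by rw [succ_nsmul]; abel
    have h2 := g1 (-((r + 1) • κ)) (by
      rw [h1, neg_ne_zero]
      exact fun h => by
        have := (nsmul_eq_zero_of_char (k := k) (p := p) hκ0).1 h
        exact absurd (Nat.le_of_dvd hr this) (by omega)) y hy
    rwa [h1] at h2
  have hAA : ∀ s r : ℕ, s < r → r < p → ∀ y ∈ n (-(r • κ)), ⁅y, ((ρ e) ^ s) v⁆ ∈ Y := by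
    intro s
    induction s with
    | zero => intro r _ _ y hy; exact hnv _ y hy
    | succ s ih =>
      intro r hr hrp y hy
      rw [hcomm]
      refine add_mem (heY _ (ih r (by omega) hrp y hy)) ?_
      obtain ⟨r', rfl⟩ : ∃ r', r = r' + 1 := ⟨r - 1, by omega⟩
      exact ih r' (by omega) (by omega) _ (hsub r' (by omega) hrp y hy)
  have hk : ∀ s < p - 1, ∀ h ∈ Sg 0, ⁅⁅h, e⁆ - ev κ h • e, ((ρ e) ^ s) v⁆ ∈ Y := by
    intro s hs h hh
    refine hAA s (p - 1) hs (by omega) _ ?_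
    rw [← pm1 (k := k)]
    exact g2 h hh
  have hstr := W.str hY he hve hk
  have hNv : ∀ s ≤ p - 1, ∀ x ∈ W.N, ⁅x, ((ρ e) ^ s) v⁆ ∈ Y := by
    intro s hs x hx
    have h1 := hstr s hs x hx.1
    rw [map_add, LinearMap.add_apply, hx.2 ν hVν, map_nsmul, LinearMap.smul_apply, W.root_N hSκ hx] at h1
    simpa using h1
  obtain ⟨m, hmp, hm, hm'⟩ := W.exm hκ0 he hv hvY
  have h3 := W.str3 hY he hve hk hfS (hnv _ f hf) (by omega) (by omega) hm hm'
  have hp2 : (2 : k) ≠ 0 ∨ p = 2 := by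
    by_cases h : p = 2
    · exact Or.inr h
    · have := natne (k := k) (p := p) (n := 2) (by norm_num) (by have := hp.two_le; omega)
      exact Or.inl (by exact_mod_cast this)
  have hmA : m ≠ p - 2 := by
    rintro rfl
    exact hA ⟨κ, e, f, ν, v, hκ0, he, hfS, hκef, hv, fun h => hm (by rw [h]; exact Y.zero_mem)⟩
  have hm1 : 1 ≤ m := by
    rcases Nat.eq_zero_or_pos m with h | h
    · subst h
      rcases hp2 with h2 | h2
      · simp only [Nat.cast_zero, zero_mul, neg_zero, mul_eq_zero, h2, hν, or_self] at h3
      · omega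
    · exact h
  have hbrk := fun {b : D} (hb : b ∈ zmultiples κ) {x' y' : S} (hx' : x' ∈ Sg b)
    (hy' : y' ∈ Sg (-b)) => W.brk hVν he hfS h3 hκef hb hx' hy'
  have hK1 : ∀ y ∈ n (-κ), ⁅e, y⁆ ∈ W.N → ∀ s ≤ p - 1, ⁅y, ((ρ e) ^ s) v⁆ ∈ Y := by
    intro y hy hey s hs
    rcases s with _ | s
    · exact hnv _ y hy
    · have h1 := W.str2 hY he hve hk (A.le _ hy) (hnv _ y hy) s (by omega)
      have h0 : ev ((s + 1) • ν + (s + 1).choose 2 • κ) ⁅e, y⁆ = 0 := by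
        rw [map_add, LinearMap.add_apply, map_nsmul, LinearMap.smul_apply, hey.2 ν hVν, map_nsmul, LinearMap.smul_apply, W.root_N hSκ hey]
        simp
      rw [h0, zero_smul, add_zero] at h1
      exact h1
  have he2 : ∀ y ∈ n (-(2 • κ)), ⁅e, ⁅e, y⁆⁆ ∈ W.N := by
    intro y hy
    have hye : ⁅e, y⁆ ∈ n (-κ) := by
      rw [← lie_skew]
      have := hsub 1 le_rfl (by omega) y hy
      rw [one_nsmul] at this
      exact neg_mem this
    refine W.mem_N_of_line hκΓ he (A.le _ hye) ?_
    refine W.str5 hY he hve hk (A.le _ hy) (hnv _ _ hye) ?_ hm1 (by omega) (by omega) hm hm'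
      (hbrk hκΓ he (A.le _ hye))
    have := hAA 1 2 (by omega) (by omega) y hy
    rwa [pow_one, toEnd_apply_apply] at this
  have hK : ∀ r : ℕ, 1 ≤ r → r < p → ∀ y ∈ n (-(r • κ)), (r = 1 → ⁅e, y⁆ ∈ W.N) → ∀ s ≤ p - 1, ⁅y, ((ρ e) ^ s) v⁆ ∈ Y := by
    intro r hr
    induction r, hr using le_induction with
    | base => intro _ y hy h; rw [one_nsmul] at hy; exact hK1 y hy (h rfl)
    | succ r hr ih =>
      intro hrp y hy _ s
      have h1 := hsub r hr hrp y hy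
      have h2 := ih (by omega) _ h1 (by
        rintro rfl
        rw [← lie_skew y e, lie_neg]
        exact neg_mem (he2 y hy))
      induction s with
      | zero => intro _; exact hnv _ y hy
      | succ s ihs =>
        intro hs
        rw [hcomm]
        exact add_mem (heY _ (ihs (by omega))) (h2 s (by omega))
  refine ⟨Y, ν, v, m, hY, hv, hvY, hm1, by omega, h3, hstr, hm, hm', ?_, he2⟩
  intro a x hx hax s hs
  by_cases ha : a ∈ zmultiples κ
  · obtain ⟨r, hrp, hr⟩ := zmul_nat (k := k) (p := p) (neg_mem ha)
    rw [neg_eq_iff_eq_neg] at hr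
    subst hr
    rcases Nat.eq_zero_or_pos r with h | h
    · subst h
      rw [zero_nsmul, neg_zero, A.zero] at hx
      exact hNv s hs x hx
    · refine hK r h hrp x hx ?_ s hs
      rintro rfl
      rcases hax with h | h
      · rw [one_nsmul] at h; exact absurd rfl h
      · exact h
  · rw [A.off a ha, mem_bot] at hx
    rw [hx, zero_lie]; exact Y.zero_mem
structure Core (W : WD p Sg Vg ev) (n : D → Submodule k S) (κ : D) (e f : S) : Prop where
  κ0 : κ ≠ 0
  he : e ∈ Sg κ
  hf : f ∈ n (-κ)
  hef : ev κ ⁅e, f⁆ ≠ 0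
  p3 : 3 < p
  eig : ∀ h ∈ Sg 0, ⁅h, e⁆ - ev κ h • e ∈ W.J κ
  oth : ∀ a, a ≠ 0 → a ≠ -κ → n a ≤ W.J a
  negN : ∀ y ∈ n (-κ), ⁅e, y⁆ ∈ W.N → y ∈ W.J (-κ)
  neg : ∀ y ∈ n (-κ), ∃ c : k, y - c • f ∈ W.J (-κ)
  ide : ∀ a ∈ zmultiples κ, ∀ x ∈ W.J a, ⁅x, e⁆ ∈ W.J (a + κ)
  L : ∃ (Y : Submodule k V) (ν : D) (v : V) (m : ℕ), W.GSt κ Y ∧ v ∈ Vg ν ∧ 1 ≤ m ∧ m + 2 < p ∧ 2 * ev ν ⁅e, f⁆ = -(m * ev κ ⁅e, f⁆) ∧ v ∉ Y ∧ ((ρ e) ^ m) v ∉ Y ∧ (∀ a ∈ zmultiples κ, ∀ x ∈ W.J a, ∀ s ≤ p - 1, ⁅x, ((ρ e) ^ s) v⁆ ∈ Y)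
theorem core (W : WD p Sg Vg ev) {Γ : AddSubgroup D} {β : D} (hΓ : Γ = zmultiples β) {n : D → Submodule k S} (A : W.Adm Γ n) (M : W.AMax Γ n) {b : D} (hb : b ∈ Γ) (hb0 : b ≠ 0) {x : S} (hx : x ∈ Sg b) (hxJ : x ∉ W.J b) (hA : ¬ W.CaseA) : ∃ κ e f, zmultiples κ = Γ ∧ W.Core n κ e f := by
  obtain ⟨κ, e, f, hκ, hκ0, he, hf, hef, g1, g2⟩ := W.coreb A M hb hb0 hx hxJ
  have hΓ' : Γ = zmultiples κ := by rw [hΓ]; exact (zmul_eq' (k := k) (p := p) (hΓ ▸ hκ) hκ0).symm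
  have hp : p.Prime := Fact.out
  clear hΓ
  subst hΓ'
  obtain ⟨Y, ν, v, m, hY, hv, hvY, hm1, hmp, h2, hstr, hm, hm', hK, he2⟩ :=
    W.core1 hκ0 A he hf hef g1 g2 hA
  have hfS := A.le _ hf
  have hκef : ev κ ⁅e, f⁆ ≠ 0 := fun h => hef (W.mem_N_of_line hκ he hfS h)
  have hVν : Vg ν ≠ ⊥ := fun h => hvY (by
    rw [h, mem_bot] at hv; rw [hv]; exact Y.zero_mem)
  have hKJ : ∀ l, l ≠ 0 → ∀ y ∈ n l, (l ≠ -κ ∨ ⁅e, y⁆ ∈ W.N) → y ∈ W.J l := by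
    intro l hl0 y0 hy0 hc0
    by_contra hJ
    have hlΓ : l ∈ zmultiples κ := by
      by_contra h
      rw [A.off l h, mem_bot] at hy0
      exact hJ (hy0 ▸ Submodule.zero_mem _)
    obtain ⟨y, ⟨hy, hc, hyJ⟩, -, hl2⟩ := (W.JF_adm (zmultiples κ)).lastS
      (fun y => y ∈ n l ∧ (l ≠ -κ ∨ ⁅e, y⁆ ∈ W.N) ∧ y ∉ W.J l)
      (fun h => h.2.2 (Submodule.zero_mem _)) y0 ⟨hy0, hc0, hJ⟩
    have hye : ∀ h ∈ Sg 0, ⁅h, y⁆ - ev l h • y ∈ W.J l := by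
      intro h hh
      by_contra hcon
      refine hl2 h hh l (A.le _ hy) ⟨sub_mem (A.H _ _ _ hh hy) (smul_mem _ _ hy), ?_, hcon⟩
      by_cases hlκ : l = -κ
      · right
        have hey : ⁅e, y⁆ ∈ W.N := by
          rcases hc with h | h
          · exact absurd hlκ h
          · exact h
        rw [lie_sub, lie_smul]
        refine sub_mem ?_ (smul_mem _ _ hey)
        rw [leibniz_lie]
        refine add_mem ?_ (W.HH hh hey.1)
        rw [← lie_skew e h, ← sub_add_cancel ⁅h, e⁆ (ev κ h • e), neg_lie, add_lie, smul_lie]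
        refine neg_mem (add_mem ?_ (smul_mem _ _ hey))
        have := A.br _ _ _ _ (g2 h hh) hy
        rwa [hlκ, add_neg_cancel, A.zero] at this
      · exact Or.inl hlκ
    obtain ⟨t, ht0, htp, ht⟩ := zmul_eq (k := k) (p := p) hlΓ hl0
    have hmt : ¬ p ∣ m * t := by
      rw [hp.dvd_mul]
      rintro (h | h)
      · exact absurd (Nat.le_of_dvd hm1 h) (by omega)
      · exact absurd (Nat.le_of_dvd ht0 h) (by omega)
    have hcast : (((m * t) % p : ℕ) : k) = (m : k) * t := by
      conv_rhs => rw [← Nat.cast_mul, ← Nat.mod_add_div (m * t) p]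
      rw [Nat.cast_add, Nat.cast_mul p, cast_eq_zero k p, zero_mul, add_zero]
    have hsm : m • κ = ((m * t) % p) • l := by
      conv_lhs => rw [ht, ← mul_nsmul']
      conv_lhs => rw [← Nat.mod_add_div (m * t) p]
      rw [add_nsmul, mul_nsmul', p_nsmul (k := k), add_zero]
    have hYl : W.GSt l Y := by
      unfold GSt
      rw [zmul_eq' (k := k) (p := p) hlΓ hl0]
      exact hY
    refine W.S1c hl0 (A.le _ hy) hyJ hye hYl hv hvY
      (by simpa using hstr 0 (Nat.zero_le _)) (by simpa using hK l y hy hc 0 (Nat.zero_le _))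
      (W.pow_mem he hv m) hm (hstr m (by omega)) (hK l y hy hc m (by omega))
      (n := (m * t) % p) ?_ (Nat.mod_lt _ hp.pos) (by rw [hsm]) ?_
    · exact Nat.pos_of_ne_zero fun h => hmt (Nat.dvd_of_mod_eq_zero h)
    · intro g hg
      rw [W.brk hVν he hfS h2 hκef hlΓ (A.le _ hy) hg, hcast]
      conv_lhs => rw [ht]
      rw [map_nsmul, LinearMap.smul_apply, nsmul_eq_mul]
      ring
  have hp3 : 3 < p := by omega
  have hκκ : κ ≠ -κ := by
    intro h
    have h2 : 2 • κ = 0 := by rw [two_nsmul]; nth_rewrite 2 [h]; exact add_neg_cancel κ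
    have := (nsmul_eq_zero_of_char (k := k) (p := p) hκ0).1 h2
    exact absurd (Nat.le_of_dvd (by norm_num) this) (by omega)
  refine ⟨κ, e, f, rfl, hκ0, he, hf, hκef, hp3, fun h hh => hKJ κ hκ0 _ (g2 h hh) (Or.inl hκκ), fun a ha ha' x hx => hKJ a ha x hx (Or.inl ha'), fun y hy h => hKJ (-κ) (neg_ne_zero.2 hκ0) y hy (Or.inr h), ?_, ?_, Y, ν, v, m, hY, hv, hm1, hmp, h2, hvY, hm, ?_⟩
  · intro y hy
    refine ⟨ev κ ⁅e, y⁆ / ev κ ⁅e, f⁆, ?_⟩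
    have hm := sub_mem hy (smul_mem _ (ev κ ⁅e, y⁆ / ev κ ⁅e, f⁆) hf)
    refine hKJ (-κ) (neg_ne_zero.2 hκ0) _ hm (Or.inr ?_)
    refine W.mem_N_of_line hκ he (A.le _ hm) ?_
    rw [lie_sub, lie_smul, map_sub, map_smul, smul_eq_mul, div_mul_cancel₀ _ hκef, sub_self]
  · intro a ha x hx
    by_cases h0 : a + κ = 0
    · rw [h0, J_zero]
      exact W.JN hx (by rwa [← eq_neg_of_add_eq_zero_right h0])
    · have h1 := g1 a h0 x (A.J a ha hx)
      refine hKJ _ h0 _ h1 ?_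
      by_cases h2 : a + κ = -κ
      · right
        have : a = -(2 • κ) := by rw [two_nsmul, neg_add]; exact eq_add_neg_of_add_eq h2
        rw [← lie_skew x e, lie_neg]
        exact neg_mem (he2 x (this ▸ A.J a ha hx))
      · exact Or.inl h2
  · intro a ha x hx s hs
    refine hK a x (A.J a ha hx) ?_ s hs
    by_cases h : a = -κ
    · right
      subst h
      exact W.JN' hx (by rwa [neg_neg])
    · exact Or.inl h
theorem Jideal1 (W : WD p Sg Vg ev) (hA : ¬ W.CaseA) (β : D) {a b : D} (ha : a ∈ zmultiples β) (hb : b ∈ zmultiples β) {x z : S} (hx : x ∈ W.J a) (hz : z ∈ Sg b) : ⁅x, z⁆ ∈ W.J (a + b) := by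
  by_contra hc
  have hab : a + b ≠ 0 := by
    intro h
    apply hc
    rw [h, J_zero]
    exact W.JN hx (by rwa [← eq_neg_of_add_eq_zero_right h])
  set Γ := zmultiples β with hΓ
  let DD : D → Submodule k S := fun j =>
    span k {w | ∃ a ∈ Γ, ∃ x ∈ W.J a, ∃ z ∈ Sg (j - a), w = ⁅x, z⁆}
  have hDS : ∀ j, DD j ≤ Sg j := by
    intro j
    refine span_le.2 ?_
    rintro w ⟨a, ha, x, hx, z, hz, rfl⟩
    have := W.sS.lie (W.J_le _ hx) hz
    rwa [add_sub_cancel] at this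
  have hDH : ∀ j, ∀ h ∈ Sg 0, ∀ w ∈ DD j, ⁅h, w⁆ ∈ DD j := by
    intro j h hh w hw
    refine span_induction ?_ ?_ ?_ ?_ hw
    · rintro w ⟨a, ha, x, hx, z, hz, rfl⟩
      rw [leibniz_lie]
      exact add_mem (subset_span ⟨a, ha, _, W.HJ hh hx, z, hz, rfl⟩)
        (subset_span ⟨a, ha, x, hx, _, W.sS.lie0 hh hz, rfl⟩)
    · rw [lie_zero]; exact zero_mem _
    · intro x y _ _ hx hy; rw [lie_add]; exact add_mem hx hy
    · intro c x _ hx; rw [lie_smul]; exact smul_mem _ _ hx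
  obtain ⟨y, ⟨j, hj, hj0, hy, hyJ⟩, hl1, hl2⟩ := (W.JF_adm Γ).lastS
    (fun w => ∃ j ∈ Γ, j ≠ 0 ∧ w ∈ DD j ∧ w ∉ W.J j)
    (by rintro ⟨j, _, _, _, h⟩; exact h (zero_mem _)) ⁅x, z⁆
    ⟨a + b, Γ.add_mem ha hb, hab, subset_span ⟨a, ha, x, hx, z, by
      rwa [add_sub_cancel_left], rfl⟩, hc⟩
  have hyS := hDS j hy
  have A1 := (W.JF_adm Γ).adjoin hj hj0 hyS (by
    intro a ha x hx
    rw [W.JF_mem (Γ.add_mem ha hj)]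
    have hxJ := hx
    rw [W.JF_mem ha] at hxJ
    by_cases h0 : a + j = 0
    · rw [h0, J_zero]
      exact W.JN hxJ (by rwa [← eq_neg_of_add_eq_zero_right h0])
    · by_contra hcon
      exact hl1 a x hx ⟨a + j, Γ.add_mem ha hj, h0, subset_span ⟨a, ha, x, hxJ, y, by
        rwa [add_sub_cancel_left], rfl⟩, hcon⟩) (by
    intro h hh
    rw [W.JF_mem hj]
    by_contra hcon
    exact hl2 h hh j hyS ⟨j, hj, hj0, sub_mem (hDH j h hh y hy) (smul_mem _ _ hy), hcon⟩)
  obtain ⟨n', A', hle, M⟩ := A1.exists_max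
  obtain ⟨κ, e, f, hκ, C⟩ := W.core rfl A' M hj hj0 hyS hyJ hA
  have hyn : y ∈ n' j := hle j (mem_adj _ _ _)
  have hjκ : j = -κ := by
    by_contra h
    exact hyJ (C.oth j hj0 h hyn)
  subst hjκ
  refine hyJ (C.negN y hyn ?_)
  refine span_induction ?_ ?_ ?_ ?_ hy
  · rintro w ⟨a, ha, x, hx, z, hz, rfl⟩
    rw [leibniz_lie]
    refine add_mem ?_ ?_
    · refine W.JN (a := a + κ) ?_ (by rwa [show -(a + κ) = -κ - a by abel])
      rw [← lie_skew]
      exact neg_mem (C.ide a (by rw [hκ]; exact ha) x hx)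
    · refine W.JN hx ?_
      have := W.sS.lie C.he hz
      rwa [show κ + (-κ - a) = -a by abel] at this
  · rw [lie_zero]; exact zero_mem _
  · intro x y _ _ hx hy; rw [lie_add]; exact add_mem hx hy
  · intro c x _ hx; rw [lie_smul]; exact smul_mem _ _ hx
include k in
theorem ne_neg_self (h3 : 3 < p) {κ : D} (hκ : κ ≠ 0) : κ ≠ -κ := by
  intro h
  have h2 : 2 • κ = 0 := by rw [two_nsmul]; nth_rewrite 2 [h]; exact add_neg_cancel κ
  have := (nsmul_eq_zero_of_char (k := k) (p := p) hκ).1 h2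
  exact absurd (Nat.le_of_dvd (by norm_num) this) (by omega)
theorem h1a (W : WD p Sg Vg ev) (hA : ¬ W.CaseA) {κ : D} {n : D → Submodule k S} (A : W.Adm (zmultiples κ) n) (M : W.AMax (zmultiples κ) n) {e f : S} (C : W.Core n κ e f) {g : S} (hg : g ∈ Sg κ) (hfg : ⁅f, g⁆ ∈ W.N) : g ∈ W.J κ := by
  by_contra hgJ
  have hκΓ := mem_zmultiples κ
  have hN : ∀ x ∈ n (-κ), ∀ g ∈ Sg κ, ⁅f, g⁆ ∈ W.N → ⁅x, g⁆ ∈ W.N := by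
    intro x hx g hg hfg
    obtain ⟨c, hc⟩ := C.neg x hx
    rw [← sub_add_cancel x (c • f), add_lie, smul_lie]
    exact add_mem (W.JN hc (by rwa [neg_neg])) (smul_mem _ _ hfg)
  obtain ⟨y, ⟨hy, hyf, hyJ⟩, -, hl2⟩ := A.lastS (fun w => w ∈ Sg κ ∧ ⁅f, w⁆ ∈ W.N ∧ w ∉ W.J κ)
    (fun h => h.2.2 (zero_mem _)) g ⟨hg, hfg, hgJ⟩
  have hκκ := ne_neg_self (k := k) C.p3 C.κ0
  refine hyJ (C.oth κ C.κ0 hκκ (AMax.ext A M hκΓ C.κ0 hy ?_ ?_))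
  · intro a ha x hx
    by_cases h : a = -κ
    · subst h
      rw [neg_add_cancel, A.zero]
      exact hN x hx y hy hyf
    · refine A.J _ (add_mem ha hκΓ) (W.Jideal1 hA κ ha hκΓ ?_ hy)
      by_cases h0 : a = 0
      · subst h0; rw [A.zero] at hx; rwa [J_zero]
      · exact C.oth a h0 h hx
  · intro h hh
    refine A.J _ hκΓ ?_
    by_contra hcon
    refine hl2 h hh κ hy ⟨sub_mem (W.sS.lie0 hh hy) (smul_mem _ _ hy), ?_, hcon⟩
    rw [lie_sub, lie_smul, leibniz_lie]
    refine sub_mem (add_mem ?_ (W.HH hh hyf.1)) (smul_mem _ _ hyf)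
    refine hN _ ?_ y hy hyf
    rw [← lie_skew]
    exact neg_mem (A.H _ _ _ hh C.hf)
theorem h1b (W : WD p Sg Vg ev) (hA : ¬ W.CaseA) {κ : D} {n : D → Submodule k S} (A : W.Adm (zmultiples κ) n) (M : W.AMax (zmultiples κ) n) {e f : S} (C : W.Core n κ e f) {g : S} (hg : g ∈ Sg κ) : ∃ c : k, g - c • e ∈ W.J κ := by
  have hef : ev κ ⁅f, e⁆ ≠ 0 := by rw [← lie_skew, map_neg, neg_ne_zero]; exact C.hef
  have hm := sub_mem hg (smul_mem _ (ev κ ⁅f, g⁆ / ev κ ⁅f, e⁆) C.he)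
  refine ⟨_, W.h1a hA A M C hm ?_⟩
  refine W.mem_N_of_line (a := -κ) (β := κ) (neg_mem (mem_zmultiples κ))
    (A.le _ C.hf) (by rwa [neg_neg]) ?_
  rw [lie_sub, lie_smul, map_sub, map_smul, smul_eq_mul, div_mul_cancel₀ _ hef, sub_self]
theorem h2a (W : WD p Sg Vg ev) (hA : ¬ W.CaseA) {κ : D} {n : D → Submodule k S} (A : W.Adm (zmultiples κ) n) (M : W.AMax (zmultiples κ) n) {e f : S} (C : W.Core n κ e f) {l : D} (hl : l ∈ zmultiples κ) (hl0 : l ≠ 0) (hl1 : l ≠ κ) (hl2 : l ≠ -κ) {x : S} (hx : x ∈ Sg l) (hxJ : x ∉ W.J l) :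
    ∃ g ∈ Sg (2 • κ), ev κ ⁅f, ⁅f, g⁆⁆ ≠ 0 := by
  have hκΓ := mem_zmultiples κ
  have hfS := A.le _ C.hf
  obtain ⟨g, ⟨l, hl, hl0, hl1, hl2, hg, hgJ⟩, hL1, hL2⟩ := A.lastS
    (fun w => ∃ l ∈ zmultiples κ, l ≠ 0 ∧ l ≠ κ ∧ l ≠ -κ ∧ w ∈ Sg l ∧ w ∉ W.J l)
    (by rintro ⟨_, _, _, _, _, _, h⟩; exact h (zero_mem _)) x ⟨l, hl, hl0, hl1, hl2, hx, hxJ⟩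
  by_cases hfg : ⁅f, g⁆ ∈ W.J (-κ + l)
  · exfalso
    refine hgJ (C.oth l hl0 hl2 (AMax.ext A M hl hl0 hg ?_ ?_))
    · intro a ha x hx
      refine A.J _ (add_mem ha hl) ?_
      by_cases h : a = -κ
      · subst h
        obtain ⟨c, hc⟩ := C.neg x hx
        rw [← sub_add_cancel x (c • f), add_lie, smul_lie]
        exact add_mem (W.Jideal1 hA κ ha hl hc hg) (smul_mem _ _ hfg)
      · refine W.Jideal1 hA κ ha hl ?_ hg
        by_cases h0 : a = 0
        · subst h0; rw [A.zero] at hx; rwa [J_zero]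
        · exact C.oth a h0 h hx
    · intro h hh
      refine A.J _ hl ?_
      by_contra hcon
      exact hL2 h hh l hg ⟨l, hl, hl0, hl1, hl2, sub_mem (W.sS.lie0 hh hg)
        (smul_mem _ _ hg), hcon⟩
  · have h1 : -κ + l = κ := by
      by_contra h
      refine hL1 _ f C.hf ⟨-κ + l, add_mem (neg_mem hκΓ) hl, ?_, h, ?_, W.sS.lie hfS hg, hfg⟩
      · intro h0; exact hl1 (neg_add_eq_zero.1 h0).symm
      · intro h0; exact hl0 (by simpa using h0)
    have h2 : l = 2 • κ := by rw [two_nsmul]; exact (neg_add_eq_iff_eq_add.1 h1)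
    have h3 := W.sS.lie hfS hg
    rw [h1] at h3 hfg
    subst h2
    refine ⟨g, hg, fun h0 => hfg (W.h1a hA A M C h3 ?_)⟩
    exact W.mem_N_of_line (a := -κ) (neg_mem hκΓ) hfS (by rwa [neg_neg]) h0
def QQ (W : WD p Sg Vg ev) (κ : D) (Y : Submodule k V) (χ : D) : Prop :=
  ∃ w ∈ Vg χ, w ∉ Y ∧ ∀ a ∈ zmultiples κ, ∀ x ∈ W.J a, ⁅x, w⁆ ∈ Y
theorem h3a (W : WD p Sg Vg ev) (hA : ¬ W.CaseA) (hp3 : 3 < p) {κ : D} (hκ0 : κ ≠ 0) {e f : S} (he : e ∈ Sg κ) (hf : f ∈ Sg (-κ)) (hef : ev κ ⁅e, f⁆ ≠ 0) (heig : ∀ h ∈ Sg 0, ⁅h, f⁆ - ev (-κ) h • f ∈ W.J (-κ)) {Y : Submodule k V} (hY : W.GSt κ Y) {χ : D} (hQ : W.QQ κ Y χ) (hQ' : ¬ W.QQ κ Y (χ + κ)) (hχ : ev χ ⁅e, f⁆ ≠ 0) {g : S} (hg : g ∈ Sg (2 • κ)) (hgf : ev κ ⁅f, ⁅f, g⁆⁆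 ≠ 0) : False := by
  have hκΓ := mem_zmultiples κ
  obtain ⟨w0, hw0, hw0Y, hw0J⟩ := hQ
  obtain ⟨w, ⟨hw, hwY, hwJ⟩, -, hl2⟩ := (W.JF_adm (zmultiples κ)).lastV
    (fun w => w ∈ Vg χ ∧ w ∉ Y ∧ ∀ a ∈ zmultiples κ, ∀ x ∈ W.J a, ⁅x, w⁆ ∈ Y)
    (fun h => h.2.1 (zero_mem _)) w0 ⟨hw0, hw0Y, hw0J⟩
  have hst : ∀ b ∈ zmultiples κ, ∀ z ∈ Sg b, ∀ u : V, (∀ a ∈ zmultiples κ, ∀ x ∈ W.J a, ⁅x, u⁆ ∈ Y) → (∀ a ∈ zmultiples κ, ∀ x ∈ W.J a, ⁅x, ⁅z, u⁆⁆ ∈ Y) := by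
    intro b hb z hz u hu a ha x hx
    rw [leibniz_lie]
    exact add_mem (hu _ (add_mem ha hb) _ (W.Jideal1 hA κ ha hb hx hz)) (hY b hb z hz _ (hu a ha x hx))
  have hve : ∀ h ∈ Sg 0, ⁅h, w⁆ - ev χ h • w ∈ Y := by
    intro h hh
    by_contra hcon
    refine hl2 h hh χ hw ⟨sub_mem (W.sV.lie0 hh hw) (smul_mem _ _ hw), hcon, ?_⟩
    intro a ha x hx
    rw [lie_sub, lie_smul]
    exact sub_mem (hst 0 (zero_mem _) h hh w hwJ a ha x hx) (smul_mem _ _ (hwJ a ha x hx))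
  have htop : ∀ u ∈ Vg (χ + κ), (∀ a ∈ zmultiples κ, ∀ x ∈ W.J a, ⁅x, u⁆ ∈ Y) → u ∈ Y := by
    intro u hu hu'
    by_contra hcon
    exact hQ' ⟨u, hu, hcon, hu'⟩
  have hpow : ∀ s, (∀ a ∈ zmultiples κ, ∀ x ∈ W.J a, ⁅x, ((ρ f) ^ s) w⁆ ∈ Y) := by
    intro s
    induction s with
    | zero => simpa using hwJ
    | succ s ih =>
      rw [pow_succ', Module.End.mul_apply, toEnd_apply_apply]
      exact hst _ (neg_mem hκΓ) f hf _ ih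
  have hY' : W.GSt (-κ) Y := by unfold GSt; rw [zmultiples_neg]; exact hY
  have hk : ∀ s < p, ∀ h ∈ Sg 0, ⁅⁅h, f⁆ - ev (-κ) h • f, ((ρ f) ^ s) w⁆ ∈ Y :=
    fun s _ h hh => hpow s _ (neg_mem hκΓ) _ (heig h hh)
  have he' : e ∈ Sg (- -κ) := by rwa [neg_neg]
  have hew : ⁅e, w⁆ ∈ Y := by
    refine htop _ ?_ (hst κ hκΓ e he w hwJ)
    rw [add_comm]; exact W.sV.lie he hw
  have hκn := neg_ne_zero.2 hκ0
  obtain ⟨m, hmp, hm, hm'⟩ := W.exm hκn hf hw hwY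
  have h3 := W.str3 hY' hf hve hk he' hew (by omega) (by omega) hm hm'
  have hfe : ⁅f, e⁆ = -⁅e, f⁆ := (lie_skew _ _).symm
  have h2k : (2 : k) ≠ 0 := by
    have := natne (k := k) (p := p) (n := 2) (by norm_num) (by omega)
    exact_mod_cast this
  have hm0 : 0 < m := by
    rcases Nat.eq_zero_or_pos m with h | h
    · subst h
      rw [hfe, Nat.cast_zero, zero_mul, neg_zero, map_neg, mul_neg, neg_eq_zero, mul_eq_zero] at h3
      rcases h3 with h | h
      · exact absurd h h2k
      · exact absurd h hχ
    · exact h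
  have hfe0 : ev (-κ) ⁅f, e⁆ ≠ 0 := by rw [hfe, map_neg, map_neg, LinearMap.neg_apply, neg_neg]; exact hef
  have hmA : m ≠ p - 2 := by
    rintro rfl
    exact hA ⟨-κ, f, e, χ, w, hκn, hf, he', hfe0, hw, fun h => hm (by rw [h]; exact Y.zero_mem)⟩
  have hVχ : Vg χ ≠ ⊥ := fun h => hwY (by
    rw [h, mem_bot] at hw; rw [hw]; exact Y.zero_mem)
  have h2Γ : 2 • κ ∈ zmultiples κ := nsmul_mem hκΓ 2
  have hfg : ⁅f, g⁆ ∈ Sg κ := by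
    have := W.sS.lie hf hg
    rwa [show -κ + 2 • κ = κ by rw [two_nsmul]; abel] at this
  have h5 := W.str5 hY' hf hve hk (y := g) (by rwa [smul_neg, neg_neg]) (by
      refine htop _ ?_ (hst κ hκΓ _ hfg w hwJ)
      rw [add_comm]; exact W.sV.lie hfg hw) (by
      refine htop _ ?_ (hst _ h2Γ _ hg _ (hst _ (neg_mem hκΓ) f hf w hwJ))
      have := W.sV.lie hg (W.sV.lie hf hw)
      rwa [show 2 • κ + (-κ + χ) = χ + κ by rw [two_nsmul]; abel] at this) hm0 (by omega) (by omega)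
      hm hm' (W.brk hVχ hf he' h3 hfe0 (mem_zmultiples _) hf (by rwa [neg_neg]))
  rw [map_neg, LinearMap.neg_apply, neg_eq_zero] at h5
  exact hgf h5
structure BB (W : WD p Sg Vg ev) (β : D) (e f : S) : Prop where
  β0 : β ≠ 0
  he : e ∈ Sg β
  hf : f ∈ Sg (-β)
  hef : ev β ⁅e, f⁆ ≠ 0
  p3 : 3 < p
  pos : ∀ g ∈ Sg β, ∃ c : k, g - c • e ∈ W.J β
  neg : ∀ g ∈ Sg (-β), ∃ c : k, g - c • f ∈ W.J (-β)
  oth : ∀ l ∈ zmultiples β, l ≠ 0 → l ≠ β → l ≠ -β → Sg l ≤ W.J l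
theorem BB.swap {W : WD p Sg Vg ev} {β : D} {e f : S} (B : W.BB β e f) : W.BB (-β) f e where
  β0 := neg_ne_zero.2 B.β0
  he := B.hf
  hf := by rw [neg_neg]; exact B.he
  hef := by rw [← lie_skew, map_neg, map_neg, LinearMap.neg_apply, neg_neg]; exact B.hef
  p3 := B.p3
  pos := B.neg
  neg := by rw [neg_neg]; exact B.pos
  oth := fun l hl h0 h1 h2 => B.oth l (by rwa [zmultiples_neg] at hl) h0
    (by rwa [neg_neg] at h2) h1
theorem good (W : WD p Sg Vg ev) (hA : ¬ W.CaseA) {β : D} (hβ : β ≠ 0) {x : S} (hx : x ∈ Sg β) (hxJ : x ∉ W.J β) : ∃ e f, W.BB β e f := by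
  obtain ⟨n, A, -, M⟩ := (W.JF_adm (zmultiples β)).exists_max
  obtain ⟨κ, e, f, hκ, C⟩ := W.core rfl A M (mem_zmultiples β) hβ hx hxJ hA
  rw [← hκ] at A M
  have hβκ : β ∈ zmultiples κ := by rw [hκ]; exact mem_zmultiples β
  clear hκ
  have hκΓ := mem_zmultiples κ
  have hfS := A.le _ C.hf
  have hκn := neg_ne_zero.2 C.κ0
  have hSκ : Sg κ ≠ ⊥ := fun h => C.hef (by
    have := C.he; rw [h, mem_bot] at this; rw [this, zero_lie, map_zero])
  have hefN : ⁅e, f⁆ ∉ W.N := fun h => C.hef (W.root_N hSκ h)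
  have heJ : e ∉ W.J κ := fun h => hefN (W.JN h hfS)
  have hfJ : f ∉ W.J (-κ) := fun h => hefN (W.JN' h (by rw [neg_neg]; exact C.he))
  have A1 := (W.JF_adm (zmultiples κ)).adjoin hκΓ C.κ0 C.he (by
    intro a ha x hx
    rw [W.JF_mem ha] at hx
    rw [W.JF_mem (add_mem ha hκΓ)]
    exact C.ide a ha x hx) (by rw [W.JF_mem hκΓ]; exact C.eig)
  obtain ⟨n', A', hle, M'⟩ := A1.exists_max
  obtain ⟨κ', e', f', hκ', C'⟩ := W.core rfl A' M' hκΓ C.κ0 C.he heJ hA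
  have hen : e ∈ n' κ := hle κ (mem_adj _ _ _)
  have hκκ : κ' = -κ := by
    by_contra h
    exact heJ (C'.oth κ C.κ0 (fun h' => h (by rw [h', neg_neg])) hen)
  subst hκκ
  rw [← hκ'] at A' M'
  have hpos := fun g (hg : g ∈ Sg κ) => W.h1b hA A M C hg
  have hneg' := fun g (hg : g ∈ Sg (-κ)) => W.h1b hA A' M' C' hg
  obtain ⟨c, hc⟩ := hneg' f hfS
  have hc0 : c ≠ 0 := by
    rintro rfl
    rw [zero_smul, sub_zero] at hc
    exact hfJ hc
  have hneg : ∀ g ∈ Sg (-κ), ∃ c : k, g - c • f ∈ W.J (-κ) := by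
    intro g hg
    obtain ⟨d, hd⟩ := hneg' g hg
    refine ⟨d / c, ?_⟩
    have := sub_mem hd (smul_mem _ (d / c) hc)
    rwa [smul_sub, smul_smul, div_mul_cancel₀ _ hc0, sub_sub_sub_cancel_right] at this
  have hfe : ∀ h ∈ Sg 0, ⁅h, f⁆ - ev (-κ) h • f ∈ W.J (-κ) := by
    intro h hh
    have h1 := add_mem (smul_mem _ c (C'.eig h hh))
      (sub_mem (W.HJ hh hc) (smul_mem _ (ev (-κ) h) hc))
    rw [lie_sub, lie_smul] at h1
    convert h1 using 1
    module
  have hef' : ∀ h ∈ Sg 0, ⁅h, e⁆ - ev (- -κ) h • e ∈ W.J (- -κ) := by rw [neg_neg]; exact C.eig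
  have hf'n := C'.hf
  rw [neg_neg] at hf'n
  have hf'S := A'.le _ hf'n
  obtain ⟨c', hc'⟩ := hpos f' hf'S
  have hoth : ∀ l ∈ zmultiples κ, l ≠ 0 → l ≠ κ → l ≠ -κ → Sg l ≤ W.J l := by
    intro l hl hl0 hl1 hl2 x hx
    by_contra hxJ
    obtain ⟨g, hg, hgf⟩ := W.h2a hA A M C hl hl0 hl1 hl2 hx hxJ
    obtain ⟨g', hg', hgf'⟩ := W.h2a hA A' M' C' (by rwa [zmultiples_neg]) hl0
      hl2 (by rwa [neg_neg]) hx hxJ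
    have hgf2 : ev (-κ) ⁅e, ⁅e, g'⁆⁆ ≠ 0 := by
      intro h0
      apply hgf'
      have h2Γ : (2 : ℕ) • -κ ∈ zmultiples κ := nsmul_mem (neg_mem hκΓ) 2
      have hr : ∀ z ∈ W.N, ev (-κ) z = 0 := by intro z hz; rw [map_neg, LinearMap.neg_apply, W.root_N hSκ hz, neg_zero]
      have e1 : f' = (f' - c' • e) + c' • e := by abel
      have k1 := W.Jideal1 hA κ hκΓ h2Γ hc' hg'
      rw [show κ + 2 • -κ = -κ by rw [two_nsmul]; abel] at k1
      have e2 : ⁅f', g'⁆ ∈ Sg (-κ) := by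
        have := W.sS.lie hf'S hg'
        rwa [show κ + 2 • -κ = -κ by rw [two_nsmul]; abel] at this
      have e3 : ⁅e, g'⁆ ∈ Sg (-κ) := by
        have := W.sS.lie C.he hg'
        rwa [show κ + 2 • -κ = -κ by rw [two_nsmul]; abel] at this
      have k2 := W.JN hc' e2
      have k3 := W.JN' k1 (by rw [neg_neg]; exact C.he)
      have : ⁅f', ⁅f', g'⁆⁆ = ⁅f' - c' • e, ⁅f', g'⁆⁆ + c' • (⁅e, ⁅f' - c' • e, g'⁆⁆ + c' • ⁅e, ⁅e, g'⁆⁆) := by simp only [sub_lie, smul_lie, lie_sub, lie_smul]; module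
      rw [this, map_add, map_smul, map_add, map_smul, hr _ k2, hr _ k3, h0]
      simp
    obtain ⟨Y, ν, v, m, hY, hv, hm1, hmp, h2, hvY, hm, hJ⟩ := C.L
    have hp2 : (2 : k) ≠ 0 := by
      have := natne (k := k) (p := p) (n := 2) (by norm_num) (by omega)
      exact_mod_cast this
    have hQs : ∀ s ≤ m, W.QQ κ Y (ν + s • κ) := by
      intro s hs
      refine ⟨((ρ e) ^ s) v, W.pow_mem C.he hv s, fun hin => hm ?_, fun a ha x hx => hJ a ha x hx s (by omega)⟩
      obtain ⟨t, rfl⟩ := Nat.exists_eq_add_of_le' hs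
      rw [pow_add, Module.End.mul_apply]
      clear hs hm hmp hm1 h2
      induction t with
      | zero => simpa using hin
      | succ t ih =>
        rw [pow_succ', Module.End.mul_apply, toEnd_apply_apply]
        exact hY κ hκΓ e C.he _ ih
    have hVQ : ∀ χ, W.QQ κ Y χ → Vg χ ≠ ⊥ := by
      rintro χ ⟨w, hw, hwY, -⟩ h
      rw [h, mem_bot] at hw
      exact hwY (hw ▸ Y.zero_mem)
    have hex1 : ∃ j : ℕ, ¬ W.QQ κ Y (ν + j • κ) := by
      obtain ⟨j, _, hj⟩ := W.nop C.κ0 ν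
      exact ⟨j, fun h => hVQ _ h hj⟩
    have hex2 : ∃ j : ℕ, ¬ W.QQ κ Y (ν + j • -κ) := by
      obtain ⟨j, _, hj⟩ := W.nop hκn ν
      exact ⟨j, fun h => hVQ _ h hj⟩
    classical
    have hj1 := Nat.find_spec hex1
    have hj1' := fun i => Nat.find_min hex1 (m := i)
    have hj2 := Nat.find_spec hex2
    have hj2' := fun i => Nat.find_min hex2 (m := i)
    set j1 := Nat.find hex1
    set j2 := Nat.find hex2
    have hj1m : m < j1 := by
      by_contra h
      exact hj1 (hQs j1 (by omega))
    have hj20 : 0 < j2 := by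
      rcases Nat.eq_zero_or_pos j2 with h | h
      · rw [h] at hj2; exact absurd (by simpa using hQs 0 (by omega)) hj2
      · exact h
    obtain ⟨m1, hm1e⟩ : ∃ m1, j1 = m1 + 1 := ⟨j1 - 1, by omega⟩
    obtain ⟨m2, hm2e⟩ : ∃ m2, j2 = m2 + 1 := ⟨j2 - 1, by omega⟩
    have hlen : m1 + m2 + 1 < p := by
      obtain ⟨j, hjp, hj⟩ := W.nop C.κ0 (ν + m2 • -κ)
      by_contra hcon
      by_cases hjm : j ≤ m2
      · refine hVQ _ (not_not.1 (hj2' (m2 - j) (by omega))) ?_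
        rw [← hj]; congr 1
        obtain ⟨i, rfl⟩ := Nat.exists_eq_add_of_le hjm
        rw [Nat.add_sub_cancel_left, add_nsmul, smul_neg, smul_neg]; abel
      · refine hVQ _ (not_not.1 (hj1' (j - m2) (by omega))) ?_
        rw [← hj]; congr 1
        obtain ⟨i, rfl⟩ := Nat.exists_eq_add_of_le (Nat.le_of_not_le hjm)
        rw [Nat.add_sub_cancel_left, add_nsmul, smul_neg]; abel
    have ht1 := not_not.1 (hj1' m1 (by omega))
    have ht2 := not_not.1 (hj2' m2 (by omega))
    have hefe : ∀ i j : ℤ, ev (i • ν + j • κ) ⁅e, f⁆ = i * ev ν ⁅e, f⁆ + j * ev κ ⁅e, f⁆ := by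
      intro i j; rw [map_add, LinearMap.add_apply, map_zsmul, map_zsmul, LinearMap.smul_apply, LinearMap.smul_apply, zsmul_eq_mul, zsmul_eq_mul]
    by_cases hc1 : ev (ν + m1 • κ) ⁅e, f⁆ = 0
    · by_cases hc2 : ev (ν + m2 • -κ) ⁅e, f⁆ = 0
      · rw [map_add, LinearMap.add_apply, map_nsmul, LinearMap.smul_apply, nsmul_eq_mul] at hc1 hc2
        rw [map_neg, LinearMap.neg_apply] at hc2
        have h0 : ((m1 + m2 : ℕ) : k) * ev κ ⁅e, f⁆ = 0 := by push_cast; linear_combination hc1 - hc2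
        rcases mul_eq_zero.1 h0 with h | h
        · exact natne (k := k) (p := p) (by omega) (by omega) h
        · exact C.hef h
      · have hY' : W.GSt (-κ) Y := by
          unfold GSt; rw [zmultiples_neg]; exact hY
        have hQn : ∀ χ, W.QQ (-κ) Y χ ↔ W.QQ κ Y χ := by intro χ; unfold QQ; rw [zmultiples_neg]
        refine W.h3a hA C.p3 hκn hfS (f := e) (by rw [neg_neg]; exact C.he) ?_ hef' hY'
          ((hQn _).2 ht2) (fun h => hj2 ?_) ?_ hg' hgf2
        · rw [← lie_skew, map_neg, map_neg, LinearMap.neg_apply, neg_neg]; exact C.hef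
        · rw [hm2e, succ_nsmul, ← add_assoc]; exact (hQn _).1 h
        · rw [← lie_skew, map_neg, neg_ne_zero]; exact hc2
    · refine W.h3a hA C.p3 C.κ0 C.he hfS C.hef hfe hY ht1 (fun h => hj1 ?_) hc1 hg hgf
      rw [hm1e, succ_nsmul, ← add_assoc]; exact h
  have B : W.BB κ e f := ⟨C.κ0, C.he, hfS, C.hef, C.p3, hpos, hneg, hoth⟩
  by_cases h1 : β = κ
  · subst h1; exact ⟨e, f, B⟩
  by_cases h2 : β = -κ
  · subst h2; exact ⟨f, e, B.swap⟩
  exact absurd (hoth β hβκ hβ h1 h2 hx) hxJ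
omit [Fact p.Prime] [CharP k p] [FiniteDimensional k S] [FiniteDimensional k V] in
theorem sc_lie (W : WD p Sg Vg ev) {a : D} {x : S} (hx : x ∈ Sg a) (c : D → k) (v : V) :
    ⁅x, W.sV.sc c v⁆ = W.sV.sc (fun b => c (b - a)) ⁅x, v⁆ := by
  have : (ρ x) ∘ₗ W.sV.sc c = W.sV.sc (fun b => c (b - a)) ∘ₗ (ρ x) := by
    refine W.sV.ext fun b m hm => ?_
    simp only [LinearMap.comp_apply, toEnd_apply_apply]
    rw [W.sV.sc_apply _ hm, W.sV.sc_apply _ (W.sV.lie hx hm), lie_smul]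
    simp
  exact congrArg (fun T => T v) this
theorem refl (W : WD p Sg Vg ev) (hA : ¬ W.CaseA) {β : D} {e f : S} (B : W.BB β e f) {μ : D} (hμ : Vg μ ≠ ⊥) {r : k} (hr : ev μ ⁅e, f⁆ = r * ev β ⁅e, f⁆) : Vg (μ - (2 * r) • β) ≠ ⊥ := by
  classical
  have hβΓ := mem_zmultiples β
  let Q : Set (Submodule k V) := {Y | W.GSt β Y ∧ (∀ c, ∀ v ∈ Y, W.sV.sc c v ∈ Y) ∧ Y ⊓ Vg μ = ⊥}
  obtain ⟨Y, ⟨hY, hYc, hYμ⟩, hmax⟩ := (wellFounded_gt (α := Submodule k V)).has_min Q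
    ⟨⊥, fun a _ x _ v hv => by rw [mem_bot] at hv ⊢; rw [hv, lie_zero], fun c v hv => by rw [mem_bot] at hv ⊢; rw [hv, map_zero], by simp⟩
  have hmax' : ∀ Z : Submodule k V, Y ≤ Z → W.GSt β Z → (∀ c, ∀ v ∈ Z, W.sV.sc c v ∈ Z) → (∃ v ∈ Z, v ∉ Y) → Z ⊓ Vg μ ≠ ⊥ := by
    intro Z h1 h2 h3 ⟨v, h4, h5⟩ h6
    exact hmax Z ⟨h2, h3, h6⟩ (lt_of_le_not_ge h1 fun h => h5 (h h4))
  have hYz : ∀ v ∈ Y, v ∈ Vg μ → v = 0 := by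
    intro v h1 h2
    have : v ∈ Y ⊓ Vg μ := ⟨h1, h2⟩
    rwa [hYμ, mem_bot] at this
  let W1 : Submodule k V :=
    { carrier := {v | ∀ a ∈ zmultiples β, ∀ x ∈ W.J a, ⁅x, v⁆ ∈ Y}
      add_mem' := fun h1 h2 a ha x hx => by rw [lie_add]; exact add_mem (h1 a ha x hx) (h2 a ha x hx)
      zero_mem' := fun a ha x hx => by rw [lie_zero]; exact Y.zero_mem
      smul_mem' := fun c v h1 a ha x hx => by rw [lie_smul]; exact Y.smul_mem c (h1 a ha x hx) }
  have hW1 : ∀ v, v ∈ W1 ↔ ∀ a ∈ zmultiples β, ∀ x ∈ W.J a, ⁅x, v⁆ ∈ Y := fun v => Iff.rfl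
  have hW1G : W.GSt β W1 := by
    intro b hb y hy v hv
    rw [hW1] at hv ⊢
    intro a ha x hx
    rw [leibniz_lie]
    exact add_mem (hv _ (add_mem ha hb) _ (W.Jideal1 hA β ha hb hx hy)) (hY b hb y hy _ (hv a ha x hx))
  have hW1c : ∀ c, ∀ v ∈ W1, W.sV.sc c v ∈ W1 := by
    intro c v hv
    rw [hW1] at hv ⊢
    intro a ha x hx
    rw [W.sc_lie (W.J_le _ hx)]
    exact hYc _ _ (hv a ha x hx)
  have hYW : Y ≤ W1 := fun v hv a ha x hx => hY a ha x (W.J_le _ hx) v hv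
  obtain ⟨v1, hv1, hv1'⟩ := exists_mem_ne_zero_of_ne_bot hμ
  have AJ := W.JF_adm (zmultiples β)
  obtain ⟨w, hw, hwJ, -⟩ := AJ.lastV (fun v => v ∉ Y) (by simp) v1 (fun h => hv1' (hYz _ h hv1))
  have hwW : w ∈ W1 := by
    intro a ha x hx
    have := hwJ a x (by rw [W.JF_mem ha]; exact hx)
    simpa using this
  obtain ⟨v2, ⟨hv2, hv2μ⟩, hv20⟩ := exists_mem_ne_zero_of_ne_bot
    (hmax' W1 hYW hW1G hW1c ⟨w, hwW, hw⟩)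
  obtain ⟨v, ⟨hvW, hvμ, hvY⟩, -, hve⟩ := AJ.lastV (fun v => v ∈ W1 ∧ v ∈ Vg μ ∧ v ∉ Y)
    (by simp) v2 ⟨hv2, hv2μ, fun h => hv20 (hYz _ h hv2μ)⟩
  have hve' : ∀ h ∈ Sg 0, ⁅h, v⁆ - ev μ h • v ∈ Y := by
    intro h hh
    have := hve h hh μ hvμ
    by_contra hc
    exact this ⟨sub_mem (hW1G 0 (zero_mem _) h hh v hvW) (W1.smul_mem _ hvW), sub_mem (W.sV.lie0 hh hvμ) ((Vg μ).smul_mem _ hvμ), hc⟩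
  have hpow : ∀ a ∈ zmultiples β, ∀ x ∈ Sg a, ∀ Z : Submodule k V, W.GSt β Z → ∀ v ∈ Z, ∀ s : ℕ, ((ρ x) ^ s) v ∈ Z := by
    intro a ha x hx Z hZ v hv s
    induction s with
    | zero => simpa using hv
    | succ s ih =>
      rw [pow_succ', Module.End.mul_apply, toEnd_apply_apply]
      exact hZ a ha x hx _ ih
  have hHJ : ∀ {b : D} {g g' : S}, b ∈ zmultiples β → b ≠ 0 → g ∈ Sg b → g' ∈ Sg (-b) → ev b ⁅g, g'⁆ ≠ 0 → (∀ g1 ∈ Sg b, ∃ c : k, g1 - c • g ∈ W.J b) → ∀ h ∈ Sg 0, ⁅h, g⁆ - ev b h • g ∈ W.J b := by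
    intro b g g' hbΓ hb hg hg' hgg hpos h hh
    by_contra hc
    have hgJ : g ∉ W.J b := by
      intro hh
      have h1 := W.JN hh hg'
      exact hgg (W.root_N (fun hb' => by rw [hb', mem_bot] at hg; rw [hg, zero_lie, map_zero] at hgg; exact hgg rfl) h1)
    obtain ⟨z, ⟨hz, hzJ⟩, -, hzh⟩ := AJ.lastS (fun v => v ∈ Sg b ∧ v ∉ W.J b) (by simp) g ⟨hg, hgJ⟩
    obtain ⟨c, hcz⟩ := hpos z hz
    have hc0 : c ≠ 0 := by intro h0; rw [h0, zero_smul, sub_zero] at hcz; exact hzJ hcz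
    have h2 : ⁅h, z⁆ - ev b h • z ∈ W.J b := by
      by_contra h3
      exact hzh h hh b hz ⟨sub_mem (W.sS.lie0 hh hz) ((Sg b).smul_mem _ hz), h3⟩
    have h3 := W.HJ hh hcz
    apply hc
    have h4 : c • (⁅h, g⁆ - ev b h • g) ∈ W.J b := by
      have := add_mem (sub_mem h2 h3) ((W.J b).smul_mem (ev b h) hcz)
      convert this using 1
      rw [lie_sub, lie_smul]
      module
    exact (smul_mem_iff _ hc0).1 h4
  have heJ := hHJ hβΓ B.β0 B.he B.hf B.hef B.pos
  have hfJ := hHJ (neg_mem hβΓ) B.swap.β0 B.hf B.swap.hf B.swap.hef B.neg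
  have hnegY : W.GSt (-β) Y := by intro a ha; rw [zmultiples_neg] at ha; exact hY a ha
  have hn0 : -β ≠ 0 := neg_ne_zero.2 B.β0
  obtain ⟨b, hbp, hb1, hb2⟩ := W.exm hn0 B.hf hvμ hvY
  set u := ((ρ f) ^ b) v with hu
  have huW : u ∈ W1 := hpow _ (neg_mem hβΓ) f B.hf W1 hW1G v hvW b
  have huw : u ∈ Vg (μ + b • (-β)) := W.pow_mem B.hf hvμ b
  have hue : ∀ h ∈ Sg 0, ⁅h, u⁆ - ev (μ + b • (-β)) h • u ∈ Y :=
    W.str hnegY B.hf hve' (t := b) (fun s _ h hh => (hpow _ (neg_mem hβΓ) f B.hf W1 hW1G v hvW s)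
      _ (neg_mem hβΓ) _ (hfJ h hh)) b le_rfl
  have hfu : ⁅f, u⁆ ∈ Y := by
    rw [pow_succ', Module.End.mul_apply, toEnd_apply_apply] at hb2
    exact hb2
  obtain ⟨m, hmp, hm1, hm2⟩ := W.exm B.β0 B.he huw hb1
  have hus : ∀ s, ((ρ e) ^ s) u ∈ W1 := hpow _ hβΓ e B.he W1 hW1G u huW
  have huk : ∀ t : ℕ, ∀ s < t, ∀ h ∈ Sg 0, ⁅⁅h, e⁆ - ev β h • e, ((ρ e) ^ s) u⁆ ∈ Y :=
    fun t s _ h hh => hus s _ hβΓ _ (heJ h hh)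
  have h3 := W.str3 hY B.he hue (huk m) B.hf hfu le_rfl (by omega) hm1 hm2
  let L : Submodule k V := Y ⊔ span k (Set.range fun s : ℕ => ((ρ e) ^ s) u)
  have huL : ∀ s, ((ρ e) ^ s) u ∈ L := fun s => mem_sup_right (subset_span ⟨s, rfl⟩)
  have hYL : Y ≤ L := le_sup_left
  have hLle : ∀ (Z : Submodule k V) (T : Module.End k V), (∀ y ∈ Y, T y ∈ Z) → (∀ s, T (((ρ e) ^ s) u) ∈ Z) → ∀ v ∈ L, T v ∈ Z := by
    intro Z T h1 h2
    have : L ≤ Z.comap T := by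
      refine sup_le h1 (span_le.2 ?_)
      rintro _ ⟨s, rfl⟩
      exact h2 s
    exact this
  have hue' : ∀ s : ℕ, ((ρ e) ^ s) u ∈ Vg (μ + b • (-β) + s • β) := W.pow_mem B.he huw
  have hLc : ∀ c, ∀ v ∈ L, W.sV.sc c v ∈ L := by
    intro c
    refine hLle L _ (fun y hy => hYL (hYc c y hy)) fun s => ?_
    rw [W.sV.sc_apply c (hue' s)]
    exact L.smul_mem _ (huL s)
  have hLe : ∀ s, ⁅e, ((ρ e) ^ s) u⁆ ∈ L := by
    intro s
    have := huL (s + 1)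
    rwa [pow_succ', Module.End.mul_apply, toEnd_apply_apply] at this
  have hLf : ∀ s, ⁅f, ((ρ e) ^ s) u⁆ ∈ L := by
    intro s
    cases s with
    | zero => exact hYL (by simpa using hfu)
    | succ s =>
      have := W.str2 hY B.he hue (huk s) B.hf hfu s le_rfl
      exact (Submodule.add_mem_iff_left _ (L.smul_mem _ (huL s))).1 (hYL this)
  have hLG : W.GSt β L := by
    intro a ha x hx
    refine hLle L (ρ x) (fun y hy => hYL (hY a ha x hx y hy)) fun s => ?_
    rw [toEnd_apply_apply]
    by_cases h0 : a = 0
    · subst h0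
      have := W.str hY B.he hue (huk s) s le_rfl x hx
      have h5 := add_mem (hYL this) (L.smul_mem (ev (μ + b • (-β) + s • β) x) (huL s))
      rwa [sub_add_cancel] at h5
    by_cases h1 : a = β
    · subst h1
      obtain ⟨c, hc⟩ := B.pos x hx
      have h5 := add_mem (hYL (hus s _ ha _ hc)) (L.smul_mem c (hLe s))
      rwa [sub_lie, smul_lie, sub_add_cancel] at h5
    by_cases h2 : a = -β
    · subst h2
      obtain ⟨c, hc⟩ := B.neg x hx
      have h5 := add_mem (hYL (hus s _ ha _ hc)) (L.smul_mem c (hLf s))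
      rwa [sub_lie, smul_lie, sub_add_cancel] at h5
    exact hYL (hus s a ha x (B.oth a ha h0 h1 h2 hx))
  obtain ⟨w', ⟨hw'L, hw'μ⟩, hw'0⟩ := exists_mem_ne_zero_of_ne_bot
    (hmax' L hYL hLG hLc ⟨u, by simpa using huL 0, hb1⟩)
  have hups : ∀ s, m < s → ((ρ e) ^ s) u ∈ Y := by
    intro s hs
    obtain ⟨t, rfl⟩ := Nat.exists_eq_add_of_lt hs
    rw [show m + t + 1 = t + (m + 1) by ring, pow_add, Module.End.mul_apply]
    exact hpow _ hβΓ e B.he Y hY _ hm2 t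
  have hbm : b ≤ m := by
    by_contra hlt
    have := hLle Y (W.sV.sc (fun b => if b = μ then 1 else 0)) (hYc _) (fun s => by
      by_cases hs : m < s
      · exact hYc _ _ (hups s hs)
      · rw [W.sV.sc_apply _ (hue' s)]
        have : μ + b • (-β) + s • β ≠ μ := by
          intro h
          have h' : s • β = b • β := by
            rw [smul_neg] at h
            have h6 : s • β - b • β = 0 := by
              have := sub_eq_zero.2 h
              rw [← this]; abel
            exact sub_eq_zero.1 h6
          have := nsmul_inj (k := k) (p := p) B.β0 (by omega) (by omega) h'
          omega
        rw [if_neg this, zero_smul]; exact Y.zero_mem) w' hw'L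
    rw [W.sV.sc_apply _ hw'μ, if_pos rfl, one_smul] at this
    exact hw'0 (hYz _ this hw'μ)
  have hmb : ((ρ e) ^ (m - b)) u ∉ Y := by
    intro h
    apply hm1
    have := hpow _ hβΓ e B.he Y hY _ h b
    rwa [← Module.End.mul_apply, ← pow_add, show b + (m - b) = m by omega] at this
  have h2r : 2 * r = 2 * b - m := by
    have h4 : (2 * r - 2 * b + m) * ev β ⁅e, f⁆ = 0 := by
      rw [map_add, LinearMap.add_apply, map_nsmul, map_neg, LinearMap.smul_apply, LinearMap.neg_apply, hr, nsmul_eq_mul] at h3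
      linear_combination h3
    have h5 := (mul_eq_zero.1 h4).resolve_right B.hef
    linear_combination h5
  intro hbot
  apply hmb
  have h6 := hue' (m - b)
  have h7 : μ + b • (-β) + (m - b) • β = μ - (2 * r) • β := by
    rw [h2r, ← cast_smul_eq_nsmul k b, ← cast_smul_eq_nsmul k (m - b), Nat.cast_sub hbm]
    module
  rw [h7, hbot, mem_bot] at h6
  rw [h6]; exact Y.zero_mem
theorem Jideal (W : WD p Sg Vg ev) (hA : ¬ W.CaseA) {a b : D} {x y : S} (hx : x ∈ W.J a) (hy : y ∈ Sg b) : ⁅x, y⁆ ∈ W.J (a + b) := by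
  by_cases hab : a + b = 0
  · rw [hab, J_zero]
    exact W.JN hx (by rw [← eq_neg_of_add_eq_zero_right hab]; exact hy)
  by_cases hb0 : b = 0
  · subst hb0
    rw [add_zero, ← lie_skew]
    exact neg_mem (W.HJ hy hx)
  by_cases haΓ : a ∈ zmultiples b
  · exact W.Jideal1 hA b haΓ (mem_zmultiples b) hx hy
  have hxS := W.J_le _ hx
  have hxy := W.sS.lie hxS hy
  refine (mem_J hab).2 ⟨hxy, fun z hz => ?_⟩
  by_contra hN
  obtain ⟨c, hc⟩ : ∃ c, c = -(a + b) := ⟨_, rfl⟩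
  rw [← hc] at hz
  have hc0 : c ≠ 0 := by rw [hc]; exact neg_ne_zero.2 hab
  have hxy' : ⁅x, y⁆ ∈ Sg (-c) := by rw [hc, neg_neg]; exact hxy
  have hzJ : z ∉ W.J c := fun h => hN (W.JN' h hxy')
  have hyJ : y ∉ W.J b := fun h => hN (W.JN (W.JJ hx h) (by rw [← hc]; exact hz))
  obtain ⟨e, f, B⟩ := W.good hA hb0 hy hyJ
  obtain ⟨e', f', C⟩ := W.good hA hc0 hz hzJ
  have hyz : ⁅y, z⁆ ∈ Sg (-a) := by
    have := W.sS.lie hy hz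
    rwa [show b + c = -a by rw [hc]; abel] at this
  have hxz : ⁅x, z⁆ ∈ Sg (-b) := by
    have := W.sS.lie hxS hz
    rwa [show a + c = -b by rw [hc]; abel] at this
  have hn1 := W.JN hx hyz
  have heq : ⁅⁅x, y⁆, z⁆ = ⁅x, ⁅y, z⁆⁆ - ⁅y, ⁅x, z⁆⁆ := by rw [lie_lie]
  obtain ⟨h, hh⟩ : ∃ h, h = ⁅⁅x, y⁆, z⁆ := ⟨_, rfl⟩
  have hroot : ∀ {b e f}, W.BB b e f → Sg b ≠ ⊥ := by
    intro b e f B hb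
    have h1 := B.he
    rw [hb, mem_bot] at h1
    exact B.hef (by rw [h1, zero_lie, map_zero])
  have hh0 : h ∈ Sg 0 := by
    rw [hh]
    have := W.sS.lie hxy' hz
    rwa [neg_add_cancel] at this
  have hbh : ev b h ≠ 0 := by
    intro h0
    apply hN
    rw [heq]
    refine sub_mem hn1 (W.mem_N_of_line (mem_zmultiples b) hy hxz ?_)
    rw [hh, heq, map_sub, W.root_N (hroot B) hn1, zero_sub, neg_eq_zero] at h0
    exact h0
  have hch : ev c h ≠ 0 := by
    intro h0
    apply hN
    refine W.mem_N_of_line (neg_mem (mem_zmultiples c)) hxy' (by rwa [neg_neg]) ?_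
    rw [← hh]; exact h0
  have fb : ∀ μ, Vg μ ≠ ⊥ → ∃ r : ℕ, ev μ h = r * ev b h ∧ ev μ ⁅e, f⁆ = r * ev b ⁅e, f⁆ := by
    intro μ hμ
    obtain ⟨r, hr⟩ := W.F2 b hμ
    refine ⟨r, ?_, hr _ (mem_zmultiples b) _ B.he _ B.hf⟩
    have := hr _ (mem_zmultiples b) _ hy _ hxz
    rw [hh, heq, map_sub, map_sub, this, W.root_N (hroot B) hn1, hn1.2 μ hμ]
    ring
  have fc : ∀ μ, Vg μ ≠ ⊥ → ∃ r : ℕ, ev μ h = r * ev c h ∧ ev μ ⁅e', f'⁆ = r * ev c ⁅e', f'⁆ := by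
    intro μ hμ
    obtain ⟨r, hr⟩ := W.F2 c hμ
    refine ⟨r, ?_, hr _ (mem_zmultiples c) _ C.he _ C.hf⟩
    rw [hh]
    exact hr _ (neg_mem (mem_zmultiples c)) _ hxy' _ (by rwa [neg_neg])
  have sb : ∀ μ, Vg μ ≠ ⊥ → Vg (μ - (2 * (ev μ h / ev b h)) • b) ≠ ⊥ := by
    intro μ hμ
    obtain ⟨r, h1, h2⟩ := fb μ hμ
    have := W.refl hA B hμ h2
    rwa [h1, mul_div_cancel_right₀ _ hbh]
  have sc' : ∀ μ, Vg μ ≠ ⊥ → Vg (μ - (2 * (ev μ h / ev c h)) • c) ≠ ⊥ := by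
    intro μ hμ
    obtain ⟨r, h1, h2⟩ := fc μ hμ
    have := W.refl hA C hμ h2
    rwa [h1, mul_div_cancel_right₀ _ hch]
  obtain ⟨μ, hμ, hμh⟩ : ∃ μ, Vg μ ≠ ⊥ ∧ ev μ h ≠ 0 := by
    by_contra hcon
    push Not at hcon
    exact hN (hh ▸ ⟨hh0, hcon⟩)
  set δ : D := (ev b h)⁻¹ • b - (ev c h)⁻¹ • c with hδ
  have hδh : ev δ h = 0 := by
    simp only [hδ, map_sub, map_smul, LinearMap.sub_apply, LinearMap.smul_apply, smul_eq_mul]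
    rw [inv_mul_cancel₀ hbh, inv_mul_cancel₀ hch, sub_self]
  have hit : ∀ n : ℕ, Vg (μ + n • (-(2 * ev μ h) • δ)) ≠ ⊥ := by
    intro n
    induction n with
    | zero => simpa using hμ
    | succ n ih =>
      set ν := μ + n • (-(2 * ev μ h) • δ) with hν
      have hνh : ev ν h = ev μ h := by simp [hν, hδh]
      have h1 := sb ν ih
      have h2 := sc' _ h1
      have h3 : ev (ν - (2 * (ev ν h / ev b h)) • b) h = - ev μ h := by
        rw [map_sub, LinearMap.sub_apply, map_smul, LinearMap.smul_apply, smul_eq_mul, hνh]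
        field_simp
        ring
      rw [h3, hνh] at h2
      have h4 : μ + (n + 1) • (-(2 * ev μ h) • δ) = ν - (2 * (ev μ h / ev b h)) • b - (2 * (-ev μ h / ev c h)) • c := by
        rw [succ_nsmul, ← add_assoc, ← hν, hδ, div_eq_mul_inv, div_eq_mul_inv]
        module
      rw [h4]; exact h2
  have h2k : (2 : k) ≠ 0 := by
    have := natne (k := k) (p := p) (n := 2) (by omega) (by have := B.p3; omega)
    simpa using this
  have hδ0 : -(2 * ev μ h) • δ ≠ 0 := by
    refine smul_ne_zero (neg_ne_zero.2 (mul_ne_zero h2k hμh)) fun hδ0 => haΓ ?_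
    obtain ⟨r, h1, -⟩ := fb μ hμ
    obtain ⟨s, h2, -⟩ := fc μ hμ
    have h3 : r • b = s • c := by
      have : ev μ h • δ = (r : k) • b - (s : k) • c := by
        rw [hδ, smul_sub, smul_smul, smul_smul]
        congr 2
        · rw [h1, mul_inv_cancel_right₀ hbh]
        · rw [h2, mul_inv_cancel_right₀ hch]
      rw [hδ0, smul_zero, cast_smul_eq_nsmul, cast_smul_eq_nsmul] at this
      exact (sub_eq_zero.1 this.symm)
    have h4 : s • c ≠ 0 := by
      rw [← cast_smul_eq_nsmul k]
      refine smul_ne_zero (fun h0 => hμh ?_) hc0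
      rw [h2, h0, zero_mul]
    have h5 := zmul_eq' (k := k) (p := p) (AddSubgroup.nsmul_mem _ (mem_zmultiples c) s) h4
    have h6 : c ∈ zmultiples b := by
      have h7 : c ∈ zmultiples (s • c) := by rw [h5]; exact mem_zmultiples c
      rw [← h3] at h7
      exact (AddSubgroup.zmultiples_le_of_mem (AddSubgroup.nsmul_mem _ (mem_zmultiples b) r)) h7
    rw [show a = -c - b by rw [hc]; abel]
    exact sub_mem (neg_mem h6) (mem_zmultiples b)
  obtain ⟨j, -, hj⟩ := W.nop hδ0 μ
  exact hit j hj
theorem Jbot (W : WD p Sg Vg ev) (hA : ¬ W.CaseA) (hs : ∀ I : LieIdeal k S, I = ⊥ ∨ I = ⊤) (hV : ∀ w : V, (∀ x : S, ⁅x, w⁆ = 0) → w = 0) (hV0 : ∃ w : V, w ≠ 0) (a : D) : W.J a = ⊥ := by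
  have hlie : ∀ (y x : S), x ∈ ⨆ a, W.J a → ⁅y, x⁆ ∈ ⨆ a, W.J a := by
    intro y x hx
    have hy : y ∈ ⨆ a, Sg a := by rw [W.sS.top]; trivial
    induction hy using Submodule.iSup_induction' with
    | mem b y hy =>
      induction hx using Submodule.iSup_induction' with
      | mem a x hx =>
        rw [← lie_skew]
        exact neg_mem (Submodule.mem_iSup_of_mem _ (W.Jideal hA hx hy))
      | zero => rw [lie_zero]; exact zero_mem _
      | add x x' _ _ h1 h2 => rw [lie_add]; exact add_mem h1 h2
    | zero => rw [zero_lie]; exact zero_mem _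
    | add x x' _ _ h1 h2 => rw [add_lie]; exact add_mem h1 h2
  let I : LieIdeal k S := { (⨆ a, W.J a) with lie_mem := fun {y x} hx => hlie y x hx }
  have hI : ∀ x, x ∈ I ↔ x ∈ ⨆ a, W.J a := fun x => Iff.rfl
  rcases hs I with h | h
  · rw [eq_bot_iff]
    intro x hx
    have : x ∈ I := (hI x).2 (Submodule.mem_iSup_of_mem a hx)
    rw [h] at this
    simpa using this
  · exfalso
    obtain ⟨w0, hw0⟩ := hV0
    obtain ⟨w, hw, hwJ, -⟩ := (W.JF_adm ⊤).lastV (fun v => v ≠ 0) (by simp) w0 hw0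
    apply hw
    apply hV
    intro x
    have hx : x ∈ ⨆ a, W.J a := by rw [← hI, h]; trivial
    induction hx using Submodule.iSup_induction' with
    | mem b y hy =>
      have := hwJ b y (by rw [W.JF_mem (AddSubgroup.mem_top b)]; exact hy)
      simpa using this
    | zero => rw [zero_lie]
    | add x x' _ _ h1 h2 => rw [add_lie, h1, h2, add_zero]
theorem BB.ne {W : WD p Sg Vg ev} {b : D} {e f : S} (B : W.BB b e f) : Sg b ≠ ⊥ := by
  intro hb
  have h1 := B.he
  rw [hb, mem_bot] at h1
  exact B.hef (by rw [h1, zero_lie, map_zero])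
theorem rt (W : WD p Sg Vg ev) (hA : ¬ W.CaseA) (hJ : ∀ a, W.J a = ⊥) {a : D} (ha : a ≠ 0) (hS : Sg a ≠ ⊥) : ∃ e f, W.BB a e f ∧ (∀ x ∈ Sg a, ∃ c : k, x = c • e) ∧ (∀ x ∈ Sg (-a), ∃ c : k, x = c • f) ∧ (∀ l ∈ zmultiples a, l ≠ 0 → l ≠ a → l ≠ -a → Sg l = ⊥) := by
  obtain ⟨x, hx, hx0⟩ := exists_mem_ne_zero_of_ne_bot hS
  obtain ⟨e, f, B⟩ := W.good hA ha hx (by rw [hJ]; simpa using hx0)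
  refine ⟨e, f, B, fun x hx => ?_, fun x hx => ?_, fun l h1 h2 h3 h4 => ?_⟩
  · obtain ⟨c, hc⟩ := B.pos x hx
    rw [hJ, mem_bot, sub_eq_zero] at hc
    exact ⟨c, hc⟩
  · obtain ⟨c, hc⟩ := B.neg x hx
    rw [hJ, mem_bot, sub_eq_zero] at hc
    exact ⟨c, hc⟩
  · have := B.oth l h1 h2 h3 h4
    rwa [hJ, le_bot_iff] at this
theorem rt_one (W : WD p Sg Vg ev) (hA : ¬ W.CaseA) (hJ : ∀ a, W.J a = ⊥) {a : D} (ha : a ≠ 0) (hS : Sg a ≠ ⊥) : finrank k (Sg a) = 1 := by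
  obtain ⟨e, f, B, h1, -⟩ := W.rt hA hJ ha hS
  have h2 : Sg a = span k {e} := by
    refine le_antisymm (fun x hx => ?_) ((Submodule.span_singleton_le_iff_mem _ _).2 B.he)
    obtain ⟨c, hc⟩ := h1 x hx
    exact mem_span_singleton.2 ⟨c, hc.symm⟩
  rw [h2]
  refine finrank_span_singleton fun h0 => B.hef ?_
  rw [h0, zero_lie, map_zero]
theorem rt_neg (W : WD p Sg Vg ev) (hA : ¬ W.CaseA) (hJ : ∀ a, W.J a = ⊥) {a : D} (ha : a ≠ 0) (hS : Sg a ≠ ⊥) : Sg (-a) ≠ ⊥ := by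
  obtain ⟨e, f, B, -⟩ := W.rt hA hJ ha hS
  exact B.swap.ne
theorem cl_abel (W : WD p Sg Vg ev) (hJ : ∀ a, W.J a = ⊥) {h h' : S} (hh : h ∈ Sg 0) (hh' : h' ∈ Sg 0) : ⁅h, h'⁆ = 0 := by
  have := W.HH hh hh'
  rwa [← J_zero, hJ, mem_bot] at this
theorem cl_eig (W : WD p Sg Vg ev) (hA : ¬ W.CaseA) (hJ : ∀ a, W.J a = ⊥) {a : D} {h x : S} (hh : h ∈ Sg 0) (hx : x ∈ Sg a) : ⁅h, x⁆ = ev a h • x := by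
  by_cases ha : a = 0
  · subst ha
    rw [W.cl_abel hJ hh hx, map_zero, LinearMap.zero_apply, zero_smul]
  by_cases hS : Sg a = ⊥
  · rw [hS, mem_bot] at hx
    rw [hx, lie_zero, smul_zero]
  obtain ⟨e, f, B, h1, -⟩ := W.rt hA hJ ha hS
  have he0 : e ≠ 0 := fun h0 => B.hef (by rw [h0, zero_lie, map_zero])
  obtain ⟨t, ht⟩ := h1 _ (W.sS.lie0 hh B.he)
  obtain ⟨n, hn⟩ := W.sS.nil hh B.he
  have key : ∀ n, ((toEnd k S S h - ev a h • (1 : Module.End k S)) ^ n) e = (t - ev a h) ^ n • e := by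
    intro n
    induction n with
    | zero => simp
    | succ n ih =>
      rw [pow_succ', Module.End.mul_apply, ih, map_smul]
      simp only [LinearMap.sub_apply, toEnd_apply_apply, LinearMap.smul_apply, Module.End.one_apply, ht]
      rw [← sub_smul, smul_smul, pow_succ]
  rw [key, smul_eq_zero, or_iff_left he0] at hn
  have h2 := sub_eq_zero.1 (pow_eq_zero_iff (M₀ := k) (n := n) (by rintro rfl; simp at hn) |>.1 hn)
  obtain ⟨c, rfl⟩ := h1 x hx
  rw [lie_smul, ht, h2, smul_comm]
theorem cl_b (W : WD p Sg Vg ev) (hA : ¬ W.CaseA) (hJ : ∀ a, W.J a = ⊥) {a : D} (ha : a ≠ 0) (hS : Sg a ≠ ⊥) : finrank k (span k {z : S | ∃ x ∈ Sg a, ∃ y ∈ Sg (-a), z = ⁅x, y⁆}) = 1 := by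
  obtain ⟨e, f, B, h1, h2, -⟩ := W.rt hA hJ ha hS
  have h3 : span k {z : S | ∃ x ∈ Sg a, ∃ y ∈ Sg (-a), z = ⁅x, y⁆} = span k {⁅e, f⁆} := by
    refine le_antisymm (span_le.2 ?_) (span_mono ?_)
    · rintro _ ⟨x, hx, y, hy, rfl⟩
      obtain ⟨c, rfl⟩ := h1 x hx
      obtain ⟨d, rfl⟩ := h2 y hy
      rw [smul_lie, lie_smul]
      exact smul_mem _ _ (smul_mem _ _ (mem_span_singleton_self _))
    · rintro _ rfl
      exact ⟨e, B.he, f, B.hf, rfl⟩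
  rw [h3]
  exact finrank_span_singleton fun h0 => B.hef (by rw [h0, map_zero])
theorem cl_tr (W : WD p Sg Vg ev) (hA : ¬ W.CaseA) (hJ : ∀ a, W.J a = ⊥) {χ β : D} (hβ : β ≠ 0) (hSβ : Sg β ≠ ⊥) (hχ : χ ∉ zmultiples β) (hall : ∀ m : ℕ, Sg (χ + m • β) ≠ ⊥) (m : ℕ) {e f : S} (B : W.BB (χ + m • β) e f) : ev β ⁅e, f⁆ = 0 := by
  classical
  have hβΓ := mem_zmultiples β
  have hp : p.Prime := Fact.out
  have hp3 := B.p3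
  have hγΓ : ∀ m : ℕ, χ + m • β ∉ zmultiples β := fun m h =>
    hχ ((add_mem_cancel_right _ (AddSubgroup.nsmul_mem _ hβΓ m)).1 h)
  have hγ0 : ∀ m : ℕ, χ + m • β ≠ 0 := fun m h => hγΓ m (h ▸ zero_mem _)
  obtain ⟨γ, hγ⟩ : ∃ γ, γ = χ + m • β := ⟨_, rfl⟩
  have hpβ := p_nsmul (k := k) (p := p) β
  have hp1 : (p - 1) • β = -β := by rw [eq_neg_iff_add_eq_zero, ← succ_nsmul, Nat.sub_add_cancel hp.one_le, hpβ]
  have e1 : β + γ = χ + (m + 1) • β := by rw [hγ, succ_nsmul]; abel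
  have e2 : β - γ = -(χ + (m + (p - 1)) • β) := by rw [hγ, add_nsmul, hp1]; abel
  have g0 : γ ≠ 0 := hγ ▸ hγ0 m
  have gn : γ ≠ -γ := ne_neg_self (k := k) hp3 g0
  have r1 : Sg (β + γ) ≠ ⊥ := by rw [e1]; exact hall _
  have r2 : Sg (β - γ) ≠ ⊥ := by rw [e2]; exact W.rt_neg hA hJ (hγ0 _) (hall _)
  have n1 : β + γ ≠ 0 := by rw [e1]; exact hγ0 _
  have n2 : β - γ ≠ 0 := by rw [e2]; exact neg_ne_zero.2 (hγ0 _)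
  have Bf := B.hf
  have Be := B.he
  rw [← hγ] at Bf Be
  have tr := W.sS.trace_lie Be Bf (W.lie_mem0 Be Bf) (fun b => if b - β ∈ zmultiples γ then 1 else 0) (by
    intro b
    have : b + γ - β ∈ zmultiples γ ↔ b - β ∈ zmultiples γ := by
      rw [show b + γ - β = (b - β) + γ by abel]
      exact add_mem_cancel_right _ (mem_zmultiples γ)
    simp only [this])
  have hsub : ({β - γ, β, β + γ} : Finset D) ⊆ W.sS.finite_ne_bot.toFinset := by
    intro b hb
    simp only [Finset.mem_insert, Finset.mem_singleton] at hb
    rw [Set.Finite.mem_toFinset]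
    rcases hb with rfl | rfl | rfl
    · exact r2
    · exact hSβ
    · exact r1
  rw [← Finset.sum_subset hsub] at tr
  · rw [Finset.sum_insert, Finset.sum_insert, Finset.sum_singleton, W.rt_one hA hJ n1 r1, W.rt_one hA hJ n2 r2, W.rt_one hA hJ hβ hSβ, if_pos, if_pos, if_pos] at tr
    · rw [map_add, map_sub, LinearMap.add_apply, LinearMap.sub_apply] at tr
      push_cast at tr
      have h3 : (3 : k) ≠ 0 := by
        have := natne (k := k) (p := p) (n := 3) (by omega) hp3
        simpa using this
      have : (3 : k) * ev β ⁅e, f⁆ = 0 := by linear_combination tr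
      exact (mul_eq_zero.1 this).resolve_left h3
    · simp
    · simp
    · simp
    · simpa using g0
    · simp only [Finset.mem_insert, Finset.mem_singleton, not_or]
      refine ⟨by simpa using g0, fun h => gn ?_⟩
      rw [sub_eq_add_neg] at h
      exact (add_left_cancel h).symm
  · intro b hb hb'
    rw [Set.Finite.mem_toFinset] at hb
    split_ifs with hΓ
    · exfalso
      obtain ⟨j, hj, hbj⟩ := zmul_nat (k := k) (p := p) hΓ
      have hbj' : b = β + j • γ := by rw [← hbj]; abel
      simp only [Finset.mem_insert, Finset.mem_singleton, not_or] at hb'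
      have hj0 : j ≠ 0 := by rintro rfl; apply hb'.2.1; rw [hbj']; simp
      have hj1 : j ≠ 1 := by rintro rfl; apply hb'.2.2; rw [hbj']; simp
      have hjβ : j • β ≠ 0 := by
        rw [Ne, nsmul_eq_zero_of_char (k := k) (p := p) hβ]
        exact not_dvd_of_pos_of_lt (by omega) hj
      obtain ⟨t, -, -, ht⟩ := zmul_eq (k := k) (p := p) (AddSubgroup.nsmul_mem _ hβΓ j) hjβ
      have hb2 : b = j • (χ + (m + t) • β) := by
        rw [hbj', hγ]
        nth_rw 1 [ht]
        module
      obtain ⟨e', f', -, -, -, ho⟩ := W.rt hA hJ (hγ0 (m + t)) (hall (m + t))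
      set γ' := χ + (m + t) • β
      apply hb
      rw [hb2]
      refine ho _ (AddSubgroup.nsmul_mem _ (mem_zmultiples _) _) ?_ ?_ ?_
      · rw [Ne, nsmul_eq_zero_of_char (k := k) (p := p) (hγ0 _)]
        exact not_dvd_of_pos_of_lt (by omega) hj
      · intro h
        exact hj1 (nsmul_inj (k := k) (p := p) (hγ0 (m + t)) hj (by omega) (by rw [h, one_nsmul]))
      · intro h
        have h5 : (j + 1) • γ' = 0 := by rw [succ_nsmul, h, neg_add_cancel]
        rw [nsmul_eq_zero_of_char (k := k) (p := p) (hγ0 _)] at h5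
        have h6 := Nat.le_of_dvd (by omega) h5
        apply hb'.1
        have : j = p - 1 := by omega
        rw [hbj', this, sub_eq_add_neg]
        congr 1
        rw [eq_neg_iff_add_eq_zero, ← succ_nsmul, Nat.sub_add_cancel hp.one_le, p_nsmul (k := k) (p := p)]
    · rw [zero_mul]
theorem cl_c (W : WD p Sg Vg ev) (hA : ¬ W.CaseA) (hJ : ∀ a, W.J a = ⊥) {χ β : D} (hSχ : Sg χ ≠ ⊥) (hSβ : Sg β ≠ ⊥) (hβ : β ≠ 0) : ∃ m : ℕ, Sg (χ + m • β) = ⊥ := by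
  by_contra hall
  push Not at hall
  have hβΓ := mem_zmultiples β
  obtain ⟨eβ, fβ, Bβ, -, -, oβ⟩ := W.rt hA hJ hβ hSβ
  have hp3 := Bβ.p3
  by_cases hχ : χ ∈ zmultiples β
  · obtain ⟨r, hr, rfl⟩ := zmul_nat (k := k) (p := p) hχ
    apply hall (p - r + 2)
    have h1 : r • β + (p - r + 2) • β = 2 • β := by rw [← add_nsmul, show r + (p - r + 2) = p + 2 by omega, add_nsmul, p_nsmul (k := k) (p := p), zero_add]
    rw [h1]
    refine oβ _ (AddSubgroup.nsmul_mem _ hβΓ _) ?_ ?_ ?_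
    · rw [Ne, nsmul_eq_zero_of_char (k := k) (p := p) hβ]
      exact not_dvd_of_pos_of_lt (by omega) (by omega)
    · intro h; rw [two_nsmul] at h; exact hβ (by simpa using h)
    · intro h
      have h5 : (2 + 1) • β = 0 := by rw [succ_nsmul, h, neg_add_cancel]
      rw [nsmul_eq_zero_of_char (k := k) (p := p) hβ] at h5
      exact not_dvd_of_pos_of_lt (by omega) hp3 h5
  have hγΓ : ∀ m : ℕ, χ + m • β ∉ zmultiples β := fun m h =>
    hχ ((add_mem_cancel_right _ (AddSubgroup.nsmul_mem _ hβΓ m)).1 h)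
  have hγ0 : ∀ m : ℕ, χ + m • β ≠ 0 := fun m h => hγΓ m (h ▸ zero_mem _)
  obtain ⟨e, f, B, -⟩ := W.rt hA hJ (hγ0 0) (hall 0)
  obtain ⟨e', f', B', -⟩ := W.rt hA hJ (hγ0 1) (hall 1)
  have hb := W.cl_tr hA hJ hβ hSβ hχ hall 0 B
  have hb' := W.cl_tr hA hJ hβ hSβ hχ hall 1 B'
  rw [zero_nsmul, add_zero] at B
  rw [one_nsmul] at B'
  have hg := B.hef
  have hg' := B'.hef
  obtain ⟨h, hh⟩ : ∃ h, h = ⁅e, f⁆ := ⟨_, rfl⟩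
  obtain ⟨h', hh'⟩ : ∃ h', h' = ⁅e', f'⁆ := ⟨_, rfl⟩
  have R : ∀ μ, Vg μ ≠ ⊥ → Vg (μ - (2 * (ev μ h / ev χ h)) • χ) ≠ ⊥ := by
    intro μ hμ
    refine W.refl hA B hμ ?_
    rw [← hh] at hg ⊢
    field_simp
  have R' : ∀ μ, Vg μ ≠ ⊥ → Vg (μ - (2 * (ev μ h' / ev χ h')) • (χ + β)) ≠ ⊥ := by
    intro μ hμ
    refine W.refl hA B' hμ ?_
    rw [map_add, LinearMap.add_apply, hb', add_zero] at hg' ⊢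
    rw [← hh'] at hg' ⊢
    field_simp
  rw [map_add, LinearMap.add_apply, hb', add_zero, ← hh'] at hg'
  rw [← hh] at hb hg
  rw [← hh'] at hb'
  have h2k : (2 : k) ≠ 0 := by
    have := natne (k := k) (p := p) (n := 2) (by omega) (by omega)
    simpa using this
  suffices hz : ∀ μ, Vg μ ≠ ⊥ → ev μ h' = 0 by
    have : h' ∈ W.N := ⟨by rw [hh']; exact W.lie_mem0 B'.he B'.hf, hz⟩
    rw [← J_zero, hJ, mem_bot] at this
    rw [this, map_zero] at hg'
    exact hg' rfl
  intro μ hμ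
  by_contra hne
  obtain ⟨A, hAd⟩ : ∃ A, A = ev μ h / ev χ h := ⟨_, rfl⟩
  obtain ⟨A', hA'd⟩ : ∃ A', A' = ev μ h' / ev χ h' := ⟨_, rfl⟩
  have hAe : ev μ h = A * ev χ h := by rw [hAd]; field_simp
  have hA'e : ev μ h' = A' * ev χ h' := by rw [hA'd]; field_simp
  have hit : ∀ i : ℕ, Vg (μ + (2 * i * (A' - A)) • χ - (2 * i * A' + 2 * i * (i - 1) * (A' - A)) • β) ≠ ⊥ := by
    intro i
    induction i with
    | zero => simpa using hμ
    | succ i ih =>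
      set ν := μ + (2 * i * (A' - A)) • χ - (2 * i * A' + 2 * i * (i - 1) * (A' - A)) • β with hν
      have h1 := R' ν ih
      have h2 := R _ h1
      have c1 : ev ν h' / ev χ h' = A' + 2 * i * (A' - A) := by
        rw [div_eq_iff hg', hν]
        simp only [map_sub, map_add, map_smul, LinearMap.sub_apply, LinearMap.add_apply, LinearMap.smul_apply, smul_eq_mul, hb', hA'e]
        ring
      rw [c1] at h2
      have c2 : ev (ν - (2 * (A' + 2 * i * (A' - A))) • (χ + β)) h / ev χ h = A + 2 * i * (A' - A) - 2 * (A' + 2 * i * (A' - A)) := by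
        rw [div_eq_iff hg, hν]
        simp only [map_sub, map_add, map_smul, LinearMap.sub_apply, LinearMap.add_apply, LinearMap.smul_apply, smul_eq_mul, hb, hAe]
        ring
      rw [c2] at h2
      convert h2 using 2
      rw [hν]
      push_cast
      module
  by_cases hE : A' - A = 0
  · have hA'0 : A' ≠ 0 := by rintro rfl; rw [zero_mul] at hA'e; exact hne hA'e
    obtain ⟨j, -, hj⟩ := W.nop (a := -(2 * A') • β) (smul_ne_zero (neg_ne_zero.2 (mul_ne_zero h2k hA'0)) hβ) μ
    apply hit j
    convert hj using 2
    rw [hE, ← cast_smul_eq_nsmul k]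
    module
  · obtain ⟨i, hi⟩ := W.nop' (fun i : Fin p => μ + (2 * ((i : ℕ) : k) * (A' - A)) • χ -
      (2 * ((i : ℕ) : k) * A' + 2 * ((i : ℕ) : k) * (((i : ℕ) : k) - 1) * (A' - A)) • β) (by
        intro i j hij
        have := congrArg (fun d => ev d h) hij
        simp only [map_sub, map_add, map_smul, LinearMap.sub_apply, LinearMap.add_apply, LinearMap.smul_apply, smul_eq_mul, hb, mul_zero, sub_zero] at this
        have h3 : (((i : ℕ) : k) - ((j : ℕ) : k)) * (2 * (A' - A) * ev χ h) = 0 := by linear_combination this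
        have h4 := (mul_eq_zero.1 h3).resolve_right (mul_ne_zero (mul_ne_zero h2k hE) hg)
        have h5 := sub_eq_zero.1 h4
        rw [cast_eq_iff_mod_eq k p, Nat.mod_eq_of_lt i.2, Nat.mod_eq_of_lt j.2] at h5
        exact Fin.ext h5)
    exact hit i hi
end WD
end
section
variable {k S V : Type*} [Field k] [LieRing S] [LieAlgebra k S]
    [AddCommGroup V] [Module k V] [LieRingModule S V] [LieModule k S V]
    {T : ℕ → Submodule k S} {u : ℕ → V} {e f h : S} {p : ℕ}
structure UD (p : ℕ) (T : ℕ → Submodule k S) (u : ℕ → V) (e f h : S) : Prop where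
  p2 : 2 < p
  per : ∀ j, u (j + p) = u j
  tper : ∀ i, T (i + p) = T i
  u0 : u 0 = 0
  une : ∀ j, ¬ p ∣ j → u j ≠ 0
  act : ∀ i, ∀ x ∈ T i, ∀ j, ∃ c : k, ⁅x, u j⁆ = c • u (i + j)
  br : ∀ i j, ∀ x ∈ T i, ∀ y ∈ T j, ⁅x, y⁆ ∈ T (i + j)
  he : e ∈ T 1
  hf : f ∈ T (p - 1)
  hh : h ∈ T 0
  eu : ∀ j : ℕ, ⁅e, u j⁆ = (j : k) • u (j + 1)
  fu : ∀ j : ℕ, ⁅f, u (j + 1)⁆ = ((j + 1 : ℕ) : k) • u j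
  hu : ∀ j : ℕ, ⁅h, u j⁆ = (j : k) • u j
  H : ∀ x ∈ T 0, ∃ c : k, x = c • h
  ext : ∀ x : S, (∀ j, ⁅x, u j⁆ = 0) → x = 0
  top : ⨆ i, T i = ⊤
  sp : span k (Set.range u) = ⊤
  dim : finrank k V = p - 1
namespace UD
variable [Fact p.Prime] [CharP k p]
theorem um (U : UD p T u e f h) {m n : ℕ} (hmn : m ≡ n [MOD p]) : u m = u n := by
  have h1 : Function.Periodic u p := U.per
  rw [← h1.map_mod_nat m, ← h1.map_mod_nat n, hmn]
theorem tm (U : UD p T u e f h) {m n : ℕ} (hmn : m ≡ n [MOD p]) : T m = T n := by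
  have h1 : Function.Periodic T p := U.tper
  rw [← h1.map_mod_nat m, ← h1.map_mod_nat n, hmn]
theorem up (U : UD p T u e f h) : u p = 0 := by rw [← zero_add p, U.per, U.u0]
omit [Fact p.Prime] [CharP k p] in
theorem flipmod (p j : ℕ) (hp : 0 < p) : (p - 1) * ((p - 1) * j) ≡ j [MOD p] := by
  obtain ⟨q, rfl⟩ : ∃ q, p = q + 1 := ⟨p - 1, by omega⟩
  rw [Nat.add_sub_cancel]
  rw [← Int.natCast_modEq_iff, Int.modEq_iff_dvd]
  refine ⟨(1 - (q : ℤ)) * j, ?_⟩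
  push_cast
  ring
theorem cast_flip (j : ℕ) : (((p - 1) * j : ℕ) : k) = -(j : k) := by
  have hp : p.Prime := Fact.out
  rw [Nat.cast_mul, Nat.cast_sub hp.one_le, cast_eq_zero k p]
  simp
theorem flip (U : UD p T u e f h) :
    UD p (fun i => T ((p - 1) * i)) (fun j => u ((p - 1) * j)) (-f) (-e) (-h) := by
  have hp : p.Prime := Fact.out
  have hp0 := hp.pos
  have madd : ∀ j, (p - 1) * (j + p) ≡ (p - 1) * j [MOD p] := fun j => by
    rw [mul_add]
    exact (ModEq.refl _).add (Nat.modEq_zero_iff_dvd.2 (Dvd.intro_left _ rfl)) |>.trans (by rw [add_zero])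
  refine
  { p2 := U.p2
    per := fun j => U.um (madd j)
    tper := fun j => U.tm (madd j)
    u0 := by rw [mul_zero, U.u0]
    une := fun j hj => U.une _ fun hd => ?_
    act := fun i x hx j => by
      obtain ⟨c, hc⟩ := U.act _ x hx ((p - 1) * j)
      exact ⟨c, by rw [hc, mul_add]⟩
    br := fun i j x hx y hy => by rw [mul_add]; exact U.br _ _ x hx y hy
    he := by rw [mul_one]; exact neg_mem U.hf
    hf := by
      have := flipmod p 1 hp0
      rw [mul_one] at this
      rw [U.tm this]; exact neg_mem U.he
    hh := by rw [mul_zero]; exact neg_mem U.hh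
    eu := fun j => ?_
    fu := fun j => ?_
    hu := fun j => by rw [neg_lie, U.hu, cast_flip, neg_smul, neg_neg]
    H := fun x hx => by
      rw [mul_zero] at hx
      obtain ⟨c, hc⟩ := U.H x hx
      exact ⟨-c, by rw [hc, neg_smul_neg]⟩
    ext := fun x hx => U.ext x fun j => by rw [← U.um (flipmod p j hp0)]; exact hx _
    top := ?_
    sp := ?_
    dim := U.dim }
  · rcases (hp.dvd_mul).1 hd with h1 | h1
    · exact not_dvd_of_pos_of_lt (by have := U.p2; omega) (by omega) h1
    · exact hj h1
  · have h1 := U.fu ((p - 1) * j + (p - 1))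
    rw [add_assoc, Nat.sub_add_cancel hp.one_le, U.per, Nat.cast_add, cast_flip, cast_eq_zero k p, add_zero] at h1
    rw [neg_lie, h1, mul_add, mul_one, neg_smul, neg_neg]
  · have h1 := U.eu ((p - 1) * (j + 1))
    have h2 : (p - 1) * (j + 1) + 1 = (p - 1) * j + p := by rw [mul_add, mul_one, add_assoc, Nat.sub_add_cancel hp.one_le]
    rw [h2, U.per, cast_flip] at h1
    rw [neg_lie, h1, neg_smul, neg_neg]
  · rw [eq_top_iff, ← U.top]
    refine iSup_le fun i => ?_
    rw [← U.tm (flipmod p i hp0)]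
    exact le_iSup (fun i => T ((p - 1) * i)) _
  · rw [eq_top_iff, ← U.sp, span_le]
    rintro _ ⟨j, rfl⟩
    rw [← U.um (flipmod p j hp0)]
    exact subset_span ⟨_, rfl⟩
theorem coef (U : UD p T u e f h) {i : ℕ} {x : S} (hx : x ∈ T i) :
    ∃ a : ℕ → k, (∀ j, ⁅x, u j⁆ = a j • u (i + j)) ∧ a 0 = 0 := by
  choose a ha using U.act i x hx
  refine ⟨fun j => if j = 0 then 0 else a j, fun j => ?_, by simp⟩
  by_cases hj : j = 0
  · subst hj; simp [U.u0]
  · simp only [if_neg hj, ha]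
theorem smul_inj' (U : UD p T u e f h) {j : ℕ} (hj : ¬ p ∣ j) {a b : k} (hab : a • u j = b • u j) :
    a = b := smul_left_injective k (U.une j hj) hab
theorem frel (U : UD p T u e f h) {i : ℕ} {x y : S} (hy : ⁅f, x⁆ = y) {a : ℕ → k} (ha : ∀ j, ⁅x, u j⁆ = a j • u (i + j)) {b : k} {j : ℕ} (hb : ⁅y, u (j + 1)⁆ = b • u (i + j)) (hj : ¬ p ∣ i + j) : (((i + j + 1 : ℕ) : k)) * a (j + 1) = ((j + 1 : ℕ) : k) * a j + b := by
  have h1 : ⁅f, ⁅x, u (j + 1)⁆⁆ = ⁅y, u (j + 1)⁆ + ⁅x, ⁅f, u (j + 1)⁆⁆ := by rw [← hy, ← leibniz_lie]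
  rw [hb, ha, lie_smul, U.fu, lie_smul, ha, ← add_assoc i j 1, U.fu, smul_smul, smul_smul, ← add_smul] at h1
  have := U.smul_inj' hj h1
  linear_combination this
theorem zlem (U : UD p T u e f h) {i : ℕ} (hi1 : 1 ≤ i) (hi2 : i + 2 ≤ p) {x : S} (hx : x ∈ T i) (hc : ⁅f, x⁆ = 0) : ∃ b : ℕ → k, (∀ j ≤ p - i, ⁅x, u j⁆ = 0) ∧ (∀ t, ⁅x, u (p - i + t)⁆ = b t • u t) ∧ (∀ t, 1 ≤ t → t + 1 < p → ((t + 1 : ℕ) : k) * b (t + 1) = ((t + 1 : ℕ) - (i : k)) * b t) ∧ (b 1 = 0 → x = 0) := by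
  have hp : p.Prime := Fact.out
  obtain ⟨a, ha, ha0⟩ := U.coef hx
  have rel : ∀ j, ¬ p ∣ i + j → (((i + j + 1 : ℕ) : k)) * a (j + 1) = ((j + 1 : ℕ) : k) * a j := by
    intro j hj
    have := U.frel hc ha (b := 0) (j := j) (by simp) hj
    rwa [add_zero] at this
  have hz : ∀ j, i + j < p → a j = 0 := by
    intro j
    induction j with
    | zero => intro _; exact ha0
    | succ j ih =>
      intro hj
      have h1 := rel j (not_dvd_of_pos_of_lt (by omega) (by omega))
      rw [ih (by omega), mul_zero] at h1
      exact (mul_eq_zero.1 h1).resolve_left (WD.natne (p := p) (by omega) (by omega))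
  have hz' : ∀ j ≤ p - i, ⁅x, u j⁆ = 0 := by
    intro j hj
    rw [ha]
    by_cases hj' : i + j < p
    · rw [hz j hj', zero_smul]
    · rw [show i + j = p by omega, U.up, smul_zero]
  have hb : ∀ t, ⁅x, u (p - i + t)⁆ = a (p - i + t) • u t := by
    intro t
    rw [ha, show i + (p - i + t) = t + p by omega, U.per]
  have hr : ∀ t, 1 ≤ t → t + 1 < p → ((t + 1 : ℕ) : k) * a (p - i + (t + 1)) = ((t + 1 : ℕ) - (i : k)) * a (p - i + t) := by
    intro t ht1 ht2
    have h1 := rel (p - i + t) (by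
      rw [show i + (p - i + t) = t + p by omega, Nat.dvd_add_self_right]
      exact not_dvd_of_pos_of_lt (by omega) (by omega))
    rw [show i + (p - i + t) + 1 = t + 1 + p by omega, Nat.cast_add _ p, cast_eq_zero k p, add_zero] at h1
    rw [← add_assoc, h1, show p - i + t + 1 = p + (t + 1) - i by omega, Nat.cast_sub (by omega), Nat.cast_add p, cast_eq_zero k p, zero_add]
  refine ⟨fun t => a (p - i + t), hz', hb, hr, fun h1 => ?_⟩
  have hb0 : ∀ t, 1 ≤ t → t < p → a (p - i + t) = 0 := by
    intro t ht
    induction t, ht using le_induction with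
    | base => intro _; exact h1
    | succ t ht ih =>
      intro ht2
      have h2 := hr t ht ht2
      rw [ih (by omega), mul_zero] at h2
      exact (mul_eq_zero.1 h2).resolve_left (WD.natne (p := p) (by omega) ht2)
  refine U.ext x fun j => ?_
  rw [← U.um (mod_modEq j p)]
  have hjp := Nat.mod_lt j hp.pos
  by_cases hj : j % p ≤ p - i
  · exact hz' _ hj
  · have := hb (j % p - (p - i))
    rw [show p - i + (j % p - (p - i)) = j % p by omega] at this
    rw [this, ← show p - i + (j % p - (p - i)) = j % p by omega, hb0 _ (by omega) (by omega), zero_smul]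
theorem zlem2 (U : UD p T u e f h) {i : ℕ} (hi1 : 1 ≤ i) (hi2 : i + 2 ≤ p) {x : S} (hx : x ∈ T i) (hc : ⁅f, x⁆ = 0) (hx0 : x ≠ 0) : (∀ j ≤ p - i, ⁅x, u j⁆ = 0) ∧ (∀ t, 1 ≤ t → t < i → ∃ c : k, c ≠ 0 ∧ ⁅x, u (p - i + t)⁆ = c • u t) := by
  obtain ⟨b, h1, h2, h3, h4⟩ := U.zlem hi1 hi2 hx hc
  refine ⟨h1, fun t ht1 ht2 => ⟨b t, ?_, h2 t⟩⟩
  induction t, ht1 using le_induction with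
  | base => exact fun h => hx0 (h4 h)
  | succ t ht ih =>
    intro h0
    have h5 := h3 t ht (by omega)
    rw [h0, mul_zero] at h5
    rcases mul_eq_zero.1 h5.symm with h6 | h6
    · have h7 := sub_eq_zero.1 h6
      rw [cast_eq_iff_mod_eq k p, Nat.mod_eq_of_lt (by omega), Nat.mod_eq_of_lt (by omega)] at h7
      omega
    · exact ih (by omega) h6
theorem hfe (U : UD p T u e f h) : ⁅f, e⁆ = (2 : k) • h := by
  rw [← sub_eq_zero]
  refine U.ext _ fun j => ?_
  cases j with
  | zero => rw [U.u0, lie_zero]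
  | succ j =>
    rw [sub_lie, smul_lie, lie_lie, U.eu, U.fu, lie_smul, lie_smul, U.eu, U.fu, U.hu]
    push_cast
    module
theorem T1 (U : UD p T u e f h) {x : S} (hx : x ∈ T 1) : ∃ c : k, x = c • e := by
  have hp2 := U.p2
  have h1 := U.br _ _ _ U.hf _ hx
  rw [Nat.sub_add_cancel (by omega), U.tm (show p ≡ 0 [MOD p] by simp [ModEq])] at h1
  obtain ⟨c, hc⟩ := U.H _ h1
  have h2k : (2 : k) ≠ 0 := by
    have := WD.natne (k := k) (p := p) (n := 2) (by omega) (by omega)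
    simpa using this
  refine ⟨c / 2, ?_⟩
  have h2 : ⁅f, x - (c / 2) • e⁆ = 0 := by rw [lie_sub, lie_smul, U.hfe, hc, smul_smul, div_mul_cancel₀ _ h2k, sub_self]
  have hm : x - (c / 2) • e ∈ T 1 := sub_mem hx (smul_mem _ _ U.he)
  obtain ⟨b, hz, -⟩ := U.zlem le_rfl (by omega) hm h2
  rw [← sub_eq_zero]
  refine U.ext _ fun j => ?_
  have hp : p.Prime := Fact.out
  rw [← U.um (mod_modEq j p)]
  have hjp := Nat.mod_lt j hp.pos
  exact hz _ (by omega)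
theorem Tm1 (U : UD p T u e f h) {x : S} (hx : x ∈ T (p - 1)) : ∃ c : k, x = c • f := by
  obtain ⟨c, hc⟩ := U.flip.T1 (x := x) (by simpa using hx)
  exact ⟨-c, by rw [hc]; simp⟩
theorem flipm (p j : ℕ) (hj : j ≤ p) (hp : 0 < p) : (p - 1) * j ≡ p - j [MOD p] := by
  obtain ⟨q, rfl⟩ : ∃ q, p = q + 1 := ⟨p - 1, by omega⟩
  rw [Nat.add_sub_cancel]
  rw [← Int.natCast_modEq_iff, Int.modEq_iff_dvd, Nat.cast_sub hj]
  refine ⟨1 - (j : ℤ), ?_⟩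
  push_cast
  ring
theorem zlem2f (U : UD p T u e f h) {i : ℕ} (hi1 : 2 ≤ i) (hi2 : i + 1 ≤ p) {x : S} (hx : x ∈ T i) (hc : ⁅e, x⁆ = 0) (hx0 : x ≠ 0) : (∀ l ≤ p, p - i ≤ l → ⁅x, u l⁆ = 0) ∧ (∀ l, 1 ≤ l → i + l < p → ∃ c : k, c ≠ 0 ∧ ⁅x, u l⁆ = c • u (i + l)) := by
  have hp : p.Prime := Fact.out
  have hx' : x ∈ T ((p - 1) * (p - i)) := by rw [U.tm (flipm p (p - i) (by omega) hp.pos), Nat.sub_sub_self (by omega)]; exact hx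
  obtain ⟨h1, h2⟩ := U.flip.zlem2 (i := p - i) (by omega) (by omega) hx' (by rw [neg_lie, hc, neg_zero]) hx0
  constructor
  · intro l hl hl2
    have := h1 (p - l) (by omega)
    rwa [U.um (flipm p (p - l) (by omega) hp.pos), Nat.sub_sub_self hl] at this
  · intro l hl1 hl2
    obtain ⟨c, hc, h3⟩ := h2 (p - i - l) (by omega) (by omega)
    refine ⟨c, hc, ?_⟩
    rwa [U.um (flipm p _ (by omega) hp.pos), U.um (flipm p (p - i - l) (by omega) hp.pos), show p - (p - (p - i) + (p - i - l)) = l by omega, show p - (p - i - l) = i + l by omega] at h3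
theorem nd {j : ℕ} (h1 : 0 < j) (h2 : j < p) : ¬ p ∣ j := not_dvd_of_pos_of_lt h1 h2
theorem A2 (U : UD p T u e f h) (h2 : ∀ x ∈ T 2, ⁅f, x⁆ = 0) (h2' : ∀ x ∈ T (p - 2), ⁅e, x⁆ = 0) :
    ∀ i, 2 ≤ i → i + 2 ≤ p → T i = ⊥ := by
  classical
  have hp : p.Prime := Fact.out
  by_contra hcon
  push Not at hcon
  obtain ⟨i, ⟨hi1, hi2, hi3⟩, himin⟩ : ∃ i, (2 ≤ i ∧ i + 2 ≤ p ∧ T i ≠ ⊥) ∧ ∀ j < i, ¬ (2 ≤ j ∧ j + 2 ≤ p ∧ T j ≠ ⊥) :=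
    ⟨Nat.find hcon, Nat.find_spec hcon, fun j hj => Nat.find_min hcon hj⟩
  have hcon' : ∃ j, 2 ≤ j ∧ j + 2 ≤ p ∧ T (p - j) ≠ ⊥ :=
    ⟨p - i, by omega, by omega, by rwa [Nat.sub_sub_self (by omega)]⟩
  obtain ⟨q, ⟨hq1, hq2, hq3⟩, hqmin⟩ : ∃ i, (2 ≤ i ∧ i + 2 ≤ p ∧ T (p - i) ≠ ⊥) ∧ ∀ j < i, ¬ (2 ≤ j ∧ j + 2 ≤ p ∧ T (p - j) ≠ ⊥) :=
    ⟨Nat.find hcon', Nat.find_spec hcon', fun j hj => Nat.find_min hcon' hj⟩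
  obtain ⟨i', hi'⟩ : ∃ i', i' = p - q := ⟨_, rfl⟩
  rw [← hi'] at hq3
  have hmax : ∀ j, i' < j → j + 2 ≤ p → T j = ⊥ := by
    intro j hj1 hj2
    by_contra h3
    exact hqmin (p - j) (by omega) ⟨by omega, by omega, by rwa [Nat.sub_sub_self (by omega)]⟩
  have hmin : ∀ j, 2 ≤ j → j < i → T j = ⊥ := by
    intro j hj1 hj2
    by_contra h3
    exact himin j hj2 ⟨hj1, by omega, h3⟩
  have hle : i ≤ i' := by
    by_contra h3
    exact hi3 (hmax i (by omega) hi2)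
  obtain ⟨z, hz, hz0⟩ := exists_mem_ne_zero_of_ne_bot hi3
  obtain ⟨z', hz', hz'0⟩ := exists_mem_ne_zero_of_ne_bot hq3
  have hfz : ⁅f, z⁆ = 0 := by
    by_cases h3 : i = 2
    · subst h3; exact h2 z hz
    · have h4 := U.br _ _ _ U.hf _ hz
      rw [show p - 1 + i = i - 1 + p by omega, U.tper, hmin (i - 1) (by omega) (by omega)] at h4
      exact h4
  have hez : ⁅e, z'⁆ = 0 := by
    by_cases h3 : i' = p - 2
    · rw [h3] at hz'; exact h2' z' hz'
    · have h4 := U.br _ _ _ U.he _ hz'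
      rw [hmax (1 + i') (by omega) (by omega)] at h4
      exact h4
  obtain ⟨a1, a2⟩ := U.zlem2 (by omega) hi2 hz hfz hz0
  obtain ⟨b1, b2⟩ := U.zlem2f (by omega) (by omega) hz' hez hz'0
  have hb := U.br _ _ _ hz' _ hz
  have hur : ⁅⁅z', z⁆, u (p - i)⁆ = 0 := by rw [lie_lie, a1 _ le_rfl, b1 _ (by omega) (by omega), lie_zero, lie_zero, sub_zero]
  have key : ∀ j, 1 ≤ j → ∀ (hj : j < p), ⁅⁅z', z⁆, u j⁆ ≠ 0 → ⁅z', z⁆ = 0 → False :=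
    fun j _ _ h3 h4 => h3 (by rw [h4, zero_lie])
  rcases lt_trichotomy (i + i') p with hc | hc | hc
  · obtain ⟨c, hc0, h3⟩ := a2 1 le_rfl (by omega)
    obtain ⟨c', hc0', h4⟩ := b2 1 le_rfl (by omega)
    have h5 : ⁅⁅z', z⁆, u (p - i + 1)⁆ = (c * c') • u (i' + 1) := by rw [lie_lie, h3, lie_smul, h4, b1 _ (by omega) (by omega), lie_zero, sub_zero, smul_smul]
    have h6 : ⁅⁅z', z⁆, u (p - i + 1)⁆ ≠ 0 := by
      rw [h5]
      exact smul_ne_zero (mul_ne_zero hc0 hc0') (U.une _ (nd (by omega) (by omega)))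
    by_cases h7 : i' + i + 2 ≤ p
    · rw [hmax _ (by omega) h7] at hb
      exact key _ (by omega) (by omega) h6 hb
    · rw [show i' + i = p - 1 by omega] at hb
      obtain ⟨d, hd⟩ := U.Tm1 hb
      rw [hd, smul_lie, show p - i = p - i - 1 + 1 by omega, U.fu, smul_smul] at hur
      have h8 := (smul_eq_zero.1 hur).resolve_right (U.une _ (nd (by omega) (by omega)))
      have h9 := (mul_eq_zero.1 h8).resolve_right (WD.natne (p := p) (by omega) (by omega))
      rw [h9, zero_smul] at hd
      exact key _ (by omega) (by omega) h6 hd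
  · obtain ⟨c, hc0, h3⟩ := a2 (i - 1) (by omega) (by omega)
    obtain ⟨c', hc0', h4⟩ := b2 (i - 1) (by omega) (by omega)
    rw [show p - i + (i - 1) = p - 1 by omega] at h3
    have h6 : ⁅⁅z', z⁆, u (p - 1)⁆ ≠ 0 := by
      rw [lie_lie, h3, lie_smul, h4, b1 _ (by omega) (by omega), lie_zero, sub_zero, smul_smul]
      exact smul_ne_zero (mul_ne_zero hc0 hc0') (U.une _ (nd (by omega) (by omega)))
    rw [show i' + i = 0 + p by omega, U.tper] at hb
    obtain ⟨d, hd⟩ := U.H _ hb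
    rw [hd, smul_lie, U.hu, smul_smul] at hur
    have h8 := (smul_eq_zero.1 hur).resolve_right (U.une _ (nd (by omega) (by omega)))
    have h9 := (mul_eq_zero.1 h8).resolve_right (WD.natne (p := p) (by omega) (by omega))
    rw [h9, zero_smul] at hd
    exact key _ (by omega) (by omega) h6 hd
  · obtain ⟨c', hc0', h4⟩ := b2 1 le_rfl (by omega)
    obtain ⟨c, hc0, h3⟩ := a2 (i' + 1 - (p - i)) (by omega) (by omega)
    rw [show p - i + (i' + 1 - (p - i)) = i' + 1 by omega] at h3
    have h6 : ⁅⁅z', z⁆, u 1⁆ ≠ 0 := by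
      rw [lie_lie, h4, lie_smul, h3, a1 1 (by omega), lie_zero, zero_sub, smul_smul]
      exact neg_ne_zero.2 (smul_ne_zero (mul_ne_zero hc0' hc0) (U.une _ (nd (by omega) (by omega))))
    rw [show i' + i = i' + i - p + p by omega, U.tper] at hb
    by_cases h7 : i' + i - p = 1
    · rw [h7] at hb
      obtain ⟨d, hd⟩ := U.T1 hb
      rw [hd, smul_lie, U.eu, smul_smul] at hur
      have h8 := (smul_eq_zero.1 hur).resolve_right (U.une _ (nd (by omega) (by omega)))
      have h9 := (mul_eq_zero.1 h8).resolve_right (WD.natne (p := p) (by omega) (by omega))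
      rw [h9, zero_smul] at hd
      exact key _ (by omega) (by omega) h6 hd
    · rw [hmin _ (by omega) (by omega)] at hb
      exact key _ (by omega) (by omega) h6 hb
noncomputable def ph (p : ℕ) (ε : k) (m : ℕ) : k := if m < p then 1 else ε
theorem A4 (U : UD p T u e f h) {x : S} (hx : x ∈ T 2) (hc : ⁅f, x⁆ ≠ 0) :
    3 < p ∧ ∃ ε : k, ∃ x ∈ T 2, ∀ j < p, ⁅x, u j⁆ = (j * ph p ε (2 + j)) • u (2 + j) := by
  have hp : p.Prime := Fact.out
  have hp2 := U.p2
  have hp3 : 3 < p := by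
    by_contra h3
    have h4 : p = 3 := by omega
    obtain ⟨c, hc'⟩ := U.Tm1 (x := x) (by rw [h4]; exact hx)
    exact hc (by rw [hc', lie_smul, lie_self, smul_zero])
  refine ⟨hp3, ?_⟩
  have h1 := U.br _ _ _ U.hf _ hx
  rw [show p - 1 + 2 = 1 + p by omega, U.tper] at h1
  obtain ⟨d, hd⟩ := U.T1 h1
  have hd0 : d ≠ 0 := by rintro rfl; exact hc (by rw [hd, zero_smul])
  have hx2 : (3 / d) • x ∈ T 2 := smul_mem _ _ hx
  have hf2 : ⁅f, (3 / d) • x⁆ = (3 : k) • e := by rw [lie_smul, hd, smul_smul, div_mul_cancel₀ _ hd0]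
  obtain ⟨a, ha, ha0⟩ := U.coef hx2
  refine ⟨- a (p - 1), _, hx2, ?_⟩
  have hj : ∀ j, j + 2 < p → a j = j := by
    intro j
    induction j with
    | zero => intro _; rw [ha0]; simp
    | succ j ih =>
      intro hj
      have h2 := U.frel hf2 ha (b := 3 * (j + 1 : ℕ)) (j := j) (by
        rw [smul_lie, U.eu, smul_smul, show j + 1 + 1 = 2 + j by omega]) (nd (by omega) (by omega))
      rw [ih (by omega)] at h2
      have h3 := WD.natne (k := k) (p := p) (n := 2 + j + 1) (by omega) (by omega)
      apply mul_left_cancel₀ h3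
      rw [h2]; push_cast; ring
  intro j hjp
  rw [ha]
  rcases lt_trichotomy (j + 2) p with h3 | h3 | h3
  · rw [hj j h3, ph, if_pos (by omega), mul_one]
  · rw [show 2 + j = p by omega, U.up, smul_zero, smul_zero]
  · have : j = p - 1 := by omega
    subst this
    rw [ph, if_neg (by omega), Nat.cast_sub hp.one_le, cast_eq_zero k p]
    simp
theorem A5 (U : UD p T u e f h) {ε : k} (hE : ∃ x ∈ T 2, ∀ j < p, ⁅x, u j⁆ = (j * ph p ε (2 + j)) • u (2 + j)) (i : ℕ) (h2 : 2 ≤ i) : i + 2 ≤ p → ∃ x ∈ T i, ∀ j < p, ⁅x, u j⁆ = (j * ph p ε (i + j)) • u (i + j) := by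
  have hp : p.Prime := Fact.out
  induction i, h2 using le_induction with
  | base => intro _; exact hE
  | succ i hi ih =>
    intro hi2
    obtain ⟨x, hx, hxu⟩ := ih (by omega)
    have hne : ((i - 1 : ℕ) : k) ≠ 0 := WD.natne (p := p) (by omega) (by omega)
    refine ⟨((i - 1 : ℕ) : k)⁻¹ • ⁅e, x⁆, smul_mem _ _ ?_, fun j hj => ?_⟩
    · have := U.br _ _ _ U.he _ hx
      rwa [add_comm 1 i] at this
    rw [smul_lie, inv_smul_eq_iff₀ hne, lie_lie, hxu j hj, lie_smul, U.eu, U.eu, lie_smul, Nat.cast_sub (by omega)]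
    by_cases hj1 : j + 1 < p
    · rw [hxu _ hj1, show i + (j + 1) = i + j + 1 by omega, show i + 1 + j = i + j + 1 by omega]
      by_cases h3 : i + j + 1 = p
      · rw [h3, U.up]; simp
      · have : ph p ε (i + j + 1) = ph p ε (i + j) := by
          unfold ph
          by_cases h4 : i + j < p
          · rw [if_pos h4, if_pos (by omega)]
          · rw [if_neg h4, if_neg (by omega)]
        rw [this]
        push_cast
        module
    · have hjj : j + 1 = p := by omega
      rw [hjj, U.up, lie_zero, smul_zero, sub_zero, show i + 1 + j = i + j + 1 by omega]
      have h4 : ((j : ℕ) : k) = -1 := by rw [show j = p - 1 by omega, Nat.cast_sub hp.one_le, cast_eq_zero k p]; simp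
      rw [ph, if_neg (by omega), ph, if_neg (by omega)]
      push_cast
      rw [h4]
      module
theorem A5f (U : UD p T u e f h) {ε : k} {i : ℕ} {x y : S} (h2 : 1 ≤ i) (hi : i + 1 < p) (hx : ∀ j < p, ⁅x, u j⁆ = (j * ph p ε (i + 1 + j)) • u (i + 1 + j)) (hy : ∀ j < p, ⁅y, u j⁆ = (j * ph p ε (i + j)) • u (i + j)) : ⁅f, x⁆ = ((i + 2 : ℕ) : k) • y := by
  have hp : p.Prime := Fact.out
  rw [← sub_eq_zero]
  refine U.ext _ fun j => ?_
  rw [← U.um (mod_modEq j p)]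
  have hjp := Nat.mod_lt j hp.pos
  obtain ⟨m, hm⟩ : ∃ m, m = j % p := ⟨_, rfl⟩
  rw [← hm] at hjp ⊢
  cases m with
  | zero => rw [U.u0, lie_zero]
  | succ m =>
    rw [sub_lie, smul_lie, lie_lie, hx _ hjp, hy _ hjp, U.fu, lie_smul, lie_smul, hx _ (by omega), show i + 1 + (m + 1) = (i + m + 1) + 1 by omega, U.fu, show i + 1 + m = i + m + 1 by omega, show i + (m + 1) = i + m + 1 by omega]
    by_cases h3 : i + m + 1 + 1 = p
    · have h4 : ((i + m + 1 + 1 : ℕ) : k) = 0 := by rw [h3]; exact cast_eq_zero k p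
      rw [h4]
      have h5 : ((i + 2 : ℕ) : k) = - m := by rw [eq_neg_iff_add_eq_zero, ← h4]; push_cast; ring
      rw [h5]
      module
    · have : ph p ε (i + m + 1 + 1) = ph p ε (i + m + 1) := by
        unfold ph
        by_cases h4 : i + m + 1 < p
        · rw [if_pos h4, if_pos (by omega)]
        · rw [if_neg h4, if_neg (by omega)]
      rw [this]
      push_cast
      module
theorem A6 (U : UD p T u e f h) {ε : k} (hE : ∃ x ∈ T 2, ∀ j < p, ⁅x, u j⁆ = (j * ph p ε (2 + j)) • u (2 + j)) (i : ℕ) (h2 : 1 ≤ i) : i + 2 ≤ p → ∃ x, (∀ j < p, ⁅x, u j⁆ = (j * ph p ε (i + j)) • u (i + j)) ∧ ∀ y ∈ T i, ∃ c : k, y = c • x := by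
  have hp : p.Prime := Fact.out
  have hp2 := U.p2
  induction i, h2 using le_induction with
  | base =>
    intro _
    refine ⟨e, fun j hj => ?_, fun y hy => U.T1 hy⟩
    rw [U.eu, add_comm 1 j]
    by_cases h3 : j + 1 < p
    · rw [ph, if_pos h3, mul_one]
    · rw [show j + 1 = p by omega, U.up, smul_zero, smul_zero]
  | succ i hi ih =>
    intro hi2
    obtain ⟨y, hyu, hy⟩ := ih (by omega)
    obtain ⟨x, hx, hxu⟩ := U.A5 hE (i + 1) (by omega) hi2
    refine ⟨x, hxu, fun w hw => ?_⟩
    have hfx := U.A5f hi (by omega) hxu hyu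
    have h1 := U.br _ _ _ U.hf _ hw
    rw [show p - 1 + (i + 1) = i + p by omega, U.tper] at h1
    obtain ⟨c, hc⟩ := hy _ h1
    have hne : ((i + 2 : ℕ) : k) ≠ 0 := WD.natne (p := p) (by omega) (by omega)
    refine ⟨c / ((i + 2 : ℕ) : k), ?_⟩
    rw [← sub_eq_zero]
    set z := w - (c / ((i + 2 : ℕ) : k)) • x with hz
    have hzT : z ∈ T (i + 1) := sub_mem hw (smul_mem _ _ hx)
    have hfz : ⁅f, z⁆ = 0 := by rw [hz, lie_sub, lie_smul, hc, hfx, smul_smul, div_mul_cancel₀ _ hne, sub_self]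
    obtain ⟨b, b1, b2, b3, b4⟩ := U.zlem (by omega) hi2 hzT hfz
    apply b4
    obtain ⟨r, hr⟩ : ∃ r, r = p - (i + 1) := ⟨_, rfl⟩
    rw [← hr] at b1 b2
    obtain ⟨g, hg, hgu⟩ := U.A5 hE r (by omega) (by omega)
    have h3 := U.br _ _ _ hg _ hzT
    rw [show r + (i + 1) = 0 + p by omega, U.tper] at h3
    obtain ⟨d, hd⟩ := U.H _ h3
    have e1 : ⁅⁅g, z⁆, u 1⁆ = d • u 1 := by rw [hd, smul_lie, U.hu]; simp
    have e2 : ⁅⁅g, z⁆, u 2⁆ = (2 * d) • u 2 := by rw [hd, smul_lie, U.hu, smul_smul, mul_comm]; simp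
    rw [lie_lie, b1 1 (by omega), hgu 1 (by omega), lie_smul, b2, ph, if_pos (by omega), lie_zero, smul_smul, zero_sub, ← neg_smul] at e1
    rw [lie_lie, b1 2 (by omega), hgu 2 (by omega), lie_smul, b2, lie_zero, smul_smul, zero_sub, ← neg_smul] at e2
    have f1 := U.smul_inj' (nd (by omega) (by omega)) e1
    have f2 := U.smul_inj' (nd (by omega) (by omega)) e2
    have f3 := b3 1 le_rfl (by omega)
    simp only [Nat.cast_one, mul_one, one_mul] at f1
    have h2k : (2 : k) ≠ 0 := by
      have := WD.natne (k := k) (p := p) (n := 2) (by omega) (by omega)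
      simpa using this
    push_cast at f2 f3
    by_cases hi1 : i = 1
    · subst hi1
      have : b 2 = 0 := by
        have : (2 : k) * b 2 = 0 := by push_cast at f3; linear_combination f3
        exact (mul_eq_zero.1 this).resolve_left h2k
      rw [this, mul_zero, neg_zero] at f2
      have := (mul_eq_zero.1 f2.symm).resolve_left h2k
      rw [this] at f1
      exact neg_eq_zero.1 f1
    · rw [ph, if_pos (by omega)] at f2
      have hne1 : ((i + 1 : ℕ) : k) ≠ 0 := WD.natne (p := p) (by omega) (by omega)
      have : ((i + 1 : ℕ) : k) * b 1 = 0 := by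
        push_cast
        linear_combination f3 + f2 - 2 * f1
      exact (mul_eq_zero.1 this).resolve_left hne1
theorem gen (U : UD p T u e f h) {ε : k} (hE : ∀ i, 1 ≤ i → i + 2 ≤ p → ∃ x, (∀ j < p, ⁅x, u j⁆ = (j * ph p ε (i + j)) • u (i + j)) ∧ ∀ y ∈ T i, ∃ c : k, y = c • x) :
    ∃ E : ℕ → S, (∀ m < p, ∀ j < p, ⁅E m, u j⁆ = (j * ph p ε (m + j - 1)) • u (m + j - 1)) ∧ span k (E '' Set.Iio p) = ⊤ := by
  have hp : p.Prime := Fact.out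
  have hp2 := U.p2
  choose! x hx1 hx2 using hE
  let E : ℕ → S := fun m => if m = 0 then f else if m = 1 then h else x (m - 1)
  refine ⟨E, fun m hm j hj => ?_, ?_⟩
  · rcases m with _ | _ | m
    · cases j with
      | zero => simp [U.u0]
      | succ j =>
        change ⁅f, _⁆ = _
        rw [U.fu, ph, if_pos (by omega), mul_one]; simp
    · change ⁅h, _⁆ = _
      rw [U.hu, ph, if_pos (by omega), mul_one]; simp
    · change ⁅x (m + 1), _⁆ = _
      rw [hx1 _ (by omega) (by omega) _ hj, show m + 1 + 1 + j - 1 = m + 1 + j by omega]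
  · rw [eq_top_iff, ← U.top, iSup_le_iff]
    intro i y hy
    rw [← U.tm (mod_modEq i p)] at hy
    have hip := Nat.mod_lt i hp.pos
    obtain ⟨m, hm⟩ : ∃ m, m = i % p := ⟨_, rfl⟩
    rw [← hm] at hip hy
    have key : ∀ m < p, ∀ c : k, c • E m ∈ span k (E '' Set.Iio p) := fun m hm c =>
      smul_mem _ _ (subset_span ⟨m, hm, rfl⟩)
    by_cases h0 : m = 0
    · subst h0
      obtain ⟨c, rfl⟩ := U.H _ hy
      exact key 1 (by omega) c
    by_cases h1 : m = p - 1
    · subst h1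
      obtain ⟨c, rfl⟩ := U.Tm1 hy
      exact key 0 (by omega) c
    · obtain ⟨c, rfl⟩ := hx2 m (by omega) (by omega) y hy
      have := key (m + 1) (by omega) c
      have h3 : E (m + 1) = x m := by
        change (if m + 1 = 0 then f else if m + 1 = 1 then h else x (m + 1 - 1)) = _
        rw [if_neg (by omega), if_neg (by omega), Nat.add_sub_cancel]
      rwa [h3] at this
theorem final (U : UD p T u e f h) : (3 < p ∧ ∀ i, 2 ≤ i → i + 2 ≤ p → T i = ⊥) ∨
    ∃ (u : ℕ → V) (ε : k) (E : ℕ → S), u p = 0 ∧ (∀ j, u (j + p) = u j) ∧ span k (Set.range u) = ⊤ ∧ (∀ m < p, ∀ j < p, ⁅E m, u j⁆ = (j * ph p ε (m + j - 1)) • u (m + j - 1)) ∧ span k (E '' Set.Iio p) = ⊤ := by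
  have hp2 := U.p2
  by_cases hA : ∃ x ∈ T 2, ⁅f, x⁆ ≠ 0
  · right
    obtain ⟨x, hx, hfx⟩ := hA
    obtain ⟨-, ε, hE⟩ := U.A4 hx hfx
    obtain ⟨E, h1, h2⟩ := U.gen (U.A6 hE)
    exact ⟨u, ε, E, U.up, U.per, U.sp, h1, h2⟩
  by_cases hB : ∃ x ∈ T (p - 2), ⁅e, x⁆ ≠ 0
  · right
    obtain ⟨x, hx, hfx⟩ := hB
    have hp : p.Prime := Fact.out
    obtain ⟨-, ε, hE⟩ := U.flip.A4 (x := x) (by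
      change x ∈ T ((p - 1) * 2)
      rwa [U.tm (flipm p 2 (by omega) hp.pos)]) (by rw [neg_lie]; exact neg_ne_zero.2 hfx)
    obtain ⟨E, h1, h2⟩ := U.flip.gen (U.flip.A6 hE)
    exact ⟨_, ε, E, U.flip.up, U.flip.per, U.flip.sp, h1, h2⟩
  push Not at hA hB
  by_cases h3 : 3 < p
  · exact Or.inl ⟨h3, U.A2 hA hB⟩
  · right
    obtain ⟨E, h1, h2⟩ := U.gen (ε := 0) (fun i hi hi2 => by
      have : i = 1 := by omega
      subst this
      refine ⟨e, fun j hj => ?_, fun y hy => U.T1 hy⟩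
      rw [U.eu, add_comm 1 j]
      by_cases h3 : j + 1 < p
      · rw [ph, if_pos h3, mul_one]
      · rw [show j + 1 = p by omega, U.up, smul_zero, smul_zero])
    exact ⟨u, 0, E, U.up, U.per, U.sp, h1, h2⟩
end UD
end
section
variable {k : Type*} [Field k] {p : ℕ}
namespace WI
theorem ntriv (k : Type*) [Field k] (p : ℕ) (hp : p.Prime) : Nontrivial (TruncPoly p k 1) := by
  let g : MvPolynomial (Fin 1) k →+* k := MvPolynomial.eval 0
  have hg : ∀ a ∈ truncIdeal p k 1, g a = 0 := by
    intro a ha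
    have : truncIdeal p k 1 ≤ RingHom.ker g := by
      rw [Ideal.span_le]
      rintro _ ⟨i, rfl⟩
      change g _ = 0
      simp [g, hp.ne_zero]
    exact this ha
  exact (Ideal.Quotient.lift (truncIdeal p k 1) g hg).domain_nontrivial
variable [CharP k p]
theorem truncX_pow (hp : p.Prime) : (truncX p k 1 0) ^ p = 0 := by
  rw [truncX, ← map_pow, Ideal.Quotient.eq_zero_iff_mem]
  exact Ideal.subset_span ⟨0, rfl⟩
theorem x_pow (hp : p.Prime) {δ ε : k} (hδ : δ ^ p = ε) : (truncX p k 1 0 + algebraMap k (TruncPoly p k 1) δ) ^ p = algebraMap k (TruncPoly p k 1) ε := by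
  haveI := ntriv k p hp
  haveI : Fact p.Prime := ⟨hp⟩
  haveI : CharP (TruncPoly p k 1) p := charP_of_injective_algebraMap (algebraMap k (TruncPoly p k 1)).injective p
  rw [add_pow_char, truncX_pow hp, zero_add, ← map_pow, hδ]
theorem pd_x (δ : k) : truncPD p k 1 0 (truncX p k 1 0 + algebraMap k (TruncPoly p k 1) δ) = 1 := by
  rw [map_add, Derivation.map_algebraMap, add_zero]
  change Ideal.Quotient.mk (truncIdeal p k 1) (MvPolynomial.pderiv 0 (MvPolynomial.X 0)) = 1
  rw [MvPolynomial.pderiv_X_self, map_one]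
theorem poly_inj (hp : p.Prime) {x : TruncPoly p k 1} (hx : truncPD p k 1 0 x = 1) (n : ℕ) :
    ∀ q : Polynomial k, n < p → q.natDegree ≤ n → Polynomial.aeval x q = 0 → q = 0 := by
  haveI := ntriv k p hp
  have hconst : ∀ c : k, Polynomial.aeval x (Polynomial.C c) = 0 → c = 0 := by
    intro c hc
    rw [Polynomial.aeval_C] at hc
    exact (map_eq_zero _).1 hc
  induction n with
  | zero =>
    intro q _ hq h0
    have h3 := Polynomial.eq_C_of_natDegree_le_zero hq
    rw [h3] at h0 ⊢
    rw [hconst _ h0, map_zero]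
  | succ n ih =>
    intro q hn hq h0
    have h1 : Polynomial.aeval x (Polynomial.derivative q) = 0 := by
      have := Derivation.map_aeval (truncPD p k 1 0) q x
      rw [h0, map_zero, hx, smul_eq_mul, mul_one] at this
      exact this.symm
    have h2 := ih _ (by omega) ((Polynomial.natDegree_derivative_le q).trans (by omega)) h1
    have h3 : q = Polynomial.C (q.coeff 0) := by
      ext m
      cases m with
      | zero => simp
      | succ m =>
        rw [Polynomial.coeff_C_succ]
        by_cases hm : m + 1 ≤ n + 1
        · have h4 := congrArg (fun r => Polynomial.coeff r m) h2
          simp only [Polynomial.coeff_derivative, Polynomial.coeff_zero] at h4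
          have h5 : ((m + 1 : ℕ) : k) ≠ 0 := by
            rw [Ne, cast_eq_zero_iff k p]
            exact not_dvd_of_pos_of_lt (by omega) (by omega)
          push_cast at h5
          exact (mul_eq_zero.1 h4).resolve_right h5
        · exact Polynomial.coeff_eq_zero_of_natDegree_lt (by omega)
    rw [h3] at h0 ⊢
    rw [hconst _ h0, map_zero]
theorem x_li (hp : p.Prime) {x : TruncPoly p k 1} (hx : truncPD p k 1 0 x = 1) :
    LinearIndependent k (fun i : Fin p => x ^ (i : ℕ)) := by
  rw [Fintype.linearIndependent_iff]
  intro g hg i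
  have h1 := poly_inj hp hx (p - 1) (∑ i : Fin p, Polynomial.monomial (i : ℕ) (g i)) (by have := hp.pos; omega)
    (Polynomial.natDegree_sum_le_of_forall_le _ _ fun i _ =>
      (Polynomial.natDegree_monomial_le _).trans (by have := i.2; omega))
    (by
      rw [map_sum, ← hg]
      refine sum_congr rfl fun i _ => ?_
      rw [Polynomial.aeval_monomial]
      exact (Algebra.smul_def _ _).symm)
  have h2 := congrArg (fun q => Polynomial.coeff q (i : ℕ)) h1
  simp only [Polynomial.finset_sum_coeff, Polynomial.coeff_monomial, Polynomial.coeff_zero] at h2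
  rw [Finset.sum_eq_single i] at h2
  · simpa using h2
  · intro j _ hj
    rw [if_neg]
    exact fun h => hj (Fin.ext h)
  · intro h; exact absurd (Finset.mem_univ _) h
theorem x_span (hp : p.Prime) {δ ε : k} {x : TruncPoly p k 1} (hx : x = truncX p k 1 0 + algebraMap k (TruncPoly p k 1) δ) (hxp : x ^ p = algebraMap k (TruncPoly p k 1) ε) :
    ⊤ ≤ span k (Set.range (fun i : Fin p => x ^ (i : ℕ))) := by
  set M := span k (Set.range (fun i : Fin p => x ^ (i : ℕ))) with hM
  have hm : ∀ i < p, x ^ i ∈ M := fun i hi => subset_span ⟨⟨i, hi⟩, rfl⟩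
  have h1 : (1 : TruncPoly p k 1) ∈ M := by simpa using hm 0 hp.pos
  have hmul : ∀ a ∈ M, a * x ∈ M := by
    intro a ha
    induction ha using span_induction with
    | mem a ha =>
      obtain ⟨i, rfl⟩ := ha
      change x ^ (i : ℕ) * x ∈ M
      rw [← pow_succ]
      by_cases hi : (i : ℕ) + 1 < p
      · exact hm _ hi
      · have : (i : ℕ) + 1 = p := by have := i.2; omega
        rw [this, hxp, Algebra.algebraMap_eq_smul_one]
        exact smul_mem _ _ h1
    | zero => rw [zero_mul]; exact zero_mem _
    | add a b _ _ ha hb => rw [add_mul]; exact add_mem ha hb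
    | smul c a _ ha => rw [smul_mul_assoc]; exact smul_mem _ _ ha
  rintro a -
  obtain ⟨q, rfl⟩ := Ideal.Quotient.mk_surjective a
  induction q using MvPolynomial.induction_on with
  | C c =>
    have : Ideal.Quotient.mk (truncIdeal p k 1) (MvPolynomial.C c) = c • (1 : TruncPoly p k 1) := by rw [← Algebra.algebraMap_eq_smul_one]; rfl
    rw [this]
    exact smul_mem _ _ h1
  | add a b ha hb => rw [map_add]; exact add_mem ha hb
  | mul_X a i ha =>
    rw [map_mul]
    have hi : i = 0 := Subsingleton.elim _ _
    have : Ideal.Quotient.mk (truncIdeal p k 1) (MvPolynomial.X i) = x - algebraMap k (TruncPoly p k 1) δ := by rw [hx, hi, truncX]; abel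
    rw [this, mul_sub, mul_comm _ (algebraMap k _ δ), ← Algebra.smul_def]
    exact sub_mem (hmul _ ha) (smul_mem _ _ ha)
variable {S V : Type*} [LieRing S] [LieAlgebra k S]
    [AddCommGroup V] [Module k V] [LieRingModule S V] [LieModule k S V]
theorem build {A : Type*} [CommRing A] [Algebra k A] (π : A →ₗ[k] V) (hπ : Function.Surjective π) (hf : ∀ x : S, (∀ v : V, ⁅x, v⁆ = 0) → x = 0) (h1 : ∀ s : S, ∃ D : Derivation k A A, ∀ a, π (D a) = ⁅s, π a⁆) (h2 : ∀ D : Derivation k A A, ∃ s : S, ∀ a, π (D a) = ⁅s, π a⁆) (h3 : ∀ D : Derivation k A A, (∀ a, π (D a) = 0) → D = 0) :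
    Nonempty (S ≃ₗ⁅k⁆ Derivation k A A) := by
  choose F hF using h1
  have uniq : ∀ D D' : Derivation k A A, (∀ a, π (D a) = π (D' a)) → D = D' := by
    intro D D' h
    rw [← sub_eq_zero]
    apply h3
    intro a
    rw [Derivation.sub_apply, map_sub, h, sub_self]
  let G : S →ₗ⁅k⁆ Derivation k A A :=
    { toFun := F
      map_add' := by
        intro s t
        apply uniq
        intro a
        rw [hF, Derivation.add_apply, map_add, hF, hF, add_lie]
      map_smul' := by
        intro c t
        apply uniq
        intro a
        rw [hF, RingHom.id_apply, Derivation.smul_apply, map_smul, hF, smul_lie]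
      map_lie' := by
        intro s t
        apply uniq
        intro a
        rw [hF, Derivation.commutator_apply, map_sub, hF, hF, hF, hF, lie_lie] }
  refine ⟨LieEquiv.ofBijective G ⟨?_, ?_⟩⟩
  · rw [injective_iff_map_eq_zero]
    intro s hs
    apply hf
    intro v
    obtain ⟨a, rfl⟩ := hπ v
    rw [← hF s a]
    have : F s = 0 := hs
    rw [this, Derivation.zero_apply, map_zero]
  · intro D
    obtain ⟨s, hs⟩ := h2 D
    exact ⟨s, uniq _ _ fun a => by rw [hs]; exact hF s a⟩
theorem main [IsAlgClosed k] [FiniteDimensional k V] (hp : p.Prime) (hp2 : 2 < p) (hdim : finrank k V = p - 1) (hf : ∀ x : S, (∀ v : V, ⁅x, v⁆ = 0) → x = 0) (u : ℕ → V) (ε : k) (E : ℕ → S) (hup : u p = 0) (hper : ∀ j, u (j + p) = u j) (hsp : span k (Set.range u) = ⊤) (hE : ∀ m < p, ∀ j < p, ⁅E m, u j⁆ = (j * UD.ph p ε (m + j - 1)) • u (m + j - 1)) (hEs : span k (E '' Set.Iio p) = ⊤) : Nonempty (S ≃ₗ⁅k⁆ WittAlg p k 1) := by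
  haveI := ntriv k p hp
  obtain ⟨δ, hδ⟩ := IsAlgClosed.exists_pow_nat_eq ε hp.pos
  obtain ⟨x, hx⟩ : ∃ x, x = truncX p k 1 0 + algebraMap k (TruncPoly p k 1) δ := ⟨_, rfl⟩
  have hxp : x ^ p = algebraMap k (TruncPoly p k 1) ε := by rw [hx]; exact x_pow hp hδ
  have hdx : truncPD p k 1 0 x = 1 := by rw [hx]; exact pd_x δ
  let B := Basis.mk (x_li hp hdx) (x_span hp hx hxp)
  have hB : ∀ i : Fin p, B i = x ^ (i : ℕ) := fun i => Basis.mk_apply _ _ i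
  let π : TruncPoly p k 1 →ₗ[k] V := B.constr k (fun i : Fin p => u i)
  have hπ0 : ∀ j < p, π (x ^ j) = u j := by
    intro j hj
    have := B.constr_basis k (fun i : Fin p => u i) ⟨j, hj⟩
    rwa [hB] at this
  have hπ : ∀ j < 2 * p, π (x ^ j) = UD.ph p ε j • u j := by
    intro j hj
    by_cases h : j < p
    · rw [hπ0 j h, UD.ph, if_pos h, one_smul]
    · rw [UD.ph, if_neg h]
      obtain ⟨i, rfl⟩ : ∃ i, j = i + p := ⟨j - p, by omega⟩
      rw [pow_add, hxp, mul_comm, ← Algebra.smul_def, map_smul, hπ0 i (by omega), hper]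
  have hsurj : Function.Surjective π := by
    rw [← LinearMap.range_eq_top, eq_top_iff, ← hsp, span_le]
    rintro _ ⟨j, rfl⟩
    have h1 : Function.Periodic u p := hper
    rw [← h1.map_mod_nat j]
    exact ⟨x ^ (j % p), hπ0 _ (Nat.mod_lt _ hp.pos)⟩
  have hu0 : u 0 = 0 := by rw [← hper, zero_add, hup]
  have hπ1 : π 1 = 0 := by rw [← pow_zero x, hπ0 0 hp.pos, hu0]
  haveI : FiniteDimensional k (TruncPoly p k 1) := Basis.finiteDimensional_of_finite B
  have hA : finrank k (TruncPoly p k 1) = p := by rw [Module.finrank_eq_card_basis B, Fintype.card_fin]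
  have hker : ∀ a, π a = 0 → ∃ c : k, a = algebraMap k _ c := by
    intro a ha
    have h1 := LinearMap.finrank_range_add_finrank_ker π
    rw [LinearMap.range_eq_top.2 hsurj, finrank_top, hdim, hA] at h1
    have h2 : finrank k (LinearMap.ker π) = 1 := by omega
    obtain ⟨c, hc⟩ := (finrank_eq_one_iff_of_nonzero' (⟨1, hπ1⟩ : LinearMap.ker π)
      (fun h => one_ne_zero (congrArg Subtype.val h))).1 h2 ⟨a, ha⟩
    refine ⟨c, ?_⟩
    have := congrArg Subtype.val hc
    rw [Algebra.algebraMap_eq_smul_one]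
    exact this.symm
  have hDext : ∀ D : Derivation k (TruncPoly p k 1) (TruncPoly p k 1), D = D x • truncPD p k 1 0 := by
    intro D
    apply Derivation.coe_injective
    have hl : (D : TruncPoly p k 1 →ₗ[k] TruncPoly p k 1) = ((D x • truncPD p k 1 0 : Derivation k _ _) :
        TruncPoly p k 1 →ₗ[k] TruncPoly p k 1) := by
      apply B.ext
      intro i
      rw [hB]
      change D (x ^ (i : ℕ)) = D x • truncPD p k 1 0 (x ^ (i : ℕ))
      rw [Derivation.leibniz_pow, Derivation.leibniz_pow, hdx]
      simp only [smul_eq_mul, nsmul_eq_mul]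
      ring
    funext a
    exact congr_fun hl a
  have hEm : ∀ m < p, ∀ a, π ((x ^ m • truncPD p k 1 0 : Derivation k _ _) a) = ⁅E m, π a⁆ := by
    intro m hm a
    have hl : π ∘ₗ ((x ^ m • truncPD p k 1 0 : Derivation k _ _) : TruncPoly p k 1 →ₗ[k] TruncPoly p k 1) = (toEnd k S V (E m)) ∘ₗ π := by
      apply B.ext
      intro i
      rw [hB]
      change π (x ^ m • truncPD p k 1 0 (x ^ (i : ℕ))) = ⁅E m, π (x ^ (i : ℕ))⁆
      rw [hπ0 _ i.2, hE m hm _ i.2, Derivation.leibniz_pow, hdx]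
      obtain ⟨i, hi⟩ := i
      change π (x ^ m • i • x ^ (i - 1) • 1) = ((i : k) * UD.ph p ε (m + i - 1)) • u (m + i - 1)
      cases i with
      | zero => simp
      | succ i =>
        have : x ^ m • (i + 1) • x ^ (i + 1 - 1) • (1 : TruncPoly p k 1) = ((i + 1 : ℕ) : k) • x ^ (m + (i + 1) - 1) := by
          rw [show m + (i + 1) - 1 = m + i by omega, Nat.add_sub_cancel, cast_smul_eq_nsmul, pow_add]
          simp only [smul_eq_mul, nsmul_eq_mul]
          ring
        rw [this, map_smul, hπ _ (by omega), smul_smul]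
    exact congr_fun hl a
  refine build π hsurj hf ?_ ?_ ?_
  · intro s
    have hs : s ∈ span k (E '' Set.Iio p) := by rw [hEs]; trivial
    induction hs using span_induction with
    | mem s hs => obtain ⟨m, hm, rfl⟩ := hs; exact ⟨_, hEm m hm⟩
    | zero => exact ⟨0, fun a => by rw [zero_lie, Derivation.zero_apply, map_zero]⟩
    | add s t _ _ hs ht =>
      obtain ⟨D, hD⟩ := hs
      obtain ⟨D', hD'⟩ := ht
      exact ⟨D + D', fun a => by rw [add_lie, Derivation.add_apply, map_add, hD, hD']⟩
    | smul c s _ hs =>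
      obtain ⟨D, hD⟩ := hs
      exact ⟨c • D, fun a => by rw [smul_lie, Derivation.smul_apply, map_smul, hD]⟩
  · intro D
    rw [hDext D]
    obtain ⟨y, hy⟩ : ∃ y, y = D x := ⟨_, rfl⟩
    rw [← hy]
    have hb : y ∈ span k (Set.range (fun i : Fin p => x ^ (i : ℕ))) := x_span hp hx hxp trivial
    clear hy
    induction hb using span_induction with
    | mem s hs => obtain ⟨m, rfl⟩ := hs; exact ⟨_, hEm m m.2⟩
    | zero => exact ⟨0, fun a => by rw [zero_lie]; change π (0 * truncPD p k 1 0 a) = 0; rw [zero_mul, map_zero]⟩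
    | add s t _ _ hs ht =>
      obtain ⟨D, hD⟩ := hs
      obtain ⟨D', hD'⟩ := ht
      exact ⟨D + D', fun a => by rw [add_lie, add_smul, Derivation.add_apply, map_add, hD, hD']⟩
    | smul c s _ hs =>
      obtain ⟨D, hD⟩ := hs
      exact ⟨c • D, fun a => by rw [smul_lie, smul_assoc, Derivation.smul_apply, map_smul, hD]⟩
  · intro D hD
    obtain ⟨c, hc⟩ := hker _ (hD x)
    obtain ⟨d, hd⟩ := hker _ (hD (x ^ 2))
    rw [Derivation.leibniz_pow, hc] at hd
    have h1 : Polynomial.aeval x (Polynomial.C (2 * c) * Polynomial.X - Polynomial.C d) = 0 := by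
      simp only [map_sub, map_mul, Polynomial.aeval_C, Polynomial.aeval_X]
      rw [← hd, map_ofNat]
      simp only [smul_eq_mul, nsmul_eq_mul]
      push_cast
      ring
    have h2 := poly_inj hp hdx 1 _ (by omega) (by
      refine (Polynomial.natDegree_sub_le _ _).trans ?_
      rw [Polynomial.natDegree_C]
      simp only [max_le_iff, zero_le, and_true]
      exact (Polynomial.natDegree_C_mul_le _ _).trans Polynomial.natDegree_X_le) h1
    have h3 := congrArg (fun q => Polynomial.coeff q 1) h2
    simp [Polynomial.coeff_C] at h3
    have h4 : (2 : k) ≠ 0 := by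
      have : ((2 : ℕ) : k) ≠ 0 := by
        rw [Ne, cast_eq_zero_iff k p]
        exact not_dvd_of_pos_of_lt (by omega) (by omega)
      simpa using this
    have h5 : c = 0 := by tauto
    rw [hDext D, hc, h5, map_zero]
    apply Derivation.ext
    intro a
    exact zero_mul (truncPD p k 1 0 a)
end WI
end
section
variable {k S D V : Type*} [Field k] [LieRing S] [LieAlgebra k S] [AddCommGroup D] [Module k D]
    [AddCommGroup V] [Module k V] [LieRingModule S V] [LieModule k S V]
    {Sg : D → Submodule k S} {Vg : D → Submodule k V} {ev : D →ₗ[k] Dual k S} {p : ℕ}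
namespace WD
variable [Fact p.Prime] [CharP k p] [FiniteDimensional k S] [FiniteDimensional k V]
local notation "ρ" => toEnd k S V
structure CA (W : WD p Sg Vg ev) (κ : D) (e f : S) (ν : D) (v : V) : Prop where
  p2 : 2 < p
  hκ : κ ≠ 0
  he : e ∈ Sg κ
  hf : f ∈ Sg (-κ)
  hc : ev κ ⁅e, f⁆ ≠ 0
  hv : v ∈ Vg ν
  top : ((toEnd k S V e) ^ (p - 2)) v ≠ 0
namespace CA
variable {W : WD p Sg Vg ev} {κ : D} {e f : S} {ν : D} {v : V}
theorem ne (C : CA W κ e f ν v) {s : ℕ} (hs : s < p - 1) : (ρ e ^ s) v ≠ 0 := by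
  intro h
  apply C.top
  rw [show p - 2 = (p - 2 - s) + s by omega, pow_add, Module.End.mul_apply, h, map_zero]
theorem mem (C : CA W κ e f ν v) (s : ℕ) : (ρ e ^ s) v ∈ Vg (ν + s • κ) := W.pow_mem C.he C.hv s
theorem li (C : CA W κ e f ν v) : LinearIndependent k (fun s : Fin (p - 1) => (ρ e ^ (s : ℕ)) v) := by
  have h1 : Function.Injective (fun s : Fin (p - 1) => ν + (s : ℕ) • κ) := by
    intro i j h
    exact Fin.ext (nsmul_inj (k := k) (p := p) C.hκ (by have := i.2; omega) (by have := j.2; omega) (by simpa using h))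
  have h2 := W.sV.ind.comp h1
  exact h2.linearIndependent _ (fun i => C.mem i) (fun i => C.ne i.2)
theorem dim (C : CA W κ e f ν v) : finrank k V = p - 1 := by
  have h1 := C.li.fintype_card_le_finrank
  rw [Fintype.card_fin] at h1
  have := W.dim
  omega
theorem spn (C : CA W κ e f ν v) :
    span k (Set.range (fun s : Fin (p - 1) => (ρ e ^ (s : ℕ)) v)) = ⊤ :=
  C.li.span_eq_top_of_card_eq_finrank' (by rw [Fintype.card_fin, C.dim])
theorem K (C : CA W κ e f ν v) {χ : D} {m : V} (hm : m ∈ Vg χ) :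
    m = 0 ∨ ∃ s < p - 1, χ = ν + s • κ ∧ ∃ c : k, m = c • (ρ e ^ s) v := by
  let n : D → Submodule k V := fun χ => span k {w | ∃ s < p - 1, χ = ν + s • κ ∧ w = (ρ e ^ s) v}
  have hn : ∀ a, n a ≤ Vg a := by
    intro a
    rw [span_le]
    rintro _ ⟨s, hs, rfl, rfl⟩
    exact C.mem s
  have htop : m ∈ ⨆ a, n a := by
    have : (⊤ : Submodule k V) ≤ ⨆ a, n a := by
      rw [← C.spn, span_le]
      rintro _ ⟨s, rfl⟩
      exact (le_iSup n (ν + (s : ℕ) • κ)) (subset_span ⟨s, s.2, rfl, rfl⟩)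
    exact this trivial
  have h1 : m ∈ n χ := indep_part W.sV.ind hn hm htop
  by_cases hs : ∃ s < p - 1, χ = ν + s • κ
  · obtain ⟨s, hs, rfl⟩ := hs
    right
    refine ⟨s, hs, rfl, ?_⟩
    have h2 : n (ν + s • κ) ≤ span k {(ρ e ^ s) v} := by
      apply span_mono
      rintro _ ⟨t, ht, h3, rfl⟩
      have := nsmul_inj (k := k) (p := p) C.hκ (i := s) (j := t) (by omega) (by omega) (by simpa using h3)
      rw [this]
      rfl
    obtain ⟨c, hc⟩ := mem_span_singleton.1 (h2 h1)
    exact ⟨c, hc.symm⟩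
  · left
    have h2 : n χ ≤ ⊥ := by
      rw [span_le]
      rintro _ ⟨t, ht, h3, rfl⟩
      exact absurd ⟨t, ht, h3⟩ hs
    exact h2 h1
theorem eigV (C : CA W κ e f ν v) {χ : D} {m : V} {h : S} (hh : h ∈ Sg 0) (hm : m ∈ Vg χ) :
    ⁅h, m⁆ = ev χ h • m := by
  by_cases hm0 : m = 0
  · rw [hm0, lie_zero, smul_zero]
  have hc : ∃ c : k, ⁅h, m⁆ = c • m := by
    rcases C.K hm with h1 | ⟨s, hs, hχ, c, h1⟩
    · exact absurd h1 hm0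
    rcases C.K (W.sV.lie0 hh hm) with h2 | ⟨t, ht, hχ', d, h2⟩
    · exact ⟨0, by rw [h2, zero_smul]⟩
    · have h3 := nsmul_inj (k := k) (p := p) C.hκ (i := s) (j := t) (by omega) (by omega)
        (by rw [hχ] at hχ'; simpa using hχ')
      subst h3
      have hc0 : c ≠ 0 := by rintro rfl; exact hm0 (by rw [h1, zero_smul])
      exact ⟨d / c, by rw [h2, h1, smul_smul, div_mul_cancel₀ _ hc0]⟩
  obtain ⟨c, hc⟩ := hc
  obtain ⟨n, hn⟩ := W.sV.nil hh hm
  have h1 : ∀ n : ℕ, ((ρ h - ev χ h • (1 : Module.End k V)) ^ n) m = (c - ev χ h) ^ n • m := by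
    intro n
    induction n with
    | zero => simp
    | succ n ih =>
      rw [pow_succ', Module.End.mul_apply, ih, map_smul]
      have : (ρ h - ev χ h • (1 : Module.End k V)) m = (c - ev χ h) • m := by
        change ⁅h, m⁆ - ev χ h • m = _
        rw [hc, sub_smul]
      rw [this, smul_smul, ← pow_succ]
  rw [h1] at hn
  have h2 := (smul_eq_zero.1 hn).resolve_right hm0
  have h3 := sub_eq_zero.1 (eq_zero_of_pow_eq_zero h2)
  rw [hc, h3]
theorem ext' (C : CA W κ e f ν v) {x y : S} (h : ∀ χ, ∀ m ∈ Vg χ, ⁅x, m⁆ = ⁅y, m⁆) : x = y := by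
  rw [← sub_eq_zero]
  apply W.faithful
  intro w
  have := W.sV.ext (T := ρ x) (T' := ρ y) h
  rw [sub_lie, sub_eq_zero]
  exact congr_fun this w
theorem eig (C : CA W κ e f ν v) {a : D} {x : S} {h : S} (hh : h ∈ Sg 0) (hx : x ∈ Sg a) :
    ⁅h, x⁆ = ev a h • x := by
  refine C.ext' fun χ m hm => ?_
  rw [lie_lie, C.eigV hh hm, C.eigV hh (W.sV.lie hx hm), smul_lie, lie_smul, map_add, LinearMap.add_apply]
  module
theorem sumk (C : CA W κ e f ν v) : ((∑ s ∈ Finset.range (p - 1), s : ℕ) : k) = 1 := by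
  have h1 := congrArg (fun n : ℕ => (n : k)) (Finset.sum_range_id_mul_two (p - 1))
  have hp2 := C.p2
  have h2k : (2 : k) ≠ 0 := by
    have := natne (k := k) (p := p) (n := 2) (by omega) (by omega)
    simpa using this
  simp only [Nat.cast_mul] at h1
  rw [show p - 1 - 1 = p - 2 by omega, Nat.cast_sub (by omega : 1 ≤ p), Nat.cast_sub (by omega : 2 ≤ p), cast_eq_zero k p] at h1
  apply mul_right_cancel₀ h2k
  push_cast at h1 ⊢
  rw [h1]; ring
theorem nu (C : CA W κ e f ν v) (htr : ∀ x : S, LinearMap.trace k V (ρ x) = 0) : ν = κ := by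
  have hp2 := C.p2
  rw [← sub_eq_zero]
  apply W.inj
  intro h hh
  let B := Basis.mk C.li C.spn.ge
  have hB : ∀ i, B i = (ρ e ^ (i : ℕ)) v := fun i => Basis.mk_apply _ _ i
  have h1 := htr h
  rw [LinearMap.trace_eq_matrix_trace k B, Matrix.trace] at h1
  have h2 : ∀ i : Fin (p - 1), Matrix.diag (LinearMap.toMatrix B B (ρ h)) i = ev ν h + (i : ℕ) * ev κ h := by
    intro i
    rw [Matrix.diag_apply, LinearMap.toMatrix_apply]
    have : (ρ h) (B i) = (ev ν h + (i : ℕ) * ev κ h) • B i := by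
      rw [hB]
      change ⁅h, _⁆ = _
      rw [C.eigV hh (C.mem i), map_add, LinearMap.add_apply, map_nsmul, LinearMap.smul_apply, nsmul_eq_mul]
    rw [this, map_smul, Basis.repr_self]
    simp
  rw [sum_congr rfl fun i _ => h2 i, Finset.sum_add_distrib, ← Finset.sum_mul, Fin.sum_univ_eq_sum_range (fun i => ((i : ℕ) : k)) (p - 1), ← Nat.cast_sum, C.sumk, Finset.sum_const, Finset.card_univ, Fintype.card_fin, one_mul, nsmul_eq_mul, Nat.cast_sub (by omega : 1 ≤ p), cast_eq_zero k p] at h1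
  rw [map_sub, LinearMap.sub_apply]
  push_cast at h1
  linear_combination -h1
theorem nsm (C : CA W κ e f ν v) {i j : ℕ} (h : i • κ = j • κ) : i ≡ j [MOD p] := by
  rw [← cast_smul_eq_nsmul k i, ← cast_smul_eq_nsmul k j] at h
  exact (cast_eq_iff_mod_eq k p).1 (smul_left_injective k C.hκ h)
omit [FiniteDimensional k S] [FiniteDimensional k V] in
theorem msn (κ : D) (p : ℕ) [CharP k p] {i j : ℕ} (h : i ≡ j [MOD p]) : i • κ = j • κ := by rw [← cast_smul_eq_nsmul k i, ← cast_smul_eq_nsmul k j, (cast_eq_iff_mod_eq k p).2 h]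
noncomputable def w (k : Type*) {S V : Type*} [Field k] [LieRing S] [LieAlgebra k S]
    [AddCommGroup V] [Module k V] [LieRingModule S V] [LieModule k S V] (e : S) (v : V) (r : ℕ) : V :=
  if r = 0 then 0 else ((factorial (r - 1) : ℕ) : k)⁻¹ • (toEnd k S V e ^ (r - 1)) v
theorem w_succ (e : S) (v : V) (r : ℕ) : w k e v (r + 1) = ((factorial r : ℕ) : k)⁻¹ • (ρ e ^ r) v := by rw [w, if_neg (by omega), Nat.add_sub_cancel]
theorem w_zero (e : S) (v : V) : w k e v 0 = 0 := if_pos rfl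
theorem facne {r : ℕ} (hr : r < p) : ((factorial r : ℕ) : k) ≠ 0 := by
  have hp : p.Prime := Fact.out
  rw [Ne, cast_eq_zero_iff k p, hp.dvd_factorial]
  omega
theorem last0 (C : CA W κ e f ν v) : (ρ e ^ (p - 1)) v = 0 := by
  have hp2 := C.p2
  rcases C.K (C.mem (p - 1)) with h | ⟨s, hs, h, -⟩
  · exact h
  · have := nsmul_inj (k := k) (p := p) C.hκ (i := p - 1) (j := s) (by omega) (by omega) (by simpa using h)
    omega
theorem f0 (C : CA W κ e f ν v) : ⁅f, v⁆ = 0 := by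
  have hp2 := C.p2
  rcases C.K (W.sV.lie C.hf C.hv) with h | ⟨s, hs, h, -⟩
  · exact h
  · have h1 : (s + 1) • κ = 0 := by
      have : s • κ = -κ := by
        have := h
        rw [add_comm] at this
        exact (add_left_cancel this).symm
      rw [succ_nsmul, this, neg_add_cancel]
    rw [nsmul_eq_zero_of_char (k := k) (p := p) C.hκ] at h1
    have := Nat.le_of_dvd (by omega) h1
    omega
theorem fs (C : CA W κ e f ν v) (hν : ν = κ) (s : ℕ) : (2 : k) • ⁅f, (ρ e ^ (s + 1)) v⁆ = (-(ev κ ⁅e, f⁆) * ((s + 1 : ℕ) * (s + 2 : ℕ))) • (ρ e ^ s) v := by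
  have step : ∀ s : ℕ, ⁅f, (ρ e ^ (s + 1)) v⁆ = ⁅e, ⁅f, (ρ e ^ s) v⁆⁆ - ((s + 1 : ℕ) * ev κ ⁅e, f⁆) • (ρ e ^ s) v := by
    intro s
    have h1 : ⁅⁅e, f⁆, (ρ e ^ s) v⁆ = ((s + 1 : ℕ) * ev κ ⁅e, f⁆) • (ρ e ^ s) v := by
      rw [C.eigV (W.lie_mem0 C.he C.hf) (C.mem s), hν, map_add, LinearMap.add_apply, map_nsmul, LinearMap.smul_apply, nsmul_eq_mul]
      push_cast
      module
    rw [← h1, lie_lie, pow_succ', Module.End.mul_apply]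
    change ⁅f, ⁅e, _⁆⁆ = _
    abel
  induction s with
  | zero =>
    rw [step 0, pow_zero, Module.End.one_apply, C.f0, lie_zero]
    push_cast
    module
  | succ s ih =>
    rw [step (s + 1), smul_sub, ← lie_smul, ih, lie_smul]
    have : ⁅e, (ρ e ^ s) v⁆ = (ρ e ^ (s + 1)) v := by rw [pow_succ', Module.End.mul_apply]; rfl
    rw [this]
    push_cast
    module
theorem toUD (C : CA W κ e f ν v) (hν : ν = κ) :
    UD p (fun i => Sg (i • κ)) (fun j => w k e v (j % p)) e ((-(2 / ev κ ⁅e, f⁆)) • f) ((ev κ ⁅e, f⁆)⁻¹ • ⁅e, f⁆) := by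
  have hp : p.Prime := Fact.out
  have hp2 := C.p2
  have hpos := hp.pos
  have hc := C.hc
  have wm : ∀ r < p, w k e v r ∈ Vg (r • κ) := by
    intro r hr
    cases r with
    | zero => rw [w_zero]; exact zero_mem _
    | succ r =>
      rw [w_succ]
      have := C.mem r
      rw [hν, ← succ_nsmul'] at this
      exact smul_mem _ _ this
  have um : ∀ j : ℕ, w k e v (j % p) ∈ Vg (j • κ) := by
    intro j
    rw [← msn (k := k) κ p (mod_modEq j p)]
    exact wm _ (Nat.mod_lt _ hpos)
  have wne : ∀ r, 0 < r → r < p → w k e v r ≠ 0 := by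
    intro r h1 h2
    obtain ⟨s, rfl⟩ : ∃ s, r = s + 1 := ⟨r - 1, by omega⟩
    rw [w_succ]
    exact smul_ne_zero (inv_ne_zero (facne (p := p) (by omega))) (C.ne (by omega))
  have K' : ∀ j : ℕ, ∀ m ∈ Vg (j • κ), ∃ c : k, m = c • w k e v (j % p) := by
    intro j m hm
    rcases C.K hm with h | ⟨s, hs, h, c, h1⟩
    · exact ⟨0, by rw [h, zero_smul]⟩
    · rw [hν, ← succ_nsmul'] at h
      have h2 := C.nsm h
      have h3 : j % p = s + 1 := by rw [h2, Nat.mod_eq_of_lt (by omega)]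
      refine ⟨c * (factorial s : ℕ), ?_⟩
      rw [h3, w_succ, smul_smul, mul_assoc, mul_inv_cancel₀ (facne (p := p) (by omega)), mul_one, h1]
  have hu : ∀ j : ℕ, ∀ x ∈ Sg 0, ⁅x, w k e v (j % p)⁆ = (j * ev κ x) • w k e v (j % p) := by
    intro j x hx
    rw [C.eigV hx (um j), map_nsmul, LinearMap.smul_apply, nsmul_eq_mul]
  have hsp : span k (Set.range (fun j => w k e v (j % p))) = ⊤ := by
    rw [eq_top_iff, ← C.spn, span_le]
    rintro _ ⟨s, rfl⟩
    have h1 : (ρ e ^ (s : ℕ)) v = ((factorial s : ℕ) : k) • w k e v (((s : ℕ) + 1) % p) := by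
      have := s.2
      rw [Nat.mod_eq_of_lt (by omega), w_succ, smul_smul, mul_inv_cancel₀ (facne (p := p) (by omega)), one_smul]
    change (ρ e ^ (s : ℕ)) v ∈ _
    rw [h1]
    exact smul_mem _ _ (subset_span ⟨_, rfl⟩)
  have hext : ∀ x : S, (∀ j, ⁅x, w k e v (j % p)⁆ = 0) → x = 0 := by
    intro x hx
    apply W.faithful
    intro m
    have hm : m ∈ span k (Set.range (fun j => w k e v (j % p))) := by rw [hsp]; trivial
    induction hm using span_induction with
    | mem m hm => obtain ⟨j, rfl⟩ := hm; exact hx j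
    | zero => rw [lie_zero]
    | add a b _ _ ha hb => rw [lie_add, ha, hb, add_zero]
    | smul c a _ ha => rw [lie_smul, ha, smul_zero]
  have hh0 := W.lie_mem0 C.he C.hf
  have castmod : ∀ j : ℕ, (j : k) = ((j % p : ℕ) : k) := fun j =>
    (cast_eq_iff_mod_eq k p).2 (mod_modEq j p).symm
  refine
  { p2 := C.p2
    per := fun j => by rw [Nat.add_mod_right]
    tper := fun i => by
      change Sg ((i + p) • κ) = _
      rw [msn (k := k) κ p (show i + p ≡ i [MOD p] by simp [ModEq])]
    u0 := by rw [Nat.zero_mod]; exact w_zero _ _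
    une := fun j hj => wne _ (by rw [Nat.dvd_iff_mod_eq_zero] at hj; omega) (Nat.mod_lt _ hpos)
    act := fun i x hx j => by
      have := W.sV.lie hx (um j)
      rw [← add_nsmul] at this
      exact K' _ _ this
    br := fun i j x hx y hy => by
      have := W.sS.lie hx hy
      rwa [← add_nsmul] at this
    he := by rw [one_nsmul]; exact C.he
    hf := by
      have h1 : (p - 1) • κ = -κ := by rw [eq_neg_iff_add_eq_zero, ← succ_nsmul, Nat.sub_add_cancel hpos, p_nsmul (k := k) κ]
      rw [h1]
      exact smul_mem _ _ C.hf
    hh := by rw [zero_nsmul]; exact smul_mem _ _ hh0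
    eu := ?_
    fu := ?_
    hu := fun j => by
      rw [smul_lie, hu j _ hh0, smul_smul]
      congr 1
      field_simp
    H := fun x hx => by
      rw [zero_nsmul] at hx
      refine ⟨ev κ x, ?_⟩
      rw [← sub_eq_zero]
      apply hext
      intro j
      rw [sub_lie, smul_lie, smul_lie, hu j _ hx, hu j _ hh0, smul_smul, smul_smul, ← sub_smul]
      have : (j * ev κ x - ev κ x * ((ev κ ⁅e, f⁆)⁻¹ * (j * ev κ ⁅e, f⁆)) : k) = 0 := by field_simp; ring
      rw [mul_assoc (ev κ x), this, zero_smul]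
    ext := hext
    top := ?_
    sp := hsp
    dim := C.dim }
  · intro j
    rw [castmod j, Nat.add_mod, Nat.mod_eq_of_lt (show 1 < p by omega)]
    have hjp := Nat.mod_lt j hpos
    obtain ⟨r, hr⟩ : ∃ r, r = j % p := ⟨_, rfl⟩
    rw [← hr] at hjp ⊢
    cases r with
    | zero => rw [w_zero, lie_zero]; simp
    | succ r =>
      have h1 : ⁅e, (ρ e ^ r) v⁆ = (ρ e ^ (r + 1)) v := by rw [pow_succ', Module.End.mul_apply]; rfl
      rw [w_succ, lie_smul, h1]
      by_cases h2 : r + 1 + 1 = p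
      · rw [h2, Nat.mod_self, w_zero, show r + 1 = p - 1 by omega, C.last0, smul_zero, smul_zero]
      · rw [Nat.mod_eq_of_lt (by omega), w_succ, smul_smul, Nat.factorial_succ, Nat.cast_mul, mul_inv, ← mul_assoc, mul_inv_cancel₀ (natne (p := p) (by omega) (by omega)), one_mul]
  · intro j
    have h2k : (2 : k) ≠ 0 := by
      have := natne (k := k) (p := p) (n := 2) (by omega) (by omega)
      simpa using this
    have hjp := Nat.mod_lt j hpos
    obtain ⟨r, hr⟩ : ∃ r, r = j % p := ⟨_, rfl⟩
    rw [Nat.cast_add, castmod j, Nat.add_mod, Nat.mod_eq_of_lt (show 1 < p by omega)]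
    rw [← hr] at hjp ⊢
    by_cases h2 : r + 1 = p
    · rw [h2, Nat.mod_self, w_zero, lie_zero, ← Nat.cast_add, h2, cast_eq_zero k p, zero_smul]
    · rw [Nat.mod_eq_of_lt (by omega), w_succ, smul_lie, lie_smul]
      cases r with
      | zero => rw [pow_zero, Module.End.one_apply, C.f0, w_zero]; simp
      | succ r =>
        have h3 : ⁅f, (ρ e ^ (r + 1)) v⁆ = (2⁻¹ * (-(ev κ ⁅e, f⁆) * ((r + 1 : ℕ) * (r + 2 : ℕ)))) • (ρ e ^ r) v := by rw [mul_smul, ← C.fs hν r, smul_smul, inv_mul_cancel₀ h2k, one_smul]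
        rw [h3, w_succ, smul_smul, smul_smul, smul_smul, Nat.factorial_succ]
        congr 1
        have h4 := facne (k := k) (p := p) (r := r) (by omega)
        have h5 := natne (k := k) (p := p) (n := r + 1) (by omega) (by omega)
        push_cast at h5 ⊢
        field_simp
        ring
  · rw [eq_top_iff, ← W.sS.top, iSup_le_iff]
    intro a
    by_cases ha : Sg a = ⊥
    · rw [ha]; exact bot_le
    · obtain ⟨χ, h1, h2⟩ := W.root_diff ha
      obtain ⟨m1, hm1, hn1⟩ := exists_mem_ne_zero_of_ne_bot h1
      obtain ⟨m2, hm2, hn2⟩ := exists_mem_ne_zero_of_ne_bot h2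
      rcases C.K hm1 with h | ⟨s, hs, hχ, -⟩
      · exact absurd h hn1
      rcases C.K hm2 with h | ⟨t, ht, hχ', -⟩
      · exact absurd h hn2
      have h3 : a ∈ zmultiples κ := by
        have : a = t • κ - s • κ := by
          rw [hχ] at hχ'
          rw [eq_sub_iff_add_eq]
          have h5 : a + s • κ + ν = t • κ + ν := by rw [add_comm (t • κ), ← hχ']; abel
          exact add_right_cancel h5
        rw [this]
        exact sub_mem (AddSubgroup.nsmul_mem_zmultiples κ t) (AddSubgroup.nsmul_mem_zmultiples κ s)
      obtain ⟨r, -, rfl⟩ := zmul_nat (k := k) (p := p) h3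
      exact le_iSup (fun i : ℕ => Sg (i • κ)) r
end CA
structure CL (W : WD p Sg Vg ev) : Prop where
  abel : ∀ h ∈ Sg 0, ∀ h' ∈ Sg 0, ⁅h, h'⁆ = 0
  eig : ∀ a, ∀ h ∈ Sg 0, ∀ x ∈ Sg a, ⁅h, x⁆ = ev a h • x
  b : ∀ a, a ≠ 0 → Sg a ≠ ⊥ → finrank k (span k {z : S | ∃ x ∈ Sg a, ∃ y ∈ Sg (-a), z = ⁅x, y⁆}) = 1
  c : ∀ χ β, Sg χ ≠ ⊥ → Sg β ≠ ⊥ → β ≠ 0 → ∃ m : ℕ, Sg (χ + m • β) = ⊥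
theorem span1 {P Q : Submodule k S} {e f h : S} (hP : e ∈ P) (hQ : f ∈ Q) (hP' : ∀ x ∈ P, ∃ c : k, x = c • e) (hQ' : ∀ x ∈ Q, ∃ c : k, x = c • f) {d : k} (hd : d ≠ 0) (hh : h ≠ 0) (hef : ⁅e, f⁆ = d • h) :
    finrank k (span k {z : S | ∃ x ∈ P, ∃ y ∈ Q, z = ⁅x, y⁆}) = 1 := by
  have : span k {z : S | ∃ x ∈ P, ∃ y ∈ Q, z = ⁅x, y⁆} = span k {⁅e, f⁆} := by
    apply le_antisymm
    · rw [span_le]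
      rintro _ ⟨x, hx, y, hy, rfl⟩
      obtain ⟨c, rfl⟩ := hP' x hx
      obtain ⟨c', rfl⟩ := hQ' y hy
      rw [smul_lie, lie_smul]
      exact smul_mem _ _ (smul_mem _ _ (mem_span_singleton_self _))
    · rw [span_le]
      rintro _ rfl
      exact subset_span ⟨e, hP, f, hQ, rfl⟩
  rw [this]
  exact finrank_span_singleton (by rw [hef]; exact smul_ne_zero hd hh)
theorem CA.cl {W : WD p Sg Vg ev} {κ ν : D} {e f : S} {v : V} (C : CA W κ e f ν v) {u : ℕ → V} {e' f' h' : S} (U : UD p (fun i => Sg (i • κ)) u e' f' h') (h3 : 3 < p) (hb : ∀ i : ℕ, 2 ≤ i → i + 2 ≤ p → Sg (i • κ) = ⊥) :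
    W.CL := by
  have hp : p.Prime := Fact.out
  have hκ := C.hκ
  have hpos := hp.pos
  have hroot : ∀ a, Sg a ≠ ⊥ → ∃ r : ℕ, r < p ∧ a = r • κ := by
    intro a ha
    by_contra hcon
    obtain ⟨x, hx, hx0⟩ := exists_mem_ne_zero_of_ne_bot ha
    have htop : (⊤ : Submodule k S) ≤ ⨆ (b : D) (_ : b ≠ a), Sg b := by
      rw [← U.top, iSup_le_iff]
      intro i
      refine le_iSup₂_of_le (i • κ) ?_ le_rfl
      rintro rfl
      exact hcon ⟨i % p, Nat.mod_lt _ hpos, CA.msn (k := k) κ p (mod_modEq i p).symm⟩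
    exact hx0 ((Submodule.disjoint_def.1 (W.sS.ind a)) x hx (htop trivial))
  have hm1 : (p - 1) • κ = -κ := by rw [eq_neg_iff_add_eq_zero, ← succ_nsmul, Nat.sub_add_cancel hpos, p_nsmul (k := k) κ]
  have he' : e' ∈ Sg κ := by have := U.he; rwa [one_nsmul] at this
  have hf' : f' ∈ Sg (-κ) := by have := U.hf; rwa [hm1] at this
  have he'' : ∀ x ∈ Sg κ, ∃ c : k, x = c • e' := fun x hx => U.T1 (by rwa [one_nsmul])
  have hf'' : ∀ x ∈ Sg (-κ), ∃ c : k, x = c • f' := fun x hx => U.Tm1 (by rwa [hm1])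
  have hh0 : h' ≠ 0 := by
    intro h0
    have h1 := U.hu 1
    rw [h0, zero_lie, Nat.cast_one, one_smul] at h1
    exact U.une 1 (UD.nd (by omega) (by omega)) h1.symm
  have h2k : (2 : k) ≠ 0 := by
    have := natne (k := k) (p := p) (n := 2) (by omega) (by omega)
    simpa using this
  have hef : ⁅e', f'⁆ = (-2 : k) • h' := by rw [← lie_skew, U.hfe, neg_smul]
  refine ⟨fun h hh x hx => ?_, fun a h hh x hx => C.eig hh hx, ?_, ?_⟩
  · rw [C.eig hh hx, map_zero, LinearMap.zero_apply, zero_smul]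
  · intro a ha hS
    obtain ⟨r, hr, rfl⟩ := hroot a hS
    have hr0 : r ≠ 0 := by rintro rfl; exact ha (zero_nsmul _)
    by_cases hr1 : r = 1
    · subst hr1
      rw [one_nsmul]
      exact span1 he' hf' he'' hf'' (neg_ne_zero.2 h2k) hh0 hef
    · have hr2 : r = p - 1 := by
        by_contra hr2
        exact hS (hb r (by omega) (by omega))
      rw [hr2, hm1, neg_neg]
      exact span1 hf' he' hf'' he'' h2k hh0 U.hfe
  · intro χ β hχ hβ hβ0
    obtain ⟨s, hs, rfl⟩ := hroot χ hχ
    obtain ⟨r, hr, rfl⟩ := hroot β hβ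
    obtain ⟨t, -, -, ht⟩ := zmul_eq (k := k) (p := p) (AddSubgroup.nsmul_mem_zmultiples κ r) hβ0
    refine ⟨(2 + (p - 1) * s) * t, ?_⟩
    rw [mul_nsmul', ← ht, ← add_nsmul]
    have : s + (2 + (p - 1) * s) = 2 + p * s := by
      obtain ⟨q, rfl⟩ : ∃ q, p = q + 1 := ⟨p - 1, by omega⟩
      rw [Nat.add_sub_cancel]; ring
    rw [this, CA.msn (k := k) κ p (show 2 + p * s ≡ 2 [MOD p] by simp [ModEq])]
    exact hb 2 le_rfl (by omega)
theorem dichotomy [IsAlgClosed k] (W : WD p Sg Vg ev) (hp2 : 2 < p) (hs : ∀ I : LieIdeal k S, I = ⊥ ∨ I = ⊤) (hV : ∀ w : V, (∀ x : S, ⁅x, w⁆ = 0) → w = 0) (hV0 : ∃ w : V, w ≠ 0) (htr : ∀ x : S, LinearMap.trace k V (toEnd k S V x) = 0) :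
    W.CL ∨ Nonempty (S ≃ₗ⁅k⁆ WittAlg p k 1) := by
  by_cases hA : W.CaseA
  · obtain ⟨κ, e, f, ν, v, h1, h2, h3, h4, h5, h6⟩ := hA
    have C : CA W κ e f ν v := ⟨hp2, h1, h2, h3, h4, h5, h6⟩
    have U := C.toUD (C.nu htr)
    rcases U.final with ⟨h7, h8⟩ | ⟨u, ε, E, g1, g2, g3, g4, g5⟩
    · exact Or.inl (C.cl U h7 h8)
    · exact Or.inr (WI.main Fact.out hp2 C.dim W.faithful u ε E g1 g2 g3 g4 g5)
  · left
    have hJ := W.Jbot hA hs hV hV0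
    exact ⟨fun h hh h' hh' => W.cl_abel hJ hh hh', fun a h hh x hx => W.cl_eig hA hJ hh hx, fun a ha hS => W.cl_b hA hJ ha hS, fun χ β h1 h2 h3 => W.cl_c hA hJ h1 h2 h3⟩
end WD
end
section
variable {k S V : Type*} [Field k] [IsAlgClosed k] [LieRing S] [LieAlgebra k S]
    [AddCommGroup V] [Module k V] [LieRingModule S V] [LieModule k S V] {p : ℕ}
    [Fact p.Prime] [CharP k p] [FiniteDimensional k S] [FiniteDimensional k V]
namespace WDfin
open LieModule LieAlgebra
theorem lin {H M : Type*} [LieRing H] [LieAlgebra k H] [LieRing.IsNilpotent H] [AddCommGroup M] [Module k M]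
    [LieRingModule H M] [LieModule k H M] [FiniteDimensional k M] (hd : finrank k M < p)
    (χ : H → k) (h : genWeightSpace M χ ≠ ⊥) : ∃ f : H →ₗ[k] k, (⇑f : H → k) = χ := by
  have h1 := trace_comp_toEnd_genWeightSpace_eq k H M χ
  have h0 := zero_lt_finrank_genWeightSpace h
  have h2 : finrank k (genWeightSpace M χ) ≤ finrank k M :=
    Submodule.finrank_le (genWeightSpace M χ).toSubmodule
  have hn : (finrank k (genWeightSpace M χ) : k) ≠ 0 := by
    intro h3
    rw [cast_eq_zero_iff k p] at h3
    exact absurd (Nat.le_of_dvd h0 h3) (by omega)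
  refine ⟨(finrank k (genWeightSpace M χ) : k)⁻¹ • (LinearMap.trace k _ ∘ₗ (toEnd k H (genWeightSpace M χ)).toLinearMap), ?_⟩
  funext x
  have h4 := congrFun h1 x
  rw [LinearMap.smul_apply, h4, Pi.smul_apply, nsmul_eq_mul, smul_eq_mul, inv_mul_cancel_left₀ hn]
def gw (H : LieSubalgebra k S) [H.IsCartanSubalgebra] (M : Type*) [AddCommGroup M] [Module k M]
    [LieRingModule S M] [LieModule k S M] (χ : Dual k H) : Submodule k M :=
  (genWeightSpace M (⇑χ : H → k)).toSubmodule
def evv (H : LieSubalgebra k S) (π : S →ₗ[k] H) : Dual k H →ₗ[k] Dual k S := π.dualMap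
theorem gw0 (H : LieSubalgebra k S) [H.IsCartanSubalgebra] : gw H S 0 = H.toSubmodule := by
  change (rootSpace H (0 : H → k)).toSubmodule = _
  rw [rootSpace_zero_eq]
  rfl
theorem gm (H : LieSubalgebra k S) [H.IsCartanSubalgebra] (π : S →ₗ[k] H) (hπ : ∀ x : H, π x = x) (M : Type*) [AddCommGroup M] [Module k M]
    [LieRingModule S M] [LieModule k S M] [FiniteDimensional k M]
    (hl : ∀ χ : H → k, genWeightSpace M χ ≠ ⊥ → ∃ f : H →ₗ[k] k, (⇑f : H → k) = χ) :
    GM (gw H S) (evv H π) (gw H M) where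
  top := by
    have h := iSup_genWeightSpace_eq_top k H M
    rw [← LieSubmodule.iSup_toSubmodule_eq_top] at h
    rw [eq_top_iff, ← h]
    apply iSup_le
    intro χ
    by_cases hc : genWeightSpace M χ = ⊥
    · rw [hc]; simp
    · obtain ⟨f, rfl⟩ := hl χ hc
      exact le_iSup (gw H M) f
  ind := by
    have h := LieSubmodule.iSupIndep_toSubmodule.mpr (iSupIndep_genWeightSpace k H M)
    exact h.comp (f := fun χ : Dual k H => (⇑χ : H → k)) DFunLike.coe_injective
  lie := by
    intro a b x m hx hm
    exact lie_mem_genWeightSpace_of_mem_genWeightSpace hx hm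
  nil := by
    intro a h m hh hm
    rw [gw0] at hh
    have h1 := (mem_genWeightSpace M _ m).1 hm ⟨h, hh⟩
    have h2 : evv H π a h = a ⟨h, hh⟩ := by
      change a (π h) = _
      rw [hπ ⟨h, hh⟩]
    rw [h2]
    exact h1
theorem neb {H M : Type*} [LieRing H] [LieAlgebra k H] [AddCommGroup M] [Module k M]
    [LieRingModule H M] [LieModule k H M] (N : LieSubmodule k H M) : N ≠ ⊥ ↔ ∃ x ∈ N, x ≠ 0 := by
  rw [Ne, LieSubmodule.eq_bot_iff]
  push Not
  rfl
theorem linS (H : LieSubalgebra k S) [H.IsCartanSubalgebra] (hd : finrank k V < p) (hf : ∀ x : S, (∀ v : V, ⁅x, v⁆ = 0) → x = 0) (α : H → k) (h : genWeightSpace S α ≠ ⊥) : ∃ f : H →ₗ[k] k, (⇑f : H → k) = α := by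
  obtain ⟨x, hx, hx0⟩ := (neb _).1 h
  have : ∃ χ : H → k, ∃ v ∈ genWeightSpace V χ, ⁅x, v⁆ ≠ 0 := by
    by_contra hc
    push Not at hc
    apply hx0
    apply hf
    intro v
    have h := iSup_genWeightSpace_eq_top k H V
    rw [← LieSubmodule.iSup_toSubmodule_eq_top] at h
    have h1 : (⨆ χ : H → k, (genWeightSpace V χ).toSubmodule) ≤ LinearMap.ker (toEnd k S V x) :=
      iSup_le fun χ v hv => hc χ v hv
    exact h1 (h ▸ Submodule.mem_top : v ∈ (⨆ χ : H → k, (genWeightSpace V χ).toSubmodule))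
  obtain ⟨χ, v, hv, hxv⟩ := this
  have h1 := lie_mem_genWeightSpace_of_mem_genWeightSpace hx hv
  obtain ⟨f, hf⟩ := lin (p := p) hd χ ((neb _).2 ⟨v, hv, by rintro rfl; simp at hxv⟩)
  obtain ⟨g, hg⟩ := lin (p := p) hd (α + χ) ((neb _).2 ⟨_, h1, hxv⟩)
  refine ⟨g - f, ?_⟩
  funext y
  rw [LinearMap.sub_apply, hf, hg]
  simp
theorem mkWD (H : LieSubalgebra k S) [H.IsCartanSubalgebra] (π : S →ₗ[k] H) (hπ : ∀ x : H, π x = x) (hd : finrank k V < p) (hf : ∀ x : S, (∀ v : V, ⁅x, v⁆ = 0) → x = 0) : WD p (gw H S) (gw H V) (evv H π) where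
  sS := gm H π hπ S (linS (p := p) H hd hf)
  sV := gm H π hπ V (lin (p := p) hd)
  dim := hd
  faithful := hf
  inj := by
    intro a ha
    ext x
    have := ha x (by rw [gw0]; exact x.2)
    change a (π x) = 0 at this
    rwa [hπ] at this
theorem cwsEq (H : LieSubalgebra k S) [H.IsCartanSubalgebra] (π : S →ₗ[k] H) (hπ : ∀ x : H, π x = x) (W : WD p (gw H S) (gw H V) (evv H π)) (C : W.CL) (χ : H →ₗ[k] k) : charWeightSpace k H χ S = gw H S χ := by
  apply le_antisymm
  · intro v hv
    exact weightSpace_le_genWeightSpace S (⇑χ : H → k) ((mem_weightSpace _ v).2 hv)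
  · intro v hv x
    have := C.eig χ x (by rw [gw0]; exact x.2) v hv
    rw [this]
    change χ (π x) • v = _
    rw [hπ]
theorem main (hsimple : LieAlgebra.IsSimple k S) (hfaithful : ∀ x : S, (∀ v : V, ⁅x, v⁆ = 0) → x = 0) (hirr : LieModule.IsIrreducible k S V) (hdim : finrank k V ≤ p - 1) :
    IsClassicalSimpleLieAlgebra k S ∨ Nonempty (S ≃ₗ⁅k⁆ WittAlg p k 1) := by
  have hpp : p.Prime := Fact.out
  have hp1 := hpp.two_le
  have hd : finrank k V < p := by omega
  have hs := hsimple.eq_bot_or_eq_top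
  have hna := hsimple.non_abelian
  have hp2 : 2 < p := by
    by_contra hc
    have hV1 : finrank k V ≤ 1 := by omega
    apply hna
    refine ⟨fun x y => hfaithful _ fun v => ?_⟩
    obtain ⟨w, hw⟩ := finrank_le_one_iff.1 hV1
    obtain ⟨c, rfl⟩ := hw v
    obtain ⟨a, ha⟩ := hw ⁅x, w⁆
    obtain ⟨b, hb⟩ := hw ⁅y, w⁆
    rw [lie_smul, lie_lie, ← ha, ← hb, lie_smul, lie_smul, ← ha, ← hb, smul_comm a b, sub_self, smul_zero]
  have hder : ⁅(⊤ : LieIdeal k S), (⊤ : LieIdeal k S)⁆ = ⊤ := by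
    rcases hs ⁅(⊤ : LieIdeal k S), (⊤ : LieIdeal k S)⁆ with h | h
    · exfalso
      apply hna
      refine ⟨fun x y => ?_⟩
      have := LieSubmodule.lie_mem_lie (LieSubmodule.mem_top (R := k) (L := S) (M := S) x) (LieSubmodule.mem_top (R := k) (L := S) (M := S) y)
      rw [h] at this
      exact (LieSubmodule.mem_bot _).1 this
    · exact h
  have hcen : LieAlgebra.center k S = ⊥ := by
    rcases hs (LieAlgebra.center k S) with h | h
    · exact h
    · exfalso
      apply hna
      refine ⟨fun x y => ?_⟩
      have : y ∈ LieAlgebra.center k S := by rw [h]; exact LieSubmodule.mem_top _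
      exact (LieModule.mem_maxTrivSubmodule k S S y).1 this x
  have htr : ∀ x : S, LinearMap.trace k V (toEnd k S V x) = 0 := by
    intro x
    have hx : x ∈ ⁅(⊤ : LieIdeal k S), (⊤ : LieIdeal k S)⁆ := by rw [hder]; exact LieSubmodule.mem_top _
    rw [← LieSubmodule.mem_toSubmodule, LieSubmodule.lieIdeal_oper_eq_linear_span'] at hx
    induction hx using span_induction with
    | mem z hz =>
      obtain ⟨a, _, b, _, rfl⟩ := hz
      rw [LieHom.map_lie]
      exact LinearMap.trace_lie _ _
    | zero => simp
    | add a b _ _ ha hb => rw [map_add, map_add, ha, hb, add_zero]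
    | smul c a _ ha => rw [map_smul, map_smul, ha, smul_zero]
  have hV : ∀ w : V, (∀ x : S, ⁅x, w⁆ = 0) → w = 0 := by
    intro w hw
    rcases hirr.eq_bot_or_eq_top (LieModule.maxTrivSubmodule k S V) with h | h
    · have : w ∈ LieModule.maxTrivSubmodule k S V := hw
      rw [h] at this
      exact (LieSubmodule.mem_bot _).1 this
    · exfalso
      apply hna
      refine ⟨fun x y => hfaithful _ fun v => ?_⟩
      have : v ∈ LieModule.maxTrivSubmodule k S V := by rw [h]; exact LieSubmodule.mem_top _
      exact this _
  have hV0 : ∃ w : V, w ≠ 0 := by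
    by_contra hc
    push Not at hc
    apply hna
    exact ⟨fun x y => hfaithful _ fun v => hc _⟩
  haveI : Infinite k := IsAlgClosed.instInfinite
  obtain ⟨x, hx⟩ := LieAlgebra.exists_isCartanSubalgebra_engel k S
  generalize LieSubalgebra.engel k x = H at hx
  haveI := hx
  obtain ⟨π, hπ⟩ := LinearMap.exists_leftInverse_of_injective H.toSubmodule.subtype (by simp)
  have hπ' : ∀ x : H, π x = x := fun x => congr_fun hπ x
  let W := mkWD (p := p) (V := V) H π hπ' hd hfaithful
  rcases W.dichotomy hp2 hs hV hV0 htr with C | h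
  · left
    have hE := cwsEq H π hπ' W C
    refine ⟨?_, hcen, H, hx, ?_, ?_, ?_, ?_⟩
    · rw [LieAlgebra.derivedSeries_def, LieAlgebra.derivedSeriesOfIdeal_succ, LieAlgebra.derivedSeriesOfIdeal_zero]
      exact hder
    · refine ⟨fun x y => Subtype.ext ?_⟩
      exact C.abel x (by rw [gw0]; exact x.2) y (by rw [gw0]; exact y.2)
    · rw [iSup_congr hE]
      exact W.sS.top
    · intro χ h0 h1
      rw [hE] at h1
      rw [hE, hE]
      exact C.b χ h0 h1
    · intro χ β h1 h2 h3
      rw [hE] at h1 h2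
      obtain ⟨m, hm⟩ := C.c χ β h1 h2 h3
      exact ⟨m, by rw [hE]; exact hm⟩
  · exact Or.inr h
end WDfin
end
end Main
/-- a result of [S0], quoted in Example 2.9.  If a finite-dimensional
simple Lie algebra `S` over `k` possesses a faithful irreducible representation of
dimension at most `p − 1`, then `S` is either a classical simple Lie algebra or the Witt
algebra `W(1)`. -/
theorem simple_with_small_faithful_irreducible_classical_or_witt
    (p : ℕ) (hp : p.Prime)
    (k : Type*) [Field k] [IsAlgClosed k] [CharP k p]
    (S : Type*) [LieRing S] [LieAlgebra k S] [FiniteDimensional k S]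
    (hsimple : LieAlgebra.IsSimple k S)
    (V : Type*) [AddCommGroup V] [Module k V] [LieRingModule S V] [LieModule k S V]
    [FiniteDimensional k V]
    (hfaithful : ∀ x : S, (∀ v : V, ⁅x, v⁆ = 0) → x = 0)
    (hirr : LieModule.IsIrreducible k S V)
    (hdim : Module.finrank k V ≤ p - 1) :
    IsClassicalSimpleLieAlgebra k S ∨ Nonempty (S ≃ₗ⁅k⁆ WittAlg p k 1) := by
  haveI := Fact.mk hp
  exact WDfin.main hsimple hfaithful hirr hdim
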